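/- There exist constants 0 < c ≤ C < ∞ such that for all integers n ≥ 1 and all y ∈ Γ_{H(n)}, c/n ≤ P(L(y, H(n))) ≤ C/n. -/

import Mathlib

/-!
Critical site percolation on the triangular lattice realized on `ℤ²`.
A configuration assigns to each site `true` (open) or `false` (closed),
and `P` is the product Bernoulli(1/2) measure, axiomatized by
`IsBernoulliHalf` below (finite cylinder events have product probability).
-/

open MeasureTheory
open scoped ENNReal

/-- Sites of the lattice: vertices of `ℤ²`. -/
abbrev Site : Type := ℤ × ℤ

/-- A percolation configuration: `true` = open, `false` = closed. -/
abbrev Config : Type := Site → Bool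

/-- Adjacency for the triangular lattice realized on `ℤ²`:
the neighbors of `(x,y)` are `(x±1,y)`, `(x,y±1)`, `(x+1,y-1)`, `(x-1,y+1)`. -/
def Adj (a b : Site) : Prop :=
  (b.1 - a.1, b.2 - a.2) ∈
    ({(1, 0), (-1, 0), (0, 1), (0, -1), (1, -1), (-1, 1)} : Set (ℤ × ℤ))

/-- A (nonempty, self-avoiding) lattice path: a list of distinct sites in which
consecutive sites are neighbors. -/
def IsPath (p : List Site) : Prop := p ≠ [] ∧ p.Nodup ∧ p.Chain' Adj

/-- A path all of whose vertices lie in the set `S`. -/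
def PathIn (S : Set Site) (p : List Site) : Prop := IsPath p ∧ ∀ v ∈ p, v ∈ S

/-- All sites of `p` are open in `ω`. -/
def IsOpenOn (ω : Config) (p : List Site) : Prop := ∀ v ∈ p, ω v = true

/-- All sites of `p` are closed in `ω`. -/
def IsClosedOn (ω : Config) (p : List Site) : Prop := ∀ v ∈ p, ω v = false

/-- The first vertex of `p` lies in `A`. -/
def FirstIn (A : Set Site) (p : List Site) : Prop := ∃ a ∈ A, p.head? = some a

/-- The last vertex of `p` lies in `A`. -/
def LastIn (A : Set Site) (p : List Site) : Prop := ∃ a ∈ A, p.getLast? = some a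

/-- `μ` is the product Bernoulli(1/2) measure on configurations: a probability
measure for which every finite cylinder event has the product probability. -/
def IsBernoulliHalf (μ : Measure Config) : Prop :=
  IsProbabilityMeasure μ ∧
    ∀ (S : Finset Site) (f : Site → Bool),
      μ {ω | ∀ v ∈ S, ω v = f v} = (1 / 2 : ℝ≥0∞) ^ S.card

/-- The lattice rectangle `[x₀,x₁] × [y₀,y₁]`. -/
def rect (x₀ x₁ y₀ y₁ : ℤ) : Set Site :=
  {v | x₀ ≤ v.1 ∧ v.1 ≤ x₁ ∧ y₀ ≤ v.2 ∧ v.2 ≤ y₁}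

/-- The left side of a rectangle. -/
def rectLeft (x₀ x₁ y₀ y₁ : ℤ) : Set Site := {v ∈ rect x₀ x₁ y₀ y₁ | v.1 = x₀}

/-- The right side of a rectangle. -/
def rectRight (x₀ x₁ y₀ y₁ : ℤ) : Set Site := {v ∈ rect x₀ x₁ y₀ y₁ | v.1 = x₁}

/-- The top side of a rectangle. -/
def rectTop (x₀ x₁ y₀ y₁ : ℤ) : Set Site := {v ∈ rect x₀ x₁ y₀ y₁ | v.2 = y₁}

/-- The bottom side of a rectangle. -/
def rectBot (x₀ x₁ y₀ y₁ : ℤ) : Set Site := {v ∈ rect x₀ x₁ y₀ y₁ | v.2 = y₀}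

/-- A horizontal open crossing of the rectangle `[x₀,x₁] × [y₀,y₁]`:
an open path in the rectangle from its left side to its right side. -/
def HorizCrossing (x₀ x₁ y₀ y₁ : ℤ) (ω : Config) (p : List Site) : Prop :=
  PathIn (rect x₀ x₁ y₀ y₁) p ∧ IsOpenOn ω p ∧
    FirstIn (rectLeft x₀ x₁ y₀ y₁) p ∧ LastIn (rectRight x₀ x₁ y₀ y₁) p

/-- The set of sites of the rectangle lying on or beneath the path `q`: sites
that are on `q` or cannot be joined to the top side of the rectangle by a
lattice path avoiding `q`. -/
def OnOrBelow (x₀ x₁ y₀ y₁ : ℤ) (q : List Site) : Set Site :=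
  {v ∈ rect x₀ x₁ y₀ y₁ | v ∈ q ∨
    ¬ ∃ r : List Site, PathIn (rect x₀ x₁ y₀ y₁ \ {w | w ∈ q}) r ∧
        r.head? = some v ∧ LastIn (rectTop x₀ x₁ y₀ y₁) r}

/-- `p` is the lowest horizontal open crossing of the rectangle: it is a
horizontal open crossing lying on or beneath every horizontal open crossing. -/
def IsLowestCrossing (x₀ x₁ y₀ y₁ : ℤ) (ω : Config) (p : List Site) : Prop :=
  HorizCrossing x₀ x₁ y₀ y₁ ω p ∧
    ∀ q, HorizCrossing x₀ x₁ y₀ y₁ ω q → ∀ v ∈ p, v ∈ OnOrBelow x₀ x₁ y₀ y₁ q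

/-! ### Connectivity in sets of sites -/

theorem adj_iff {a b : Site} : Adj a b ↔
    (b.1 = a.1 + 1 ∧ b.2 = a.2) ∨ (b.1 = a.1 - 1 ∧ b.2 = a.2) ∨
    (b.1 = a.1 ∧ b.2 = a.2 + 1) ∨ (b.1 = a.1 ∧ b.2 = a.2 - 1) ∨
    (b.1 = a.1 + 1 ∧ b.2 = a.2 - 1) ∨ (b.1 = a.1 - 1 ∧ b.2 = a.2 + 1) := by
  simp only [Adj, Set.mem_insert_iff, Set.mem_singleton_iff, Prod.mk.injEq]
  omega

theorem Adj.symm {a b : Site} (h : Adj a b) : Adj b a := by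
  rw [adj_iff] at *; omega

/-- `b` is reachable from `a` by a lattice walk inside `S`. -/
def Conn (S : Set Site) (a b : Site) : Prop :=
  a ∈ S ∧ Relation.ReflTransGen (fun u v => Adj u v ∧ v ∈ S) a b

namespace Conn

variable {S T : Set Site} {a b c : Site}

theorem refl (h : a ∈ S) : Conn S a a := ⟨h, .refl⟩

theorem left_mem (h : Conn S a b) : a ∈ S := h.1

theorem tail (h : Conn S a b) (hbc : Adj b c) (hc : c ∈ S) : Conn S a c :=
  ⟨h.1, h.2.tail ⟨hbc, hc⟩⟩

/-- Induction along a walk, extending at its end. -/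
@[elab_as_elim]
theorem ind {P : Site → Prop} (h : Conn S a b) (h0 : P a)
    (hs : ∀ u v, Conn S a u → Adj u v → v ∈ S → P u → P v) : P b := by
  obtain ⟨ha, h⟩ := h
  induction h with
  | refl => exact h0
  | tail h1 h2 ih => exact hs _ _ ⟨ha, h1⟩ h2.1 h2.2 ih

theorem right_mem (h : Conn S a b) : b ∈ S :=
  h.ind h.1 fun _ _ _ _ hv _ => hv

theorem trans (h : Conn S a b) (h' : Conn S b c) : Conn S a c := ⟨h.1, h.2.trans h'.2⟩

theorem of_adj (ha : a ∈ S) (hb : b ∈ S) (h : Adj a b) : Conn S a b := (refl ha).tail h hb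

theorem symm (h : Conn S a b) : Conn S b a :=
  h.ind (P := fun x => Conn S x a) (refl h.1)
    fun _ _ hu huv hv ih => (of_adj hv hu.right_mem huv.symm).trans ih

theorem mono (hST : S ⊆ T) (h : Conn S a b) : Conn T a b :=
  h.ind (refl (hST h.1)) fun _ _ _ huv hv ih => ih.tail huv (hST hv)

/-- The walk stays in any set closed under steps. -/
theorem restrict (h : Conn S a b) {Q : Set Site} (ha : a ∈ Q)
    (hQ : ∀ u v, Conn S a u → u ∈ Q → Adj u v → v ∈ S → v ∈ Q) : Conn (S ∩ Q) a b := by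
  refine (h.ind (P := fun x => Conn (S ∩ Q) a x) (refl ⟨h.1, ha⟩) ?_)
  intro u v hu huv hv ih
  exact ih.tail huv ⟨hv, hQ u v hu ih.right_mem.2 huv hv⟩

/-- A walk lives in the connected component of its starting point. -/
theorem in_cluster (h : Conn S a b) : Conn {x | Conn S a x} a b :=
  (h.restrict (Q := {x | Conn S a x}) (refl h.1) fun _ _ _ hu huv hv => hu.tail huv hv).mono
    Set.inter_subset_right

/-- First exit from `Q`. -/
theorem exit (h : Conn S a b) {Q : Set Site} (ha : a ∈ Q) (hb : b ∉ Q) :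
    ∃ c c', Conn (S ∩ Q) a c ∧ Adj c c' ∧ c' ∈ S ∧ c' ∉ Q ∧ Conn S c' b := by
  by_contra hcon
  push Not at hcon
  have key : Conn (S ∩ Q) a b := by
    refine h.ind (P := fun x => Conn (S ∩ Q) a x) (refl ⟨h.1, ha⟩) ?_
    intro u v hu huv hv ih
    by_cases hvQ : v ∈ Q
    · exact ih.tail huv ⟨hv, hvQ⟩
    · exact absurd ((hu.tail huv hv).symm.trans h) (hcon u v ih huv hv hvQ)
  exact hb key.right_mem.2

/-- Last visit to the complement of `Q`. -/
theorem entry (h : Conn S a b) {Q : Set Site} (ha : a ∉ Q) (hb : b ∈ Q) :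
    ∃ c c', Conn S a c ∧ c ∉ Q ∧ Adj c c' ∧ Conn (S ∩ Q) c' b := by
  obtain ⟨c, c', h1, h2, h3, h4, h5⟩ := h.symm.exit hb ha
  exact ⟨c', c, h5.symm, h4, h2.symm, h1.symm⟩

/-- A walk from `A` to `B` contains an excursion between `A` and `B` avoiding both, or a step
between them. -/
theorem between (h : Conn S a b) {A B : Set Site} (ha : a ∈ A) (hb : b ∈ B)
    (hdis : ∀ x ∈ S, x ∈ A → x ∉ B) (hadj : ∀ x ∈ S, ∀ y ∈ S, x ∈ A → y ∈ B → ¬ Adj x y) :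
    ∃ a0 a' b' b0, a0 ∈ A ∧ a0 ∈ S ∧ b0 ∈ B ∧ b0 ∈ S ∧ Adj a0 a' ∧ Adj b' b0 ∧
      Conn (S \ (A ∪ B)) a' b' := by
  obtain ⟨c, c', h1, h2, h3, h4, h5⟩ := h.exit (Q := Bᶜ)
    (hdis a h.1 ha) (by simpa using hb)
  have hc'B : c' ∈ B := by simpa using h4
  by_cases hcA : c ∈ A
  · exact absurd h2 (hadj c h1.right_mem.1 c' h3 hcA hc'B)
  obtain ⟨d, d', g1, g2, g3, g4⟩ := h1.entry (Q := Aᶜ) (by simpa using ha) hcA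
  refine ⟨d, d', c, c', by simpa using g2, g1.right_mem.1, hc'B, h3, g3, h2, g4.mono ?_⟩
  rintro x ⟨⟨h1, h2⟩, h3⟩
  exact ⟨h1, fun h => h.elim h3 h2⟩

end Conn

/-- A walk along which `f` changes by steps at most `d` has a piece crossing the window
`[lo, hi]`. -/
theorem Conn.window {S : Set Site} {a b : Site} (h : Conn S a b) (f : Site → ℤ) (d : ℤ)
    (hf : ∀ u v, Adj u v → f v ≤ f u + d) {lo hi : ℤ} (hlh : lo + d ≤ hi)
    (ha : f a < lo + d) (hb : hi - d < f b) :
    ∃ c c', f c < lo + d ∧ hi - d < f c' ∧ Conn (S ∩ {v | lo ≤ f v ∧ f v ≤ hi}) c c' := by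
  obtain ⟨c, c', hc, hcc', hc'⟩ : ∃ c c', Conn (S ∩ {v | f v ≤ hi}) c c' ∧ f c < lo + d ∧
      hi - d < f c' := by
    by_cases hbh : f b ≤ hi
    · by_cases hah : ∃ c c', Conn (S ∩ {v | f v ≤ hi}) a c ∧ Adj c c' ∧ hi < f c'
      · obtain ⟨c, c', h1, h2, h3⟩ := hah
        exact ⟨a, c, h1, ha, by have := hf _ _ h2; omega⟩
      · push Not at hah
        refine ⟨a, b, ?_, ha, hb⟩
        by_contra hcon
        have : Conn (S ∩ {v | f v ≤ hi}) a b := by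
          refine h.ind (P := fun x => Conn (S ∩ {v | f v ≤ hi}) a x)
            (.refl ⟨h.1, by simp; omega⟩) ?_
          intro u v hu huv hv ih
          exact ih.tail huv ⟨hv, hah u v ih huv⟩
        exact hcon this
    · obtain ⟨c, c', h1, h2, h3, h4, h5⟩ := h.exit (Q := {v | f v ≤ hi})
        (by simp; omega) (by simpa using hbh)
      have := hf _ _ h2
      simp only [Set.mem_ofPred_eq, not_le] at h4
      exact ⟨a, c, h1, ha, by omega⟩
  by_cases hcl : ∃ e e', Conn (S ∩ {v | f v ≤ hi} ∩ {v | lo ≤ f v}) e c' ∧ Adj e' e ∧ f e' < lo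
  · obtain ⟨e, e', h1, h2, h3⟩ := hcl
    exact ⟨e, c', by have := hf _ _ h2; omega, hc', h1.mono fun x hx => ⟨hx.1.1, hx.2, hx.1.2⟩⟩
  · push Not at hcl
    have : Conn (S ∩ {v | f v ≤ hi} ∩ {v | lo ≤ f v}) c c' := by
      refine hc.symm.ind (P := fun x => Conn (S ∩ {v | f v ≤ hi} ∩ {v | lo ≤ f v}) x c')
        (.refl ⟨hc.right_mem, by simp; omega⟩) ?_
      intro u v hu huv hv ih
      have hv' : v ∈ S ∩ {v | f v ≤ hi} ∩ {v | lo ≤ f v} := ⟨hv, hcl u v ih huv.symm⟩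
      exact (Conn.of_adj hv' ih.left_mem huv.symm).trans ih
    exact ⟨c, c', hcc', hc', this.mono fun x hx => ⟨hx.1.1, hx.2, hx.1.2⟩⟩

/-! ### Walks and lists -/

theorem Conn.of_isChain {S : Set Site} : ∀ {l : List Site} {a b : Site}, l.IsChain Adj →
    (∀ v ∈ l, v ∈ S) → l.head? = some a → l.getLast? = some b → Conn S a b := by
  intro l
  induction l with
  | nil => simp
  | cons x l ih =>
    intro a b hc hS ha hb
    simp only [List.head?_cons, Option.some.injEq] at ha
    subst ha
    cases l with
    | nil =>
      simp only [List.getLast?_singleton, Option.some.injEq] at hb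
      subst hb
      exact .refl (hS _ (by simp))
    | cons y l =>
      rw [List.isChain_cons_cons] at hc
      refine (Conn.of_adj (hS _ (by simp)) (hS y (by simp)) hc.1).trans
        (ih hc.2 (fun v hv => hS v (by simp [hv])) rfl ?_)
      simpa using hb

theorem Conn.exists_path {S : Set Site} {a b : Site} (h : Conn S a b) :
    ∃ p, PathIn S p ∧ p.head? = some a ∧ p.getLast? = some b := by
  refine h.symm.ind (P := fun x => ∃ p, PathIn S p ∧ p.head? = some x ∧ p.getLast? = some b)
    ⟨[b], ⟨⟨by simp, by simp, List.isChain_singleton _⟩, by simpa using h.right_mem⟩, rfl, rfl⟩ ?_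
  rintro u v hu huv hv ⟨p, ⟨⟨hne, hnd, hch⟩, hpS⟩, hh, hl⟩
  by_cases hvp : v ∈ p
  · obtain ⟨s, t, rfl⟩ := List.append_of_mem hvp
    refine ⟨v :: t, ⟨⟨by simp, ?_, ?_⟩, ?_⟩, rfl, ?_⟩
    · exact (List.nodup_append.1 hnd).2.1
    · exact (List.isChain_append.1 hch).2.1
    · exact fun w hw => hpS w (by simp only [List.mem_append]; exact Or.inr hw)
    · rwa [List.getLast?_append_of_ne_nil _ (by simp)] at hl
  · cases p with
    | nil => simp at hne
    | cons x p =>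
      simp only [List.head?_cons, Option.some.injEq] at hh
      subst hh
      refine ⟨v :: x :: p, ⟨⟨by simp, List.nodup_cons.2 ⟨hvp, hnd⟩,
        List.isChain_cons_cons.2 ⟨huv.symm, hch⟩⟩, ?_⟩, rfl, by simpa using hl⟩
      intro w hw
      rcases List.mem_cons.1 hw with rfl | hw
      · exact hv
      · exact hpS w hw

theorem PathIn.conn {S : Set Site} {p : List Site} {a b : Site} (h : PathIn S p)
    (ha : p.head? = some a) (hb : p.getLast? = some b) : Conn {v | v ∈ p} a b :=
  Conn.of_isChain h.1.2.2 (fun _ hv => hv) ha hb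

/-! ### Straight segments and rectangles -/

theorem conn_vert {S : Set Site} {x y y' : ℤ} (hy : y ≤ y')
    (h : ∀ z, y ≤ z → z ≤ y' → (x, z) ∈ S) : Conn S (x, y) (x, y') := by
  obtain ⟨k, rfl⟩ := Int.le.dest hy
  induction k with
  | zero => simpa using Conn.refl (h y le_rfl (by omega))
  | succ k ih =>
    refine (ih (by omega) fun z h1 h2 => h z h1 (by push_cast; omega)).tail ?_
      (h _ hy le_rfl)
    rw [adj_iff]; simp; omega

theorem conn_horiz {S : Set Site} {x x' y : ℤ} (hx : x ≤ x')
    (h : ∀ z, x ≤ z → z ≤ x' → (z, y) ∈ S) : Conn S (x, y) (x', y) := by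
  obtain ⟨k, rfl⟩ := Int.le.dest hx
  induction k with
  | zero => simpa using Conn.refl (h x le_rfl (by omega))
  | succ k ih =>
    refine (ih (by omega) fun z h1 h2 => h z h1 (by push_cast; omega)).tail ?_
      (h _ hx le_rfl)
    rw [adj_iff]; simp; omega

theorem conn_vert' {S : Set Site} {x y y' : ℤ}
    (h : ∀ z, min y y' ≤ z → z ≤ max y y' → (x, z) ∈ S) : Conn S (x, y) (x, y') := by
  rcases le_total y y' with hy | hy
  · exact conn_vert hy fun z h1 h2 => h z (by omega) (by omega)
  · exact (conn_vert hy fun z h1 h2 => h z (by omega) (by omega)).symm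

theorem conn_horiz' {S : Set Site} {x x' y : ℤ}
    (h : ∀ z, min x x' ≤ z → z ≤ max x x' → (z, y) ∈ S) : Conn S (x, y) (x', y) := by
  rcases le_total x x' with hy | hy
  · exact conn_horiz hy fun z h1 h2 => h z (by omega) (by omega)
  · exact (conn_horiz hy fun z h1 h2 => h z (by omega) (by omega)).symm

theorem conn_rect {x₀ x₁ y₀ y₁ : ℤ} {a b : Site} (ha : a ∈ rect x₀ x₁ y₀ y₁)
    (hb : b ∈ rect x₀ x₁ y₀ y₁) : Conn (rect x₀ x₁ y₀ y₁) a b := by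
  obtain ⟨a1, a2⟩ := a
  obtain ⟨b1, b2⟩ := b
  simp only [rect, Set.mem_ofPred_eq] at ha hb
  refine (conn_horiz' (x' := b1) ?_).trans (conn_vert' ?_) <;> intro z h1 h2 <;>
    simp only [rect, Set.mem_ofPred_eq] <;> omega

/-! ### Planarity: crossing potentials -/

theorem site_ne {a b : Site} : a ≠ b ↔ ¬(a.1 = b.1 ∧ a.2 = b.2) := by
  rw [Ne, Prod.ext_iff]

/-- Signed crossing of the step `a → b` with the vertical ray above `v`. -/
def chi (v a b : Site) : ℤ :=
  if a.1 = v.1 ∧ b.1 = v.1 + 1 ∧ v.2 < a.2 then 1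
  else if b.1 = v.1 ∧ a.1 = v.1 + 1 ∧ v.2 < b.2 then -1 else 0

/-- Indicator that `a` lies strictly above `w` in the same column. -/
def psi (w a : Site) : ℤ := if a.1 = w.1 ∧ w.2 < a.2 then 1 else 0

/-- Indicator that `a` lies strictly to the right of the column of `v`. -/
def rgt (v a : Site) : ℤ := if v.1 < a.1 then 1 else 0

theorem chi_vert {v w a b : Site} (hvw : Adj v w) (h1 : w.1 = v.1)
    (va : v ≠ a) (vb : v ≠ b) (wa : w ≠ a) (wb : w ≠ b) : chi v a b = chi w a b := by
  rw [adj_iff] at *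
  rw [site_ne] at *
  unfold chi
  split_ifs <;> omega

theorem chi_horiz {v w a b : Site} (hab : Adj a b) (hvw : Adj v w) (h1 : w.1 = v.1 + 1)
    (va : v ≠ a) (vb : v ≠ b) (wa : w ≠ a) (wb : w ≠ b) :
    chi v a b - chi w a b = psi w b - psi w a := by
  obtain ⟨v1, v2⟩ := v
  obtain ⟨w1, w2⟩ := w
  obtain ⟨a1, a2⟩ := a
  obtain ⟨b1, b2⟩ := b
  simp only [adj_iff, site_ne, chi, psi] at *
  subst h1
  have hw : w2 = v2 ∨ w2 = v2 - 1 := by omega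
  clear hvw
  rcases hab with h | h | h | h | h | h <;> obtain ⟨rfl, rfl⟩ := h <;>
    rcases hw with rfl | rfl <;> split_ifs <;> omega

theorem chi_diag {v w a b : Site} (hab : Adj a b) (h1 : w.1 = v.1 + 1) (h2 : w.2 = v.2 + 1)
    (va : v ≠ a) (vb : v ≠ b) (wa : w ≠ a) (wb : w ≠ b) (ua : a ≠ (v.1, v.2 + 1))
    (ub : b ≠ (v.1, v.2 + 1)) :
    chi v a b - chi w a b = psi w b - psi w a := by
  obtain ⟨v1, v2⟩ := v
  obtain ⟨w1, w2⟩ := w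
  obtain ⟨a1, a2⟩ := a
  obtain ⟨b1, b2⟩ := b
  simp only [adj_iff, site_ne, chi, psi] at *
  subst h1 h2
  rcases hab with h | h | h | h | h | h <;> obtain ⟨rfl, rfl⟩ := h <;> split_ifs <;> omega

theorem chi_below {v a b : Site} (hab : Adj a b) (ha : v.2 < a.2) (hb : v.2 < b.2) :
    chi v a b = rgt v b - rgt v a := by
  rw [adj_iff] at *
  unfold chi rgt
  split_ifs <;> omega

theorem chi_zero {v a b : Site}
    (h : (a.2 ≤ v.2 ∧ b.2 ≤ v.2) ∨ (a.1 ≤ v.1 ∧ b.1 ≤ v.1) ∨ (v.1 < a.1 ∧ v.1 < b.1)) :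
    chi v a b = 0 := by
  unfold chi
  split_ifs <;> omega

/-- The signed number of crossings of a walk with vertical rays, as a function of the foot of
the ray. -/
theorem Conn.exists_potential {S : Set Site} {a b : Site} (h : Conn S a b) :
    ∃ F : Site → ℤ,
      (∀ v w, v ∉ S → w ∉ S → Adj v w → w.1 = v.1 → F v = F w) ∧
      (∀ v w, v ∉ S → w ∉ S → Adj v w → w.1 = v.1 + 1 → F v - F w = psi w b - psi w a) ∧
      (∀ v w : Site, v ∉ S → w ∉ S → (v.1, v.2 + 1) ∉ S → w.1 = v.1 + 1 → w.2 = v.2 + 1 →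
        F v - F w = psi w b - psi w a) ∧
      (∀ v : Site, (∀ s ∈ S, v.2 < s.2) → F v = rgt v b - rgt v a) ∧
      (∀ v : Site, ((∀ s ∈ S, s.2 ≤ v.2) ∨ (∀ s ∈ S, s.1 ≤ v.1) ∨ ∀ s ∈ S, v.1 < s.1) →
        F v = 0) := by
  refine h.ind ⟨fun _ => 0, by simp, by simp, by simp, by simp, by simp⟩ ?_
  rintro c d hc hcd hd ⟨F, h1, h2, h3, h4, h5⟩
  have hcS := hc.right_mem
  have ne : ∀ v, v ∉ S → v ≠ c ∧ v ≠ d := fun v hv =>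
    ⟨fun h => hv (h ▸ hcS), fun h => hv (h ▸ hd)⟩
  refine ⟨fun v => F v + chi v c d, ?_, ?_, ?_, ?_, ?_⟩
  · intro v w hv hw hvw e
    have := h1 v w hv hw hvw e
    have := chi_vert hvw e (ne v hv).1 (ne v hv).2 (ne w hw).1 (ne w hw).2
    simp only; omega
  · intro v w hv hw hvw e
    have := h2 v w hv hw hvw e
    have := chi_horiz hcd hvw e (ne v hv).1 (ne v hv).2 (ne w hw).1 (ne w hw).2
    simp only; omega
  · intro v w hv hw hu e e'
    have := h3 v w hv hw hu e e'
    have := chi_diag hcd e e' (ne v hv).1 (ne v hv).2 (ne w hw).1 (ne w hw).2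
      (ne _ hu).1.symm (ne _ hu).2.symm
    simp only; omega
  · intro v hv
    have := h4 v hv
    have := chi_below hcd (hv _ hcS) (hv _ hd)
    simp only; omega
  · intro v hv
    have h6 := h5 v hv
    have : chi v c d = 0 := chi_zero <| hv.imp (fun h => ⟨h _ hcS, h _ hd⟩) <|
      Or.imp (fun h => ⟨h _ hcS, h _ hd⟩) fun h => ⟨h _ hcS, h _ hd⟩
    simp only; omega

theorem Conn.const {S : Set Site} {a b : Site} (h : Conn S a b) {F : Site → ℤ}
    (hF : ∀ u v, u ∈ S → v ∈ S → Adj u v → F u = F v) : F a = F b :=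
  h.ind rfl fun u v hu huv hv ih => ih.trans (hF u v hu.right_mem hv huv)

/-- Potentials are constant along walks avoiding a walk, provided the column changes do not
involve the endpoints. -/
theorem potential_const {S T : Set Site} {a b c d : Site} {F : Site → ℤ}
    (h1 : ∀ v w, v ∉ S → w ∉ S → Adj v w → w.1 = v.1 → F v = F w)
    (h2 : ∀ v w, v ∉ S → w ∉ S → Adj v w → w.1 = v.1 + 1 → F v - F w = psi w b - psi w a)
    (hT : Conn T c d) (hdis : ∀ v ∈ T, v ∉ S)
    (hab : ∀ v ∈ T, ∀ w ∈ T, w.1 = v.1 + 1 → psi w b = psi w a) : F c = F d := by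
  refine hT.const fun u v hu hv huv => ?_
  have hcol : v.1 = u.1 ∨ v.1 = u.1 + 1 ∨ u.1 = v.1 + 1 := by rw [adj_iff] at huv; omega
  rcases hcol with e | e | e
  · exact h1 u v (hdis u hu) (hdis v hv) huv e
  · have := h2 u v (hdis u hu) (hdis v hv) huv e
    have := hab u hu v hv e
    omega
  · have := h2 v u (hdis v hv) (hdis u hu) huv.symm e
    have := hab v hv u hu e
    omega

theorem Conn.cross_strict {S T : Set Site} {a a' b b' : Site} (hS : Conn S a a')
    (hT : Conn T b b') (h1 : ∀ v ∈ T, a.1 < v.1 ∧ v.1 < a'.1)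
    (h2 : ∀ v ∈ S, b.2 < v.2 ∧ v.2 < b'.2) : ∃ v ∈ S, v ∈ T := by
  by_contra hcon
  push Not at hcon
  obtain ⟨F, f1, f2, -, f4, f5⟩ := hS.exists_potential
  have key := potential_const f1 f2 hT (fun v hv hv' => hcon v hv' hv) (by
    intro v hv w hw _
    have := h1 w hw
    unfold psi
    rw [if_neg (by omega), if_neg (by omega)])
  rw [f4 b fun s hs => (h2 s hs).1, f5 b' (Or.inl fun s hs => (h2 s hs).2.le)] at key
  have := h1 b hT.left_mem
  unfold rgt at key
  rw [if_pos (by omega), if_neg (by omega)] at key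
  omega

/-- A left-right walk and a bottom-top walk meet. -/
theorem Conn.cross {S T : Set Site} {a a' b b' : Site} (hS : Conn S a a')
    (hT : Conn T b b') (h1 : ∀ v ∈ T, a.1 ≤ v.1 ∧ v.1 ≤ a'.1)
    (h2 : ∀ v ∈ S, b.2 ≤ v.2 ∧ v.2 ≤ b'.2) : ∃ v ∈ S, v ∈ T := by
  have hS' : Conn (S ∪ {(a.1 - 1, a.2), (a'.1 + 1, a'.2)}) (a.1 - 1, a.2) (a'.1 + 1, a'.2) :=
    ((Conn.of_adj (by simp) (Or.inl hS.left_mem) (by rw [adj_iff]; simp)).trans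
      (hS.mono Set.subset_union_left)).tail (by rw [adj_iff]; simp) (by simp)
  have hT' : Conn (T ∪ {(b.1, b.2 - 1), (b'.1, b'.2 + 1)}) (b.1, b.2 - 1) (b'.1, b'.2 + 1) :=
    ((Conn.of_adj (by simp) (Or.inl hT.left_mem) (by rw [adj_iff]; simp)).trans
      (hT.mono Set.subset_union_left)).tail (by rw [adj_iff]; simp) (by simp)
  have hb := h1 b hT.left_mem
  have hb' := h1 b' hT.right_mem
  have ha := h2 a hS.left_mem
  have ha' := h2 a' hS.right_mem
  obtain ⟨v, hv, hv'⟩ := hS'.cross_strict hT' (by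
    rintro v (hv | rfl | rfl)
    · have := h1 v hv; simp only; omega
    · simp only; omega
    · simp only; omega) (by
    rintro v (hv | rfl | rfl)
    · have := h2 v hv; simp only; omega
    · simp only; omega
    · simp only; omega)
  rcases hv with hv | rfl | rfl
  · rcases hv' with hv' | rfl | rfl
    · exact ⟨v, hv, hv'⟩
    · have := h2 _ hv; simp only at this; omega
    · have := h2 _ hv; simp only at this; omega
  · rcases hv' with hv' | hv' | hv'
    · have := h1 _ hv'; simp only at this; omega
    · simp only [Prod.mk.injEq] at hv'; omega
    · simp only [Set.mem_singleton_iff, Prod.mk.injEq] at hv'; omega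
  · rcases hv' with hv' | hv' | hv'
    · have := h1 _ hv'; simp only at this; omega
    · simp only [Prod.mk.injEq] at hv'; omega
    · simp only [Set.mem_singleton_iff, Prod.mk.injEq] at hv'; omega

/-- Twice the Euclidean abscissa of a site in the triangular embedding. -/
def lin (v : Site) : ℤ := 2 * v.1 + v.2

/-- Version of `Conn.cross` for vertical strips of the triangular embedding. -/
theorem Conn.cross_lin {S T : Set Site} {a a' b b' : Site} (hS : Conn S a a')
    (hT : Conn T b b') (h1 : ∀ v ∈ T, lin a - 1 ≤ lin v ∧ lin v ≤ lin a' + 1)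
    (h2 : ∀ v ∈ S, b.2 ≤ v.2 ∧ v.2 ≤ b'.2) (h3 : ∀ v ∈ T, b.2 ≤ v.2 ∧ v.2 ≤ b'.2) :
    ∃ v ∈ S, v ∈ T := by
  set m := min a.1 ((lin a - 1 - b'.2) / 2 - 1) with hm
  set m' := max a'.1 ((lin a' + 1 - b.2) / 2 + 1) with hm'
  have hR : Conn {v : Site | v.2 = a.2 ∧ v.1 ≤ a.1} (m, a.2) a :=
    conn_horiz (by omega) (by intro z _ hz; exact ⟨rfl, hz⟩)
  have hR' : Conn {v : Site | v.2 = a'.2 ∧ a'.1 ≤ v.1} a' (m', a'.2) :=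
    conn_horiz (by omega) (by intro z hz _; exact ⟨rfl, hz⟩)
  have ha := h2 a hS.left_mem
  have ha' := h2 a' hS.right_mem
  obtain ⟨v, hv, hvT⟩ := Conn.cross
    (S := {v : Site | v.2 = a.2 ∧ v.1 ≤ a.1} ∪ S ∪ {v : Site | v.2 = a'.2 ∧ a'.1 ≤ v.1})
    (((hR.mono (by intro v hv; exact Or.inl (Or.inl hv))).trans
      (hS.mono (by intro v hv; exact Or.inl (Or.inr hv)))).trans
      (hR'.mono (by intro v hv; exact Or.inr hv))) hT (by
    intro v hv
    have := h1 v hv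
    have := h3 v hv
    simp only [lin] at *
    omega) (by
    rintro v ((⟨hv, -⟩ | hv) | ⟨hv, -⟩)
    · omega
    · exact h2 v hv
    · omega)
  rcases hv with (⟨e, f⟩ | hv) | ⟨e, f⟩
  · have := h1 v hvT
    simp only [lin] at this
    have : v = a := Prod.ext (by omega) e
    exact ⟨v, this ▸ hS.left_mem, hvT⟩
  · exact ⟨v, hv, hvT⟩
  · have := h1 v hvT
    simp only [lin] at this
    have : v = a' := Prod.ext (by omega) e
    exact ⟨v, this ▸ hS.right_mem, hvT⟩

/-- A walk in a rectangle between two sites of its left column separates the sites of that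
column in between from the outside of the rectangle. -/
theorem Conn.leftSep {S T : Set Site} {x₀ x₁ y₀ y₁ u u' w : ℤ} {z : Site}
    (hS : Conn S (x₀, u) (x₀, u')) (hSr : S ⊆ rect x₀ x₁ y₀ y₁)
    (hT : Conn T (x₀, w) z) (hTr : ∀ v ∈ T, x₀ ≤ v.1) (hz : z ∉ rect x₀ x₁ y₀ y₁)
    (h1 : u < w) (h2 : w < u') : ∃ v ∈ S, v ∈ T := by
  by_contra hcon
  push Not at hcon
  obtain ⟨F, f1, f2, -, f4, f5⟩ := hS.exists_potential
  have key := potential_const f1 f2 hT (fun v hv hv' => hcon v hv' hv) (by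
    intro v hv w hw _
    have := hTr v hv
    unfold psi
    rw [if_neg (by simp only; omega), if_neg (by simp only; omega)])
  have hz0 : F z = 0 := by
    have hzx := hTr z hT.right_mem
    by_cases hzy : z.2 < y₀
    · rw [f4 z fun s hs => hzy.trans_le (hSr hs).2.2.1]
      unfold rgt
      rw [if_neg (by simp only; omega)]
      simp
    · apply f5
      by_cases hzy' : y₁ < z.2
      · exact Or.inl fun s hs => (hSr hs).2.2.2.trans hzy'.le
      · refine Or.inr (Or.inl fun s hs => (hSr hs).2.1.trans ?_)
        by_contra hcon
        exact hz ⟨hzx, by omega, by omega, by omega⟩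
  have hl : F (x₀ - 1, w) = 0 :=
    f5 _ (Or.inr (Or.inr fun s hs => by have := (hSr hs).1; simp only; omega))
  have := f2 (x₀ - 1, w) (x₀, w) (fun h => by have := (hSr h).1; simp only at this; omega)
    (fun h => hcon _ h hT.left_mem) (by rw [adj_iff]; simp) (by simp)
  rw [hl, key, hz0] at this
  unfold psi at this
  rw [if_pos (by simp only; omega), if_neg (by simp only; omega)] at this
  omega

/-- In a rectangle, a walk from the left column to the right side meets any walk to the bottom
from a site of the left column above its starting point. -/
theorem Conn.leftRightBot {S T : Set Site} {x₀ x₁ y₀ y₁ u w : ℤ} {z z' : Site}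
    (hS : Conn S (x₀, u) z) (hSr : S ⊆ rect x₀ x₁ y₀ y₁) (hz : z.1 = x₁)
    (hT : Conn T (x₀, w) z') (hTr : T ⊆ rect x₀ x₁ y₀ y₁) (hz' : z'.2 = y₀)
    (h1 : u < w) : ∃ v ∈ S, v ∈ T := by
  by_contra hcon
  push Not at hcon
  have hS' : Conn (S ∪ {(x₁ + 1, z.2)}) (x₀, u) (x₁ + 1, z.2) :=
    (hS.mono Set.subset_union_left).tail (by rw [adj_iff]; simp [hz]) (by simp)
  have hT' : Conn (T ∪ {(z'.1, y₀ - 1)}) (x₀, w) (z'.1, y₀ - 1) :=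
    (hT.mono Set.subset_union_left).tail (by rw [adj_iff]; simp [hz']) (by simp)
  have hzr := hSr hS.right_mem
  have hzr' := hTr hT.right_mem
  have hlr := hSr hS.left_mem
  have hlr' := hTr hT.left_mem
  simp only [rect, Set.mem_ofPred_eq] at hzr hzr' hlr hlr'
  have hSb : ∀ s ∈ S ∪ {(x₁ + 1, z.2)}, x₀ ≤ s.1 ∧ y₀ ≤ s.2 := by
    rintro s (hs | rfl)
    · exact ⟨(hSr hs).1, (hSr hs).2.2.1⟩
    · simp only; omega
  have hTb : ∀ s ∈ T ∪ {(z'.1, y₀ - 1)}, x₀ ≤ s.1 ∧ s.1 ≤ x₁ := by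
    rintro s (hs | rfl)
    · exact ⟨(hTr hs).1, (hTr hs).2.1⟩
    · simp only; omega
  have hdis : ∀ v ∈ T ∪ {(z'.1, y₀ - 1)}, v ∉ S ∪ {(x₁ + 1, z.2)} := by
    intro v hv hv'
    rcases hv' with hv' | rfl
    · rcases hv with hv | rfl
      · exact hcon v hv' hv
      · have := hSb _ (Or.inl hv'); simp only at this; omega
    · have := hTb _ hv; simp only at this; omega
  obtain ⟨F, f1, f2, -, f4, f5⟩ := hS'.exists_potential
  have key := potential_const f1 f2 hT' hdis (by
    intro v hv w hw _
    have := hTb v hv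
    have := hTb w hw
    unfold psi
    rw [if_neg (by simp only; omega), if_neg (by simp only; omega)])
  rw [f4 (z'.1, y₀ - 1) fun s hs => by have := hSb s hs; simp only; omega] at key
  have hl : F (x₀ - 1, w) = 0 :=
    f5 _ (Or.inr (Or.inr fun s hs => by have := hSb s hs; simp only; omega))
  have := f2 (x₀ - 1, w) (x₀, w) (fun h => by have := hSb _ h; simp only at this; omega)
    (hdis _ hT'.left_mem) (by rw [adj_iff]; simp) (by simp)
  rw [hl, key] at this
  simp only [psi, rgt] at this
  split_ifs at this <;> omega

/-- If walks issued from `u - (0,1)` and `u + (1,0)` leave a rectangle, then `u + (1,-1)` and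
`u - (1,0)` cannot be joined in the rectangle off these walks and off `u`. -/
theorem enclosure {x₀ x₁ y₀ y₁ : ℤ} {u g d : Site} {Sg Sd S : Set Site}
    (hu : u ∈ rect x₀ x₁ y₀ y₁) (hS : S ⊆ rect x₀ x₁ y₀ y₁)
    (hg : Conn Sg (u.1 + 1, u.2) g) (hg' : g ∉ rect x₀ x₁ y₀ y₁)
    (hd : Conn Sd (u.1, u.2 - 1) d) (hd' : d ∉ rect x₀ x₁ y₀ y₁)
    (hSg : ∀ v ∈ S, v ∉ Sg) (hSd : ∀ v ∈ S, v ∉ Sd) (huS : u ∉ S) (hug : u ∉ Sg) (hud : u ∉ Sd) :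
    ¬ Conn S (u.1 + 1, u.2 - 1) (u.1 - 1, u.2) := by
  intro h
  obtain ⟨F, f1, f2, f3, f4, f5⟩ := h.exists_potential
  have hz := hS h.left_mem
  have he := hS h.right_mem
  set z : Site := (u.1 + 1, u.2 - 1) with hzdef
  set e : Site := (u.1 - 1, u.2) with hedef
  have huz : Adj u z := by rw [adj_iff]; simp [z]
  have heu : Adj e u := by rw [adj_iff]; simp [e]
  set G : Site → ℤ := fun v => F v + chi v u z + chi v e u with hG
  have hconst : ∀ (T : Set Site) (c c' : Site), Conn T c c' → (∀ v ∈ T, v ∉ S) → u ∉ T →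
      G c = G c' := by
    intro T c c' hT hTS huT
    have ne : ∀ v ∈ T, v ≠ u ∧ v ≠ z ∧ v ≠ e := fun v hv =>
      ⟨fun h => huT (h ▸ hv), fun h' => hTS v hv (h' ▸ h.left_mem),
        fun h' => hTS v hv (h' ▸ h.right_mem)⟩
    refine hT.const fun v w hv hw hvw => ?_
    have hcol : w.1 = v.1 ∨ w.1 = v.1 + 1 ∨ v.1 = w.1 + 1 := by rw [adj_iff] at hvw; omega
    obtain ⟨v1, v2, v3⟩ := ne v hv
    obtain ⟨w1, w2, w3⟩ := ne w hw
    simp only [hG]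
    rcases hcol with e1 | e1 | e1
    · have a1 := f1 v w (hTS v hv) (hTS w hw) hvw e1
      have a2 := chi_vert hvw e1 v1 v2 w1 w2
      have a3 := chi_vert hvw e1 v3 v1 w3 w1
      omega
    · have a1 := f2 v w (hTS v hv) (hTS w hw) hvw e1
      have a2 := chi_horiz huz hvw e1 v1 v2 w1 w2
      have a3 := chi_horiz heu hvw e1 v3 v1 w3 w1
      omega
    · have a1 := f2 w v (hTS w hw) (hTS v hv) hvw.symm e1
      have a2 := chi_horiz huz hvw.symm e1 w1 w2 v1 v2
      have a3 := chi_horiz heu hvw.symm e1 w3 w1 v3 v1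
      omega
  have hout : ∀ v, v ∉ rect x₀ x₁ y₀ y₁ → G v = 0 := by
    intro v hv
    simp only [rect, Set.mem_ofPred_eq] at hv hu hz he
    have hS' : ∀ s ∈ S, x₀ ≤ s.1 ∧ s.1 ≤ x₁ ∧ y₀ ≤ s.2 ∧ s.2 ≤ y₁ := fun s hs => hS hs
    by_cases hvy : v.2 < y₀
    · have a1 := f4 v fun s hs => by have := hS' s hs; omega
      have a2 := chi_below huz (v := v) (by omega) (by omega)
      have a3 := chi_below heu (v := v) (by omega) (by omega)
      simp only [hG]; omega
    · have hc : y₁ < v.2 ∨ x₁ < v.1 ∨ v.1 < x₀ := by omega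
      have a1 := f5 v (hc.imp (fun _ s hs => by have := hS' s hs; omega) <|
        Or.imp (fun _ s hs => by have := hS' s hs; omega)
          fun _ s hs => by have := hS' s hs; omega)
      have a2 : chi v u z = 0 := chi_zero (by omega)
      have a3 : chi v e u = 0 := chi_zero (by omega)
      simp only [hG]; omega
  have g1 := (hconst Sg _ _ hg (fun v hv hv' => hSg v hv' hv) hug).trans (hout _ hg')
  have g2 := (hconst Sd _ _ hd (fun v hv hv' => hSd v hv' hv) hud).trans (hout _ hd')
  have g3 := f3 (u.1, u.2 - 1) (u.1 + 1, u.2) (fun h' => hSd _ h' hd.left_mem)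
    (fun h' => hSg _ h' hg.left_mem) (by simpa using huS) (by simp) (by simp)
  simp [hG, chi, psi, z, e] at g1 g2 g3
  omega

/-! ### Duality -/

theorem exists_int_potential (e : ℤ → ℤ) : ∃ g : ℤ → ℤ, g 0 = 0 ∧ ∀ x, g (x + 1) = g x + e x := by
  refine ⟨fun x => ∑ i ∈ Finset.range x.toNat, e i -
    ∑ i ∈ Finset.range (-x).toNat, e (-(i : ℤ) - 1), by simp, fun x => ?_⟩
  rcases le_or_gt 0 x with hx | hx
  · obtain ⟨k, rfl⟩ := Int.eq_ofNat_of_zero_le hx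
    have h1 : ((k : ℤ) + 1).toNat = k + 1 := by omega
    have h2 : (-((k : ℤ) + 1)).toNat = 0 := by omega
    have h3 : (-(k : ℤ)).toNat = 0 := by omega
    simp only [h1, h2, h3, Finset.sum_range_succ, Int.toNat_natCast, Finset.range_zero,
      Finset.sum_empty]
    ring
  · obtain ⟨k, rfl⟩ : ∃ k : ℕ, x = -(k : ℤ) - 1 := ⟨(-x - 1).toNat, by omega⟩
    have h1 : (-(k : ℤ) - 1 + 1).toNat = 0 := by omega
    have h2 : (-(-(k : ℤ) - 1 + 1)).toNat = k := by omega
    have h3 : (-(k : ℤ) - 1).toNat = 0 := by omega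
    have h4 : (-(-(k : ℤ) - 1)).toNat = k + 1 := by omega
    simp only [h1, h2, h3, h4, Finset.sum_range_succ, Finset.range_zero, Finset.sum_empty]
    ring

/-- An antisymmetric function of steps with zero sum around triangles is a gradient. -/
theorem exists_potential_of_closed (d : Site → Site → ℤ)
    (hanti : ∀ u v, Adj u v → d v u = -d u v)
    (h1 : ∀ x y : ℤ, d (x, y) (x + 1, y) + d (x + 1, y) (x, y + 1) = d (x, y) (x, y + 1))
    (h2 : ∀ x y : ℤ, d (x + 1, y) (x, y + 1) + d (x, y + 1) (x + 1, y + 1) =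
      d (x + 1, y) (x + 1, y + 1)) :
    ∃ φ : Site → ℤ, ∀ u v, Adj u v → φ v = φ u + d u v := by
  obtain ⟨g, -, hg⟩ := exists_int_potential fun x => d (x, 0) (x + 1, 0)
  choose k hk0 hk using fun x : ℤ => exists_int_potential fun y => d (x, y) (x, y + 1)
  set φ : ℤ → ℤ → ℤ := fun x y => g x + k x y with hφ
  have vert : ∀ x y, φ x (y + 1) = φ x y + d (x, y) (x, y + 1) := fun x y => by
    simp only [hφ, hk]; ring
  have horiz : ∀ x y, φ (x + 1) y = φ x y + d (x, y) (x + 1, y) := by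
    intro x y
    induction y with
    | zero => simp only [hφ, hk0, hg]; ring
    | succ i ih =>
      have a1 := vert x i
      have a2 := vert (x + 1) i
      have a3 := h1 x i
      have a4 := h2 x i
      linarith
    | pred i ih =>
      have a1 := vert x (-i - 1)
      have a2 := vert (x + 1) (-i - 1)
      have a3 := h1 x (-i - 1)
      have a4 := h2 x (-i - 1)
      simp only [sub_add_cancel] at a1 a2 a3 a4
      linarith
  have diag : ∀ x y, φ x (y + 1) = φ (x + 1) y + d (x + 1, y) (x, y + 1) := fun x y => by
    have a1 := vert x y
    have a2 := horiz x y
    have a3 := h1 x y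
    linarith
  refine ⟨fun v => φ v.1 v.2, ?_⟩
  rintro ⟨x, y⟩ ⟨x', y'⟩ hadj
  have hs := hanti _ _ hadj
  have hadj' := hadj
  simp only [adj_iff] at hadj
  rcases hadj with ⟨rfl, rfl⟩ | ⟨e, rfl⟩ | ⟨rfl, rfl⟩ | ⟨rfl, e⟩ | ⟨rfl, e⟩ | ⟨e, rfl⟩
  · exact horiz _ _
  · obtain rfl : x = x' + 1 := by omega
    have := horiz x' y'
    simp only; linarith
  · exact vert _ _
  · obtain rfl : y = y' + 1 := by omega
    have := vert x' y'
    simp only; linarith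
  · obtain rfl : y = y' + 1 := by omega
    have := diag x y'
    simp only; linarith
  · obtain rfl : x = x' + 1 := by omega
    have := diag x' y
    simp only; linarith

/-- Duality for a two-colouring of the lattice: if the colours alternate
black-white-black-white around a circuit made of four monochromatic walks, then the black walks
are joined or the white walks are joined. -/
theorem duality {B : Set Site} {l l' b b' r r' t t' : Site}
    (hl : Conn B l l') (hb : Conn Bᶜ b b') (hr : Conn B r r') (ht : Conn Bᶜ t t')
    (hlb : Adj l' b) (hbr : Adj b' r) (hrt : Adj r' t) (htl : Adj t' l) :
    Conn B l r ∨ Conn Bᶜ b t := by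
  classical
  by_contra hcon
  push Not at hcon
  obtain ⟨hlr, hbt⟩ := hcon
  set c : Site → ℤ := fun v => if v ∈ B then (if Conn B l v then 0 else 2) else
    (if Conn Bᶜ b v then 1 else 3) with hc
  have cB0 : ∀ v, Conn B l v → c v = 0 := fun v hv => by
    simp only [hc]; rw [if_pos hv.right_mem, if_pos hv]
  have cW1 : ∀ v, Conn Bᶜ b v → c v = 1 := fun v hv => by
    simp only [hc]; rw [if_neg hv.right_mem, if_pos hv]
  have cB2 : ∀ v, Conn B r v → c v = 2 := fun v hv => by
    simp only [hc]; rw [if_pos hv.right_mem, if_neg fun h => hlr (h.trans hv.symm)]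
  have cW3 : ∀ v, Conn Bᶜ t v → c v = 3 := fun v hv => by
    simp only [hc]; rw [if_neg hv.right_mem, if_neg fun h => hbt (h.trans hv.symm)]
  have c4 : ∀ v, 0 ≤ c v ∧ c v ≤ 3 := fun v => by simp only [hc]; split_ifs <;> omega
  set d : Site → Site → ℤ := fun u v => (c v - c u + 1) % 4 - 1 with hd
  have hcol : ∀ u v, Adj u v → (c v - c u) % 4 ≠ 2 := by
    intro u v huv
    by_cases hu : u ∈ B <;> by_cases hv : v ∈ B
    · have : Conn B l u ↔ Conn B l v := ⟨fun h => h.tail huv hv, fun h => h.tail huv.symm hu⟩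
      simp only [hc, if_pos hu, if_pos hv, this]; omega
    · simp only [hc, if_pos hu, if_neg hv]; split_ifs <;> omega
    · simp only [hc, if_neg hu, if_pos hv]; split_ifs <;> omega
    · have : Conn Bᶜ b u ↔ Conn Bᶜ b v := ⟨fun h => h.tail huv hv, fun h => h.tail huv.symm hu⟩
      simp only [hc, if_neg hu, if_neg hv, this]; omega
  obtain ⟨φ, hφ⟩ := exists_potential_of_closed d
    (fun u v huv => by have := hcol u v huv; simp only [hd]; omega)
    (fun x y => by
      have a1 := hcol (x, y) (x + 1, y) (by simp [adj_iff])
      have a2 := hcol (x + 1, y) (x, y + 1) (by simp [adj_iff])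
      have a3 := hcol (x, y) (x, y + 1) (by simp [adj_iff])
      simp only [hd]; omega)
    (fun x y => by
      have a1 := hcol (x + 1, y) (x, y + 1) (by simp [adj_iff])
      have a2 := hcol (x, y + 1) (x + 1, y + 1) (by simp [adj_iff])
      have a3 := hcol (x + 1, y) (x + 1, y + 1) (by simp [adj_iff])
      simp only [hd]; omega)
  have hconst : ∀ {T : Set Site} {x y : Site} (i : ℤ), Conn T x y → (∀ v, Conn T x v → c v = i) →
      φ y = φ x := by
    intro T x y i h hi
    refine (h.in_cluster.const fun u v hu hv huv => ?_).symm
    rw [hφ u v huv]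
    simp only [hd, hi u hu, hi v hv]
    omega
  have e1 := hconst 0 hl cB0
  have e2 := hconst 1 hb cW1
  have e3 := hconst 2 hr cB2
  have e4 := hconst 3 ht cW3
  have s1 := hφ _ _ hlb
  have s2 := hφ _ _ hbr
  have s3 := hφ _ _ hrt
  have s4 := hφ _ _ htl
  simp only [hd, cB0 l' hl, cB0 l (.refl hl.1), cW1 b (.refl hb.1), cW1 b' hb, cB2 r (.refl hr.1),
    cB2 r' hr, cW3 t (.refl ht.1), cW3 t' ht] at s1 s2 s3 s4
  omega

/-! ### Finite-dimensional events -/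

/-- Sites of colour `s`. -/
def col (s : Bool) (ω : Config) : Set Site := {v | ω v = s}

/-- Colour flip. -/
def flipCfg (ω : Config) : Config := fun v => !ω v

/-- The event `A` depends only on the sites of `S`. -/
def DepOn (S : Set Site) (A : Set Config) : Prop :=
  ∀ ω η : Config, (∀ v ∈ S, ω v = η v) → ω ∈ A → η ∈ A

/-- Increasing events. -/
def Incr (A : Set Config) : Prop :=
  ∀ ω η : Config, (∀ v, ω v = true → η v = true) → ω ∈ A → η ∈ A

/-- The configuration whose open sites are those of `s`. -/
def cfg (s : Finset Site) : Config := fun v => decide (v ∈ s)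

theorem col_inter_eq {S : Set Site} {ω ω' : Config} (h : ∀ v ∈ S, ω v = ω' v) (s : Bool) :
    col s ω ∩ S = col s ω' ∩ S := by
  ext v
  constructor
  · rintro ⟨h1, h2⟩; exact ⟨(h v h2).symm.trans h1, h2⟩
  · rintro ⟨h1, h2⟩; exact ⟨(h v h2).trans h1, h2⟩

theorem col_flip (s : Bool) (ω : Config) : col s (flipCfg ω) = col (!s) ω := by
  ext v; simp [col, flipCfg]

namespace DepOn

variable {S T : Set Site} {A B : Set Config}

theorem mono (h : DepOn S A) (hST : S ⊆ T) : DepOn T A :=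
  fun ω ω' hω => h ω ω' fun v hv => hω v (hST hv)

theorem inter (hA : DepOn S A) (hB : DepOn S B) : DepOn S (A ∩ B) :=
  fun ω ω' hω h => ⟨hA ω ω' hω h.1, hB ω ω' hω h.2⟩

theorem iff (h : DepOn S A) {ω ω' : Config} (hω : ∀ v ∈ S, ω v = ω' v) : ω ∈ A ↔ ω' ∈ A :=
  ⟨h ω ω' hω, h ω' ω fun v hv => (hω v hv).symm⟩

theorem compl (h : DepOn S A) : DepOn S Aᶜ :=
  fun _ _ hω h' h'' => h' ((h.iff hω).2 h'')

theorem flipCfg (h : DepOn S A) : DepOn S {ω | flipCfg ω ∈ A} :=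
  fun ω ω' hω => h _ _ fun v hv => by simp [_root_.flipCfg, hω v hv]

end DepOn

namespace IsBernoulliHalf

variable {μ : Measure Config}

theorem prob (hμ : IsBernoulliHalf μ) : IsProbabilityMeasure μ := hμ.1

theorem real_cyl (hμ : IsBernoulliHalf μ) (F : Finset Site) (f : Config) :
    μ.real {ω | ∀ v ∈ F, ω v = f v} = (1 / 2 : ℝ) ^ F.card := by
  rw [measureReal_def, hμ.2]
  simp

theorem measurable_cyl (F : Finset Site) (f : Config) :
    MeasurableSet {ω : Config | ∀ v ∈ F, ω v = f v} := by
  have : {ω : Config | ∀ v ∈ F, ω v = f v} = ⋂ v ∈ F, (fun ω : Config => ω v) ⁻¹' {f v} := by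
    ext ω; simp
  rw [this]
  exact Finset.measurableSet_biInter _ fun v _ => measurable_pi_apply v (measurableSet_singleton _)

open Classical in
theorem eq_biUnion_cyl {F : Finset Site} {A : Set Config} (hA : DepOn F A) :
    A = ⋃ s ∈ F.powerset.filter (fun s => cfg s ∈ A), {ω | ∀ v ∈ F, ω v = cfg s v} := by
  ext ω
  simp only [Set.mem_iUnion, Finset.mem_filter, Finset.mem_powerset, Set.mem_ofPred_eq,
    exists_prop]
  constructor
  · intro h
    have : ∀ v ∈ F, ω v = cfg (F.filter fun v => ω v = true) v := by
      intro v hv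
      simp only [cfg, Finset.mem_filter, hv, true_and]
      cases ω v <;> simp
    exact ⟨_, ⟨Finset.filter_subset _ _, hA _ _ (fun v hv => this v hv) h⟩, this⟩
  · rintro ⟨s, ⟨-, hs⟩, h⟩
    exact hA _ _ (fun v hv => (h v hv).symm) hs

theorem _root_.DepOn.measurableSet {S : Set Site} (hS : S.Finite) {A : Set Config}
    (hA : DepOn S A) : MeasurableSet A := by
  classical
  rw [eq_biUnion_cyl (F := hS.toFinset) (hA.mono (by simp))]
  exact Finset.measurableSet_biUnion _ fun s _ => measurable_cyl _ _

theorem cyl_disjoint (F : Finset Site) {s t : Finset Site} (hs : s ⊆ F) (ht : t ⊆ F)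
    (hst : s ≠ t) :
    Disjoint {ω : Config | ∀ v ∈ F, ω v = cfg s v} {ω | ∀ v ∈ F, ω v = cfg t v} := by
  rw [Set.disjoint_left]
  intro ω h1 h2
  apply hst
  ext v
  by_cases hv : v ∈ F
  · have := (h1 v hv).symm.trans (h2 v hv)
    simpa [cfg] using this
  · exact ⟨fun h => absurd (hs h) hv, fun h => absurd (ht h) hv⟩

open Classical in
theorem real_inter_eq_sum (hμ : IsBernoulliHalf μ) {F : Finset Site} {A B : Set Config}
    (hA : DepOn F A) (hB : MeasurableSet B) :
    μ.real (A ∩ B) = ∑ s ∈ F.powerset.filter (fun s => cfg s ∈ A),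
      μ.real ({ω | ∀ v ∈ F, ω v = cfg s v} ∩ B) := by
  have := hμ.prob
  conv_lhs => rw [eq_biUnion_cyl hA, Set.iUnion₂_inter]
  rw [measureReal_biUnion_finset]
  · intro s hs t ht hst
    simp only [Finset.coe_filter, Finset.mem_powerset, Set.mem_ofPred_eq] at hs ht
    exact (cyl_disjoint F hs.1 ht.1 hst).mono Set.inter_subset_left Set.inter_subset_left
  · exact fun s _ => (measurable_cyl _ _).inter hB

open Classical in
theorem real_eq_card (hμ : IsBernoulliHalf μ) {F : Finset Site} {A : Set Config}
    (hA : DepOn F A) :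
    μ.real A = (F.powerset.filter (fun s => cfg s ∈ A)).card * (1 / 2 : ℝ) ^ F.card := by
  have := hμ.real_inter_eq_sum hA MeasurableSet.univ
  rw [Set.inter_univ] at this
  rw [this]
  simp only [Set.inter_univ, hμ.real_cyl, Finset.sum_const, nsmul_eq_mul]

/-- Events depending on disjoint sets of sites are independent. -/
theorem indep (hμ : IsBernoulliHalf μ) {S T : Set Site} (hS : S.Finite) (hT : T.Finite)
    (hST : Disjoint S T) {A B : Set Config} (hA : DepOn S A) (hB : DepOn T B) :
    μ.real (A ∩ B) = μ.real A * μ.real B := by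
  classical
  obtain ⟨F, rfl⟩ := hS.exists_finset_coe
  obtain ⟨G, rfl⟩ := hT.exists_finset_coe
  have hFG : Disjoint F G := by exact_mod_cast hST
  have key : ∀ s : Finset Site, μ.real ({ω | ∀ v ∈ F, ω v = cfg s v} ∩ B) =
      (1 / 2 : ℝ) ^ F.card * μ.real B := by
    intro s
    rw [Set.inter_comm, hμ.real_inter_eq_sum hB (measurable_cyl _ _), hμ.real_eq_card hB]
    have : ∀ t : Finset Site, μ.real ({ω | ∀ v ∈ G, ω v = cfg t v} ∩
        {ω | ∀ v ∈ F, ω v = cfg s v}) = (1 / 2 : ℝ) ^ F.card * (1 / 2 : ℝ) ^ G.card := by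
      intro t
      rw [← pow_add, ← Finset.card_union_of_disjoint hFG,
        ← hμ.real_cyl (F ∪ G) fun v => if v ∈ F then cfg s v else cfg t v]
      congr 1
      ext ω
      simp only [Set.mem_inter_iff, Set.mem_ofPred_eq, Finset.mem_union]
      constructor
      · rintro ⟨h1, h2⟩ v hv
        split_ifs with h
        · exact h2 v h
        · exact h1 v (hv.resolve_left h)
      · intro h
        refine ⟨fun v hv => ?_, fun v hv => ?_⟩
        · have := h v (Or.inr hv)
          rwa [if_neg fun h' => Finset.disjoint_left.1 hFG h' hv] at this
        · have := h v (Or.inl hv)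
          rwa [if_pos hv] at this
    simp only [this, Finset.sum_const, nsmul_eq_mul]
    ring
  rw [hμ.real_inter_eq_sum hA (hB.measurableSet hT), hμ.real_eq_card hA]
  simp only [key, Finset.sum_const, nsmul_eq_mul]
  ring

/-- Invariance under relabelling of sites and a site-dependent colour flip. -/
theorem real_map (hμ : IsBernoulliHalf μ) (e : Site ≃ Site) (f : Bool) {S : Set Site}
    (hS : S.Finite) {A : Set Config} (hA : DepOn S A) :
    μ.real {ω | (fun v => xor f (ω (e v))) ∈ A} = μ.real A := by
  classical
  have := hμ.prob
  obtain ⟨F, rfl⟩ := hS.exists_finset_coe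
  have hA' : {ω : Config | (fun v => xor f (ω (e v))) ∈ A} =
      ⋃ s ∈ F.powerset.filter (fun s => cfg s ∈ A),
        {ω | ∀ v ∈ F.map e.toEmbedding, ω v = xor f (cfg s (e.symm v))} := by
    ext ω
    rw [Set.mem_ofPred_eq, Set.ext_iff.1 (eq_biUnion_cyl hA)]
    simp only [Set.mem_iUnion, Finset.mem_filter, Finset.mem_powerset, Set.mem_ofPred_eq,
      exists_prop, Finset.mem_map_equiv]
    refine exists_congr fun s => ?_
    refine and_congr_right fun _ => ⟨fun h v hv => ?_, fun h v hv => ?_⟩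
    · have := h _ hv
      rw [← this]
      cases f <;> simp
    · have := h (e v) (by simpa using hv)
      rw [this]
      cases f <;> simp
  rw [hA', measureReal_biUnion_finset]
  · simp only [hμ.real_cyl, Finset.card_map, Finset.sum_const, nsmul_eq_mul]
    rw [hμ.real_eq_card hA]
  · intro s hs t ht hst
    simp only [Finset.coe_filter, Finset.mem_powerset, Set.mem_ofPred_eq] at hs ht
    refine Set.disjoint_left.2 fun ω h1 h2 => ?_
    have hd := cyl_disjoint F hs.1 ht.1 hst
    rw [Set.disjoint_left] at hd
    refine @hd (fun v => xor f (ω (e v))) (fun v hv => ?_) (fun v hv => ?_)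
    · simp only [h1 (e v) (by simpa using hv)]; cases f <;> simp
    · simp only [h2 (e v) (by simpa using hv)]; cases f <;> simp
  · exact fun s _ => measurable_cyl _ _

theorem real_flip (hμ : IsBernoulliHalf μ) {S : Set Site}
    (hS : S.Finite) {A : Set Config} (hA : DepOn S A) :
    μ.real {ω | flipCfg ω ∈ A} = μ.real A := by
  have := hμ.real_map (Equiv.refl _) true hS hA
  simp only [Equiv.refl_apply, Bool.true_xor] at this
  exact this

end IsBernoulliHalf

/-! ### The Harris inequality -/

theorem harris_sum (F : Finset Site) : ∀ f g : Finset Site → ℝ, Monotone f → Monotone g →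
    (∑ s ∈ F.powerset, f s) * (∑ s ∈ F.powerset, g s) ≤
      2 ^ F.card * ∑ s ∈ F.powerset, f s * g s := by
  classical
  induction F using Finset.induction_on with
  | empty => intro f g _ _; simp
  | insert a F ha ih =>
    intro f g hf hg
    have hi : Monotone fun s : Finset Site => insert a s :=
      fun s t h => Finset.insert_subset_insert a h
    have h0 := ih f g hf hg
    have h1 := ih (fun s => f (insert a s)) (fun s => g (insert a s)) (hf.comp hi) (hg.comp hi)
    rw [Finset.sum_powerset_insert ha, Finset.sum_powerset_insert ha,
      Finset.sum_powerset_insert ha, Finset.card_insert_of_notMem ha, pow_succ]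
    have e1 : ∑ s ∈ F.powerset, f s ≤ ∑ s ∈ F.powerset, f (insert a s) :=
      Finset.sum_le_sum fun s _ => hf (Finset.subset_insert a s)
    have e2 : ∑ s ∈ F.powerset, g s ≤ ∑ s ∈ F.powerset, g (insert a s) :=
      Finset.sum_le_sum fun s _ => hg (Finset.subset_insert a s)
    nlinarith [mul_nonneg (sub_nonneg.2 e1) (sub_nonneg.2 e2)]

theorem Incr.cfg {A : Set Config} (hA : Incr A) {s t : Finset Site} (h : s ⊆ t)
    (hs : cfg s ∈ A) : _root_.cfg t ∈ A :=
  hA _ _ (fun v hv => by simp only [_root_.cfg, decide_eq_true_eq] at *; exact h hv) hs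

/-- Harris' inequality. -/
theorem IsBernoulliHalf.harris {μ : Measure Config} (hμ : IsBernoulliHalf μ) {S : Set Site}
    (hS : S.Finite) {A B : Set Config} (hA : DepOn S A) (hB : DepOn S B) (hA' : Incr A)
    (hB' : Incr B) : μ.real A * μ.real B ≤ μ.real (A ∩ B) := by
  classical
  obtain ⟨F, rfl⟩ := hS.exists_finset_coe
  rw [hμ.real_eq_card hA, hμ.real_eq_card hB, hμ.real_eq_card (hA.inter hB)]
  have hm : ∀ {C : Set Config}, Incr C →
      Monotone fun s : Finset Site => if cfg s ∈ C then (1 : ℝ) else 0 := by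
    intro C hC s t h
    simp only
    split_ifs with h1 h2
    · exact le_rfl
    · exact absurd (hC.cfg h h1) h2
    · norm_num
    · exact le_rfl
  have := harris_sum F _ _ (hm hA') (hm hB')
  simp only [← ite_and, mul_ite, mul_one, mul_zero, Finset.sum_boole] at this
  have e : (F.powerset.filter fun s => cfg s ∈ B ∧ cfg s ∈ A) =
      F.powerset.filter fun s => cfg s ∈ A ∩ B :=
    Finset.filter_congr fun s _ => by rw [Set.mem_inter_iff, and_comm]
  rw [e] at this
  have h2 : (2 : ℝ) ^ F.card * (1 / 2) ^ F.card = 1 := by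
    rw [← mul_pow]; norm_num
  calc _ = ((F.powerset.filter fun s => cfg s ∈ A).card : ℝ) *
        (F.powerset.filter fun s => cfg s ∈ B).card * ((1 / 2) ^ F.card * (1 / 2) ^ F.card) := by
        ring
    _ ≤ (2 ^ F.card * (F.powerset.filter fun s => cfg s ∈ A ∩ B).card) *
        ((1 / 2) ^ F.card * (1 / 2) ^ F.card) := by gcongr
    _ = (2 ^ F.card * (1 / 2) ^ F.card) *
        ((F.powerset.filter fun s => cfg s ∈ A ∩ B).card * (1 / 2) ^ F.card) := by ring
    _ = _ := by rw [h2, one_mul]; congr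

/-! ### The van den Berg–Kesten inequality -/

open Classical in
/-- Indicator of a proposition. -/
noncomputable def indp (p : Prop) : ℝ := if p then 1 else 0

theorem indp_mono {p q : Prop} (h : p → q) : indp p ≤ indp q := by
  unfold indp
  split_ifs with h1 h2 h3
  · exact le_rfl
  · exact absurd (h h1) h2
  · norm_num
  · exact le_rfl

theorem sum_indp (F : Finset Site) (p : Finset Site → Prop) [DecidablePred p] :
    ∑ s ∈ F.powerset, indp (p s) = ((F.powerset.filter p).card : ℝ) := by
  rw [← Finset.sum_boole]
  refine Finset.sum_congr rfl fun s _ => ?_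
  by_cases h : p s <;> simp [indp, h]

theorem bk_pointwise {p q r s : Prop} (h1 : p → q) (h2 : p → r) (h3 : q → s) (h4 : r → s) :
    2 * indp p + 2 * indp (r ∨ q) ≤ indp p + indp q + (indp r + indp s) := by
  by_cases p <;> by_cases q <;> by_cases r <;> by_cases s <;> simp_all [indp] <;> norm_num

theorem bk_sum (F : Finset Site) : ∀ Q : Finset Site → Finset Site → Prop,
    (∀ I I' J J', I ⊆ I' → J ⊆ J' → Q I J → Q I' J') →
    (2 : ℝ) ^ F.card * (∑ W ∈ F.powerset, indp (∃ I ⊆ W, Q I (W \ I))) ≤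
      ∑ I ∈ F.powerset, ∑ J ∈ F.powerset, indp (Q I J) := by
  classical
  induction F using Finset.induction_on with
  | empty =>
    intro Q _
    simp only [Finset.powerset_empty, Finset.sum_singleton, Finset.subset_empty, exists_eq_left,
      Finset.sdiff_self, Finset.card_empty, pow_zero, one_mul, le_refl]
  | insert a F ha ih =>
    intro Q hQ
    have h0 := ih Q hQ
    have h1 := ih (fun I J => Q (insert a I) J ∨ Q I (insert a J)) fun I I' J J' hI hJ h =>
      h.imp (hQ _ _ _ _ (Finset.insert_subset_insert a hI) hJ)
        (hQ _ _ _ _ hI (Finset.insert_subset_insert a hJ))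
    rw [Finset.sum_powerset_insert ha, Finset.card_insert_of_notMem ha, pow_succ]
    have e1 : ∑ W ∈ F.powerset, indp (∃ I ⊆ insert a W, Q I (insert a W \ I)) ≤
        ∑ W ∈ F.powerset, indp (∃ I ⊆ W, Q (insert a I) (W \ I) ∨ Q I (insert a (W \ I))) := by
      refine Finset.sum_le_sum fun W hW => indp_mono ?_
      have haW : a ∉ W := fun h => ha (Finset.mem_powerset.1 hW h)
      rintro ⟨I, hI, hq⟩
      clear ih h0 h1
      have hQ' := hQ
      clear hQ
      by_cases haI : a ∈ I
      · refine ⟨I.erase a, ?_, Or.inl (hQ' _ _ _ _ ?_ ?_ hq)⟩ <;> clear hQ' hq <;> grind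
      · refine ⟨I, ?_, Or.inr (hQ' _ _ _ _ ?_ ?_ hq)⟩ <;> clear hQ' hq <;> grind
    have e3 : 2 * (∑ I ∈ F.powerset, ∑ J ∈ F.powerset, indp (Q I J)) +
        2 * (∑ I ∈ F.powerset, ∑ J ∈ F.powerset, indp (Q (insert a I) J ∨ Q I (insert a J))) ≤
        ∑ I ∈ F.powerset, ∑ J ∈ F.powerset, (indp (Q I J) + indp (Q I (insert a J)) +
          (indp (Q (insert a I) J) + indp (Q (insert a I) (insert a J)))) := by
      simp only [Finset.mul_sum, ← Finset.sum_add_distrib]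
      exact Finset.sum_le_sum fun I _ => Finset.sum_le_sum fun J _ => bk_pointwise
        (hQ _ _ _ _ le_rfl (Finset.subset_insert a J))
        (hQ _ _ _ _ (Finset.subset_insert a I) le_rfl)
        (hQ _ _ _ _ (Finset.subset_insert a I) le_rfl)
        (hQ _ _ _ _ le_rfl (Finset.subset_insert a J))
    have e2 : ∑ I ∈ (insert a F).powerset, ∑ J ∈ (insert a F).powerset, indp (Q I J) =
        ∑ I ∈ F.powerset, ∑ J ∈ F.powerset, (indp (Q I J) + indp (Q I (insert a J)) +
          (indp (Q (insert a I) J) + indp (Q (insert a I) (insert a J)))) := by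
      simp only [Finset.sum_powerset_insert ha, Finset.sum_add_distrib]
    rw [e2]
    refine le_trans ?_ e3
    have e4 := mul_le_mul_of_nonneg_left e1 (show (0 : ℝ) ≤ 2 ^ F.card by positivity)
    linarith

/-- Disjoint occurrence of two events. -/
def disjOcc (A B : Set Config) : Set Config :=
  {ω | ∃ s t : Finset Site, Disjoint s t ∧ (∀ v ∈ s, ω v = true) ∧ (∀ v ∈ t, ω v = true) ∧
    cfg s ∈ A ∧ cfg t ∈ B}

theorem IsBernoulliHalf.bk {μ : Measure Config} (hμ : IsBernoulliHalf μ) {S : Set Site}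
    (hS : S.Finite) {A B : Set Config} (hA : DepOn S A) (hB : DepOn S B) (hA' : Incr A)
    (hB' : Incr B) : μ.real (disjOcc A B) ≤ μ.real A * μ.real B := by
  classical
  obtain ⟨F, rfl⟩ := hS.exists_finset_coe
  have hcut : ∀ {C : Set Config}, DepOn F C → ∀ s : Finset Site, cfg s ∈ C → cfg (s ∩ F) ∈ C := by
    intro C hC s hs
    refine hC _ _ (fun v hv => ?_) hs
    have : v ∈ F := hv
    simp [cfg, this]
  have hD : DepOn F (disjOcc A B) := by
    rintro ω ω' hω ⟨s, t, hst, hs, ht, hsA, htB⟩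
    refine ⟨s ∩ F, t ∩ F, hst.mono Finset.inter_subset_left Finset.inter_subset_left, ?_, ?_,
      hcut hA s hsA, hcut hB t htB⟩
    · intro v hv
      have hv := Finset.mem_inter.1 hv
      rw [← hω v hv.2]; exact hs v hv.1
    · intro v hv
      have hv := Finset.mem_inter.1 hv
      rw [← hω v hv.2]; exact ht v hv.1
  rw [hμ.real_eq_card hA, hμ.real_eq_card hB, hμ.real_eq_card hD]
  have key := bk_sum F (fun I J => cfg I ∈ A ∧ cfg J ∈ B)
    fun I I' J J' hI hJ h => ⟨hA'.cfg hI h.1, hB'.cfg hJ h.2⟩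
  have e1 : (F.powerset.filter fun W => cfg W ∈ disjOcc A B) ⊆
      F.powerset.filter fun W => ∃ I ⊆ W, cfg I ∈ A ∧ cfg (W \ I) ∈ B := by
    refine Finset.monotone_filter_right _ fun W _ => ?_
    rintro ⟨s, t, hst, hs, ht, hsA, htB⟩
    have hs' : s ⊆ W := fun v hv => by simpa [cfg] using hs v hv
    have ht' : t ⊆ W := fun v hv => by simpa [cfg] using ht v hv
    refine ⟨s, hs', hsA, hB'.cfg (fun v hv => ?_) htB⟩
    exact Finset.mem_sdiff.2 ⟨ht' hv, fun h => Finset.disjoint_left.1 hst h hv⟩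
  have e2 : (∑ I ∈ F.powerset, ∑ J ∈ F.powerset, indp (cfg I ∈ A ∧ cfg J ∈ B)) =
      (F.powerset.filter fun s => cfg s ∈ A).card * (F.powerset.filter fun s => cfg s ∈ B).card := by
    rw [← Finset.sum_boole, ← Finset.sum_boole, Finset.sum_mul_sum]
    refine Finset.sum_congr rfl fun I _ => Finset.sum_congr rfl fun J _ => ?_
    by_cases h1 : cfg I ∈ A <;> by_cases h2 : cfg J ∈ B <;> simp [indp, h1, h2]
  rw [e2] at key
  rw [sum_indp] at key
  have h2 : (2 : ℝ) ^ F.card * (1 / 2) ^ F.card = 1 := by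
    rw [← mul_pow]; norm_num
  have e3 : ((F.powerset.filter fun W => cfg W ∈ disjOcc A B).card : ℝ) ≤
      (F.powerset.filter fun W => ∃ I ⊆ W, cfg I ∈ A ∧ cfg (W \ I) ∈ B).card := by
    exact_mod_cast Finset.card_le_card e1
  calc _ ≤ ((F.powerset.filter fun W => ∃ I ⊆ W, cfg I ∈ A ∧ cfg (W \ I) ∈ B).card : ℝ) *
        (1 / 2) ^ F.card := mul_le_mul_of_nonneg_right e3 (by positivity)
    _ = (2 ^ F.card * (F.powerset.filter fun W => ∃ I ⊆ W, cfg I ∈ A ∧ cfg (W \ I) ∈ B).card) *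
        ((1 / 2) ^ F.card * (1 / 2) ^ F.card) := by
        rw [show ∀ x y : ℝ, 2 ^ F.card * x * (y * y) = (2 ^ F.card * y) * (x * y) by
          intros; ring, h2, one_mul]
    _ ≤ _ := by
        refine (mul_le_mul_of_nonneg_right key (by positivity)).trans_eq ?_
        ring

/-! ### Coloured versions of the basic inequalities -/

/-- Events that are increasing in the set of sites of colour `s`. -/
def IncrC (s : Bool) (A : Set Config) : Prop :=
  ∀ ω ω' : Config, col s ω ⊆ col s ω' → ω ∈ A → ω' ∈ A

theorem IncrC.inter {s : Bool} {A B : Set Config} (hA : IncrC s A) (hB : IncrC s B) :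
    IncrC s (A ∩ B) :=
  fun ω ω' hω h => ⟨hA ω ω' hω h.1, hB ω ω' hω h.2⟩

theorem IncrC.incr {A : Set Config} (hA : IncrC true A) : Incr A :=
  fun ω ω' hω h => hA ω ω' (fun v hv => hω v hv) h

theorem IncrC.flip {s : Bool} {A : Set Config} (hA : IncrC s A) :
    IncrC (!s) {ω | flipCfg ω ∈ A} := by
  intro ω ω' hω h
  refine hA _ _ ?_ h
  rw [col_flip, col_flip]
  exact hω

theorem IsBernoulliHalf.harrisC {μ : Measure Config} (hμ : IsBernoulliHalf μ) (s : Bool)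
    {S : Set Site} (hS : S.Finite) {A B : Set Config} (hA : DepOn S A) (hB : DepOn S B)
    (hA' : IncrC s A) (hB' : IncrC s B) : μ.real A * μ.real B ≤ μ.real (A ∩ B) := by
  cases s
  · rw [← hμ.real_flip hS hA, ← hμ.real_flip hS hB, ← hμ.real_flip hS (hA.inter hB)]
    exact hμ.harris hS hA.flipCfg hB.flipCfg hA'.flip.incr hB'.flip.incr
  · exact hμ.harris hS hA hB hA'.incr hB'.incr

/-- Some site of `I` is joined to some site of `O` in `S`. -/
def Linked (S I O : Set Site) : Prop := ∃ a ∈ I, ∃ b ∈ O, Conn S a b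

theorem Linked.mono {S S' I I' O O' : Set Site} (h : Linked S I O) (hS : S ⊆ S') (hI : I ⊆ I')
    (hO : O ⊆ O') : Linked S' I' O' := by
  obtain ⟨a, ha, b, hb, h⟩ := h
  exact ⟨a, hI ha, b, hO hb, h.mono hS⟩

/-- `I` and `O` are joined by sites of colour `s` in `G`. -/
def arm (s : Bool) (G I O : Set Site) : Set Config := {ω | Linked (col s ω ∩ G) I O}

theorem arm_depOn (s : Bool) (G I O : Set Site) : DepOn G (arm s G I O) := by
  intro ω ω' h hω
  rw [arm, Set.mem_ofPred_eq] at hω ⊢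
  rwa [← col_inter_eq h]

theorem arm_incrC (s : Bool) (G I O : Set Site) : IncrC s (arm s G I O) :=
  fun _ _ h hω => hω.mono (Set.inter_subset_inter_left _ h) le_rfl le_rfl

theorem flip_arm (s : Bool) (G I O : Set Site) :
    {ω | flipCfg ω ∈ arm s G I O} = arm (!s) G I O := by
  ext ω
  rw [arm, arm, Set.mem_ofPred_eq, Set.mem_ofPred_eq, Set.mem_ofPred_eq, col_flip]

/-! ### Counting disjoint arms -/

theorem disjOcc_incr {A B : Set Config} : Incr (disjOcc A B) := by
  rintro ω ω' h ⟨s, t, hst, hs, ht, hA, hB⟩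
  exact ⟨s, t, hst, fun v hv => h v (hs v hv), fun v hv => h v (ht v hv), hA, hB⟩

theorem disjOcc_depOn {S : Set Site} {A B : Set Config} (hA : DepOn S A) (hB : DepOn S B) :
    DepOn S (disjOcc A B) := by
  classical
  have hcut : ∀ {C : Set Config}, DepOn S C → ∀ s : Finset Site, cfg s ∈ C →
      cfg (s.filter (· ∈ S)) ∈ C := by
    intro C hC s hs
    refine hC _ _ (fun v hv => ?_) hs
    simp [cfg, hv]
  rintro ω ω' hω ⟨s, t, hst, hs, ht, hsA, htB⟩
  refine ⟨s.filter (· ∈ S), t.filter (· ∈ S),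
    hst.mono (Finset.filter_subset _ _) (Finset.filter_subset _ _), ?_, ?_,
    hcut hA s hsA, hcut hB t htB⟩
  · intro v hv
    have hv := Finset.mem_filter.1 hv
    rw [← hω v hv.2]; exact hs v hv.1
  · intro v hv
    have hv := Finset.mem_filter.1 hv
    rw [← hω v hv.2]; exact ht v hv.1

/-- `k` disjoint occurrences of `A`. -/
def disjPow (A : Set Config) : ℕ → Set Config
  | 0 => Set.univ
  | k + 1 => disjOcc (disjPow A k) A

theorem disjPow_incr {A : Set Config} : ∀ k, Incr (disjPow A k)
  | 0 => fun _ _ _ _ => trivial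
  | _ + 1 => disjOcc_incr

theorem disjPow_depOn {S : Set Site} {A : Set Config} (hA : DepOn S A) :
    ∀ k, DepOn S (disjPow A k)
  | 0 => fun _ _ _ _ => trivial
  | k + 1 => disjOcc_depOn (disjPow_depOn hA k) hA

theorem IsBernoulliHalf.real_disjPow_le {μ : Measure Config} (hμ : IsBernoulliHalf μ)
    {S : Set Site} (hS : S.Finite) {A : Set Config} (hA : DepOn S A) (hA' : Incr A) (k : ℕ) :
    μ.real (disjPow A k) ≤ μ.real A ^ k := by
  have := hμ.prob
  induction k with
  | zero => simp [disjPow]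
  | succ k ih =>
    rw [pow_succ]
    exact (hμ.bk hS (disjPow_depOn hA k) hA (disjPow_incr k) hA').trans
      (mul_le_mul_of_nonneg_right ih measureReal_nonneg)

theorem mem_disjPow_of_arms {G Inn Out : Set Site} (hG : G.Finite) {ω : Config}
    (I : Finset Site) :
    (∀ a ∈ I, a ∈ Inn ∧ ∃ b ∈ Out, Conn (col true ω ∩ G) a b) →
    (∀ a ∈ I, ∀ b ∈ I, a ≠ b → ¬Conn (col true ω ∩ G) a b) →
    ω ∈ disjPow (arm true G Inn Out) I.card := by
  classical
  have hcl : ∀ T : Set Site, T ⊆ G → ∃ s : Finset Site, ∀ v, v ∈ s ↔ v ∈ T := by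
    intro T hT
    obtain ⟨s, hs⟩ := (hG.subset hT).exists_finset_coe
    exact ⟨s, fun v => by rw [← hs]; rfl⟩
  have hcfg : ∀ s : Finset Site, col true (cfg s) = (s : Set Site) := by
    intro s; ext v; simp [col, cfg]
  induction I using Finset.induction_on generalizing ω with
  | empty => exact fun _ _ => trivial
  | insert a I ha ih =>
    intro h1 h2
    rw [Finset.card_insert_of_notMem ha]
    obtain ⟨s, hs⟩ := hcl {v | ∃ b ∈ I, Conn (col true ω ∩ G) b v}
      fun v ⟨b, _, hb⟩ => hb.right_mem.2
    obtain ⟨t, ht⟩ := hcl {v | Conn (col true ω ∩ G) a v} fun v hb => hb.right_mem.2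
    have hsub : col true (cfg s) ∩ G ⊆ col true ω ∩ G := by
      rintro v ⟨hv, hvG⟩
      rw [hcfg] at hv
      obtain ⟨b, _, hb⟩ := (hs v).1 hv
      exact hb.right_mem
    refine ⟨s, t, ?_, ?_, ?_, ih ?_ ?_, ?_⟩
    · rw [Finset.disjoint_left]
      intro v hv hv'
      obtain ⟨b, hb, hbv⟩ := (hs v).1 hv
      exact h2 a (Finset.mem_insert_self _ _) b (Finset.mem_insert_of_mem hb)
        (fun h => ha (h ▸ hb)) (((ht v).1 hv').trans hbv.symm)
    · intro v hv
      obtain ⟨b, hb, hbv⟩ := (hs v).1 hv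
      exact hbv.right_mem.1
    · intro v hv
      exact ((ht v).1 hv).right_mem.1
    · intro b hb
      obtain ⟨h3, z, hz, hbz⟩ := h1 b (Finset.mem_insert_of_mem hb)
      refine ⟨h3, z, hz, hbz.in_cluster.mono fun v hv => ?_⟩
      rw [hcfg]
      exact ⟨(hs v).2 ⟨b, hb, hv⟩, hv.right_mem.2⟩
    · intro b hb b' hb' hne hc
      exact h2 b (Finset.mem_insert_of_mem hb) b' (Finset.mem_insert_of_mem hb') hne
        (hc.mono hsub)
    · obtain ⟨h3, z, hz, haz⟩ := h1 a (Finset.mem_insert_self _ _)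
      refine ⟨a, h3, z, hz, haz.in_cluster.mono fun v hv => ?_⟩
      rw [hcfg]
      exact ⟨(ht v).2 hv, hv.right_mem.2⟩

theorem IsBernoulliHalf.sum_arms_le_true {μ : Measure Config} (hμ : IsBernoulliHalf μ)
    {G Inn Out : Set Site} (hG : G.Finite) {ρ : ℝ} (hρ : ρ < 1)
    (harm : μ.real (arm true G Inn Out) ≤ ρ) {ι : Type*} (J : Finset ι) (X : ι → Set Config)
    (hX : ∀ i ∈ J, MeasurableSet (X i))
    (h : ∀ ω, ∃ a : ι → Site,
      (∀ i ∈ J, ω ∈ X i → a i ∈ Inn ∧ ∃ b ∈ Out, Conn (col true ω ∩ G) (a i) b) ∧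
      ∀ i ∈ J, ∀ j ∈ J, i ≠ j → ω ∈ X i → ω ∈ X j → ¬Conn (col true ω ∩ G) (a i) (a j)) :
    ∑ i ∈ J, μ.real (X i) ≤ 1 / (1 - ρ) := by
  classical
  have := hμ.prob
  have hρ0 : 0 ≤ ρ := measureReal_nonneg.trans harm
  set A := arm true G Inn Out
  have hA : DepOn G A := arm_depOn _ _ _ _
  have hA' : Incr A := (arm_incrC _ _ _ _).incr
  have hpt : ∀ ω, ∑ i ∈ J, (X i).indicator (1 : Config → ℝ) ω ≤
      ∑ k ∈ Finset.range J.card, (disjPow A (k + 1)).indicator (1 : Config → ℝ) ω := by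
    intro ω
    obtain ⟨a, h1, h2⟩ := h ω
    set J' := J.filter fun i => ω ∈ X i
    have hJ' : ∑ i ∈ J, (X i).indicator (1 : Config → ℝ) ω = J'.card := by
      simp only [Set.indicator_apply, Pi.one_apply, Finset.sum_boole, J']
    have hinj : ∀ i ∈ J', ∀ j ∈ J', a i = a j → i = j := by
      intro i hi j hj hij
      by_contra hne
      obtain ⟨hi, hiX⟩ := Finset.mem_filter.1 hi
      obtain ⟨hj, hjX⟩ := Finset.mem_filter.1 hj
      refine h2 i hi j hj hne hiX hjX ?_
      obtain ⟨-, b, -, hb⟩ := h1 i hi hiX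
      rw [← hij]
      exact Conn.refl hb.left_mem
    have hmem : ∀ k ≤ J'.card, ω ∈ disjPow A k := by
      intro k hk
      obtain ⟨K, hK, rfl⟩ := Finset.exists_subset_card_eq hk
      rw [← Finset.card_image_of_injOn (f := a) fun i hi j hj => hinj i (hK hi) j (hK hj)]
      refine mem_disjPow_of_arms hG _ ?_ ?_
      · intro x hx
        obtain ⟨i, hi, rfl⟩ := Finset.mem_image.1 hx
        obtain ⟨hi, hiX⟩ := Finset.mem_filter.1 (hK hi)
        exact h1 i hi hiX
      · intro x hx y hy hxy
        obtain ⟨i, hi, rfl⟩ := Finset.mem_image.1 hx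
        obtain ⟨j, hj, rfl⟩ := Finset.mem_image.1 hy
        obtain ⟨hi, hiX⟩ := Finset.mem_filter.1 (hK hi)
        obtain ⟨hj, hjX⟩ := Finset.mem_filter.1 (hK hj)
        exact h2 i hi j hj (fun h => hxy (h ▸ rfl)) hiX hjX
    have hcard : J'.card ≤ J.card := Finset.card_filter_le _ _
    rw [hJ']
    calc (J'.card : ℝ) = ∑ k ∈ Finset.range J'.card, (1 : ℝ) := by simp
      _ = ∑ k ∈ Finset.range J'.card, (disjPow A (k + 1)).indicator (1 : Config → ℝ) ω := by
          refine Finset.sum_congr rfl fun k hk => ?_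
          rw [Set.indicator_of_mem (hmem _ (Finset.mem_range.1 hk))]
          rfl
      _ ≤ _ := Finset.sum_le_sum_of_subset_of_nonneg (Finset.range_mono hcard)
          fun k _ _ => Set.indicator_nonneg (fun _ _ => zero_le_one) _
  have hmD : ∀ k, MeasurableSet (disjPow A k) := fun k => (disjPow_depOn hA k).measurableSet hG
  have hle := integral_mono (μ := μ)
    (integrable_finsetSum J fun i hi => (integrable_const (1 : ℝ)).indicator (hX i hi))
    (integrable_finsetSum (Finset.range J.card) fun k _ =>
      (integrable_const (1 : ℝ)).indicator (hmD (k + 1))) hpt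
  rw [integral_finsetSum J fun i hi => (integrable_const (1 : ℝ)).indicator (hX i hi),
    integral_finsetSum (Finset.range J.card) fun k _ =>
      (integrable_const (1 : ℝ)).indicator (hmD (k + 1))] at hle
  have e1 : ∑ i ∈ J, μ.real (X i) = ∑ i ∈ J, ∫ ω, (X i).indicator (fun _ => (1 : ℝ)) ω ∂μ :=
    Finset.sum_congr rfl fun i hi => by rw [integral_indicator (hX i hi)]; simp
  have e2 : ∀ k, ∫ ω, (disjPow A (k + 1)).indicator (fun _ => (1 : ℝ)) ω ∂μ =
      μ.real (disjPow A (k + 1)) := fun k => by rw [integral_indicator (hmD _)]; simp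
  rw [e1]
  refine hle.trans ?_
  simp only [e2]
  have hgeom : ∑ k ∈ Finset.range J.card, ρ ^ k ≤ 1 / (1 - ρ) := by
    rw [one_div]
    rw [← tsum_geometric_of_lt_one hρ0 hρ]
    exact (summable_geometric_of_lt_one hρ0 hρ).sum_le_tsum _ fun k _ => pow_nonneg hρ0 k
  refine (Finset.sum_le_sum fun k _ => ?_).trans hgeom
  calc μ.real (disjPow A (k + 1)) ≤ μ.real A ^ (k + 1) := hμ.real_disjPow_le hG hA hA' _
    _ ≤ ρ ^ (k + 1) := pow_le_pow_left₀ measureReal_nonneg harm _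
    _ ≤ ρ ^ k := pow_le_pow_of_le_one hρ0 hρ.le (Nat.le_succ k)

/-- If occurrences of the events `X i` give rise to pairwise disconnected arms of colour `s`, then
the sum of their probabilities is bounded. -/
theorem IsBernoulliHalf.sum_arms_le {μ : Measure Config} (hμ : IsBernoulliHalf μ) (s : Bool)
    {G S Inn Out : Set Site} (hG : G.Finite) (hS : S.Finite) {ρ : ℝ} (hρ : ρ < 1)
    (harm : μ.real (arm s G Inn Out) ≤ ρ) {ι : Type*} (J : Finset ι) (X : ι → Set Config)
    (hX : ∀ i ∈ J, DepOn S (X i))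
    (h : ∀ ω, ∃ a : ι → Site,
      (∀ i ∈ J, ω ∈ X i → a i ∈ Inn ∧ ∃ b ∈ Out, Conn (col s ω ∩ G) (a i) b) ∧
      ∀ i ∈ J, ∀ j ∈ J, i ≠ j → ω ∈ X i → ω ∈ X j → ¬Conn (col s ω ∩ G) (a i) (a j)) :
    ∑ i ∈ J, μ.real (X i) ≤ 1 / (1 - ρ) := by
  cases s
  · have e : ∀ i ∈ J, μ.real (X i) = μ.real {ω | flipCfg ω ∈ X i} :=
      fun i hi => (hμ.real_flip hS (hX i hi)).symm
    rw [Finset.sum_congr rfl e]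
    refine hμ.sum_arms_le_true (Inn := Inn) (Out := Out) hG hρ ?_ J _
      (fun i hi => (hX i hi).flipCfg.measurableSet hS) fun ω => ?_
    · rwa [← hμ.real_flip hG (arm_depOn _ _ _ _), flip_arm]
    · have := h (flipCfg ω)
      rwa [col_flip] at this
  · exact hμ.sum_arms_le_true hG hρ harm J X (fun i hi => (hX i hi).measurableSet hS) h

/-! ### Exploring a cluster -/

/-- The union of the clusters of colour `s` in `D` that meet `Z`. -/
def kap (s : Bool) (D Z : Set Site) (ω : Config) : Set Site :=
  {v | ∃ z ∈ Z, Conn (col s ω ∩ D) z v}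

/-- The sites examined when exploring the clusters `K` from `Z` in `D`. -/
def nbhd (D Z K : Set Site) : Set Site := K ∪ {v ∈ D | v ∈ Z ∨ ∃ u ∈ K, Adj u v}

theorem kap_subset {s : Bool} {D Z : Set Site} {ω : Config} : kap s D Z ω ⊆ col s ω ∩ D :=
  fun _ ⟨_, _, h⟩ => h.right_mem

theorem nbhd_subset {D Z K : Set Site} (hK : K ⊆ D) : nbhd D Z K ⊆ D :=
  fun _ h => h.elim (fun h => hK h) fun h => h.1

theorem kap_nbhd {s : Bool} {D Z : Set Site} {ω : Config} {v : Site}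
    (hv : v ∈ nbhd D Z (kap s D Z ω)) (hv' : v ∉ kap s D Z ω) : ω v = !s := by
  rcases hv with hv | ⟨hvD, hv⟩
  · exact absurd hv hv'
  · by_contra hne
    have hs : ω v = s := by revert hne; cases ω v <;> cases s <;> simp
    rcases hv with hv | ⟨u, ⟨z, hz, hu⟩, huv⟩
    · exact hv' ⟨v, hv, Conn.refl ⟨hs, hvD⟩⟩
    · exact hv' ⟨z, hz, hu.tail huv ⟨hs, hvD⟩⟩

theorem kap_eq {s : Bool} {D Z : Set Site} {ω ω' : Config}
    (h1 : ∀ v ∈ kap s D Z ω, ω' v = s)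
    (h2 : ∀ v ∈ nbhd D Z (kap s D Z ω), v ∉ kap s D Z ω → ω' v = !s) :
    kap s D Z ω' = kap s D Z ω := by
  ext v
  constructor
  · rintro ⟨z, hz, h⟩
    have key : ∀ u ∈ nbhd D Z (kap s D Z ω), ω' u = s → u ∈ kap s D Z ω := by
      intro u hu hs
      by_contra hne
      have := h2 u hu hne
      rw [hs] at this
      cases s <;> simp at this
    refine h.ind (key z (Or.inr ⟨h.left_mem.2, Or.inl hz⟩) h.left_mem.1) fun a b ha hab hb ih => ?_
    exact key b (Or.inr ⟨hb.2, Or.inr ⟨a, ih, hab⟩⟩) hb.1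
  · rintro ⟨z, hz, h⟩
    refine ⟨z, hz, h.in_cluster.mono fun u hu => ⟨h1 u ⟨z, hz, hu⟩, ?_⟩⟩
    exact Conn.right_mem hu |>.2

open Classical in
/-- Repaint the sites of `T` as in `f`. -/
noncomputable def paint (T : Set Site) (f ω : Config) : Config := fun v => if v ∈ T then f v else ω v

theorem paint_of_mem {T : Set Site} {f ω : Config} {v : Site} (h : v ∈ T) :
    paint T f ω v = f v := if_pos h

theorem paint_of_notMem {T : Set Site} {f ω : Config} {v : Site} (h : v ∉ T) :
    paint T f ω v = ω v := if_neg h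

theorem paint_depOn {S T : Set Site} {f : Config} {A : Set Config} (hA : DepOn S A) :
    DepOn (S \ T) {ω | paint T f ω ∈ A} := by
  intro ω ω' h
  refine hA _ _ fun v hv => ?_
  by_cases hT : v ∈ T
  · rw [paint_of_mem hT, paint_of_mem hT]
  · rw [paint_of_notMem hT, paint_of_notMem hT, h v ⟨hv, hT⟩]

theorem paint_incrC {s : Bool} {T : Set Site} {f : Config} {A : Set Config} (hA : IncrC s A) :
    IncrC s {ω | paint T f ω ∈ A} := by
  intro ω ω' h
  refine hA _ _ fun v hv => ?_
  by_cases hT : v ∈ T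
  · rw [col, Set.mem_ofPred_eq, paint_of_mem hT] at *; exact hv
  · rw [col, Set.mem_ofPred_eq, paint_of_notMem hT] at *; exact h hv

open Classical in
/-- The configuration with colour `s` exactly on `K`. -/
noncomputable def onCfg (s : Bool) (K : Set Site) : Config := fun v => if v ∈ K then s else !s

theorem onCfg_of_mem {s : Bool} {K : Set Site} {v : Site} (h : v ∈ K) : onCfg s K v = s := if_pos h

theorem onCfg_of_notMem {s : Bool} {K : Set Site} {v : Site} (h : v ∉ K) : onCfg s K v = !s :=
  if_neg h

/-- Conditioning on the explored cluster and using the Harris inequality in the rest. -/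
theorem IsBernoulliHalf.explore {μ : Measure Config} (hμ : IsBernoulliHalf μ) {D S : Set Site}
    (hS : S.Finite) (hDS : D ⊆ S) (s : Bool) (Z : Set Site) (Q : Set Site → Prop) {O : Set Config}
    (hO : DepOn S O) (hO' : IncrC (!s) O) (A : Set Site → Set Config) (c : ℝ)
    (hA : ∀ ω, Q (kap s D Z ω) → IncrC (!s) (A (kap s D Z ω)) ∧
      DepOn (S \ nbhd D Z (kap s D Z ω)) (A (kap s D Z ω)) ∧ c ≤ μ.real (A (kap s D Z ω))) :
    c * μ.real {ω | Q (kap s D Z ω) ∧ ω ∈ O} ≤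
      μ.real {ω | Q (kap s D Z ω) ∧ ω ∈ O ∧ ω ∈ A (kap s D Z ω)} := by
  classical
  have := hμ.prob
  have hD := hS.subset hDS
  set 𝒦 : Finset (Finset Site) :=
    hD.toFinset.powerset.filter fun k => ∃ ω, kap s D Z ω = ↑k ∧ Q ↑k with h𝒦
  set cyl : Finset Site → Set Config := fun k =>
    {ω | ∀ v ∈ nbhd D Z ↑k, ω v = onCfg s ↑k v} with hcyl
  have hsub : ∀ k ∈ 𝒦, (↑k : Set Site) ⊆ D := by
    intro k hk v hv
    have := Finset.mem_powerset.1 (Finset.mem_filter.1 hk).1 hv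
    simpa using this
  have hcylD : ∀ k : Finset Site, DepOn (nbhd D Z ↑k) (cyl k) :=
    fun k ω ω' h hω v hv => by rw [← h v hv]; exact hω v hv
  have hcylS : ∀ k ∈ 𝒦, DepOn S (cyl k) :=
    fun k hk => (hcylD k).mono ((nbhd_subset (hsub k hk)).trans hDS)
  have hcyl1 : ∀ k ∈ 𝒦, ∀ ω ∈ cyl k, kap s D Z ω = ↑k := by
    intro k hk ω hω
    obtain ⟨ω₀, h0, -⟩ := (Finset.mem_filter.1 hk).2
    rw [← h0]
    refine kap_eq (fun v hv => ?_) fun v hv hv' => ?_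
    · rw [h0] at hv
      rw [hω v (Or.inl hv), onCfg_of_mem hv]
    · rw [h0] at hv hv'
      rw [hω v hv, onCfg_of_notMem hv']
  have hcyl2 : ∀ ω, Q (kap s D Z ω) → ∃ k ∈ 𝒦, ω ∈ cyl k := by
    intro ω hQ
    have hf : (kap s D Z ω).Finite := hD.subset fun v hv => (kap_subset hv).2
    obtain ⟨k, hk⟩ := hf.exists_finset_coe
    refine ⟨k, Finset.mem_filter.2 ⟨?_, ω, hk.symm, hk ▸ hQ⟩, ?_⟩
    · rw [Finset.mem_powerset]
      intro v hv
      have : v ∈ kap s D Z ω := by rw [← hk]; exact hv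
      simpa using (kap_subset this).2
    · intro v hv
      rw [hk] at hv ⊢
      by_cases hvk : v ∈ kap s D Z ω
      · rw [onCfg_of_mem hvk]; exact (kap_subset hvk).1
      · rw [onCfg_of_notMem hvk]; exact kap_nbhd hv hvk
  have hdec : ∀ R : Finset Site → Set Config, (∀ k ∈ 𝒦, DepOn S (R k)) →
      ∀ R' : Set Config, (∀ k ∈ 𝒦, ∀ ω ∈ cyl k, ω ∈ R' ↔ ω ∈ R k) →
      μ.real {ω | Q (kap s D Z ω) ∧ ω ∈ R'} = ∑ k ∈ 𝒦, μ.real (cyl k ∩ R k) := by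
    intro R hR R' hR'
    rw [← measureReal_biUnion_finset]
    · congr 1
      ext ω
      simp only [Set.mem_ofPred_eq, Set.mem_iUnion, exists_prop]
      constructor
      · rintro ⟨hQ, hω⟩
        obtain ⟨k, hk, hωk⟩ := hcyl2 ω hQ
        exact ⟨k, hk, hωk, (hR' k hk ω hωk).1 hω⟩
      · rintro ⟨k, hk, hωk, hω⟩
        refine ⟨?_, (hR' k hk ω hωk).2 hω⟩
        obtain ⟨-, -, -, hQ⟩ := Finset.mem_filter.1 hk
        rw [hcyl1 k hk ω hωk]; exact hQ
    · intro k hk k' hk' hne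
      refine Set.disjoint_left.2 fun ω h1 h2 => hne ?_
      have := (hcyl1 k hk ω h1.1).symm.trans (hcyl1 k' hk' ω h2.1)
      exact_mod_cast this
    · exact fun k hk => ((hcylS k hk).inter (hR k hk)).measurableSet hS
  set OK : Finset Site → Set Config := fun k => {ω | paint (nbhd D Z ↑k) (onCfg s ↑k) ω ∈ O}
  have hpaint : ∀ k : Finset Site, ∀ ω ∈ cyl k, paint (nbhd D Z ↑k) (onCfg s ↑k) ω = ω := by
    intro k ω hω
    funext v
    by_cases hv : v ∈ nbhd D Z ↑k
    · rw [paint_of_mem hv, hω v hv]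
    · rw [paint_of_notMem hv]
  have hOK1 : ∀ k : Finset Site, DepOn (S \ nbhd D Z ↑k) (OK k) := fun k => paint_depOn hO
  have hOK2 : ∀ k : Finset Site, IncrC (!s) (OK k) := fun k => paint_incrC hO'
  have hQk : ∀ k ∈ 𝒦, IncrC (!s) (A ↑k) ∧ DepOn (S \ nbhd D Z ↑k) (A ↑k) ∧ c ≤ μ.real (A ↑k) := by
    intro k hk
    obtain ⟨-, ω, hω, hQ⟩ := Finset.mem_filter.1 hk
    rw [← hω] at hQ ⊢
    exact hA ω hQ
  have hsum : μ.real {ω | Q (kap s D Z ω) ∧ ω ∈ O ∧ ω ∈ A (kap s D Z ω)} =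
      ∑ k ∈ 𝒦, μ.real (cyl k ∩ (OK k ∩ A ↑k)) :=
    hdec (fun k => OK k ∩ A ↑k) (fun k hk => ((hOK1 k).inter (hQk k hk).2.1).mono Set.sdiff_subset)
      {ω | ω ∈ O ∧ ω ∈ A (kap s D Z ω)} fun k hk ω hω => by
      simp only [OK, Set.mem_ofPred_eq, Set.mem_inter_iff, hpaint k ω hω, hcyl1 k hk ω hω]
  rw [hdec OK (fun k _ => (hOK1 k).mono Set.sdiff_subset) O fun k _ ω hω => by
      simp only [OK, Set.mem_ofPred_eq, hpaint k ω hω],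
    hsum, Finset.mul_sum]
  refine Finset.sum_le_sum fun k hk => ?_
  obtain ⟨h1, h2, h3⟩ := hQk k hk
  have hfin : (S \ nbhd D Z (↑k : Set Site)).Finite := hS.subset Set.sdiff_subset
  have hNfin : (nbhd D Z (↑k : Set Site)).Finite := hD.subset (nbhd_subset (hsub k hk))
  have hdisj : Disjoint (nbhd D Z (↑k : Set Site)) (S \ nbhd D Z ↑k) := Set.disjoint_sdiff_right
  rw [hμ.indep hNfin hfin hdisj (hcylD k) (hOK1 k),
    hμ.indep hNfin hfin hdisj (hcylD k) ((hOK1 k).inter h2)]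
  have hH := hμ.harrisC (!s) hfin (hOK1 k) h2 (hOK2 k) h1
  have h4 := mul_le_mul_of_nonneg_left h3 (measureReal_nonneg (μ := μ) (s := OK k))
  nlinarith [measureReal_nonneg (μ := μ) (s := cyl k)]

/-! ### Crossings of windows in a horizontal strip -/

/-- The part of the strip `0 ≤ y ≤ b` with `lo ≤ lin ≤ hi`. -/
def strip (lo hi b : ℤ) : Set Site := {v | 0 ≤ v.2 ∧ v.2 ≤ b ∧ lo ≤ lin v ∧ lin v ≤ hi}

theorem finite_rect (x₀ x₁ y₀ y₁ : ℤ) : (rect x₀ x₁ y₀ y₁).Finite := by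
  refine ((Set.finite_Icc x₀ x₁).prod (Set.finite_Icc y₀ y₁)).subset ?_
  rintro ⟨x, y⟩ ⟨h1, h2, h3, h4⟩
  exact ⟨⟨h1, h2⟩, h3, h4⟩

theorem finite_strip (lo hi b : ℤ) : (strip lo hi b).Finite := by
  refine (finite_rect (min (lo - b) 0) (max hi 0) 0 b).subset ?_
  rintro ⟨x, y⟩ ⟨h1, h2, h3, h4⟩
  simp only [lin] at h1 h2 h3 h4
  simp only [rect, Set.mem_ofPred_eq]
  omega

theorem Conn.map {S T : Set Site} {a b : Site} (h : Conn S a b) {f : Site → Site}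
    (hf : ∀ u v, Adj u v → Adj (f u) (f v)) (hST : ∀ v ∈ S, f v ∈ T) : Conn T (f a) (f b) :=
  h.ind (P := fun x => Conn T (f a) (f x)) (Conn.refl (hST a h.1)) fun _ _ _ huv hv ih =>
    ih.tail (hf _ _ huv) (hST _ hv)

/-- The reflection of the triangular lattice that changes the sign of `lin`. -/
def mirror (v : Site) : Site := (-v.1 - v.2, v.2)

theorem mirror_mirror (v : Site) : mirror (mirror v) = v := by
  ext <;> simp [mirror]

theorem lin_mirror (v : Site) : lin (mirror v) = -lin v := by
  simp only [lin, mirror]; ring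

theorem adj_mirror (u v : Site) (h : Adj u v) : Adj (mirror u) (mirror v) := by
  rw [adj_iff] at *; simp only [mirror]; omega

theorem strip_lower {N b : ℤ} (hN : 2 ≤ N) (hb : 1 ≤ b) {K : Set Site}
    (hK : K ⊆ strip (-N) 0 b) (hKt : ∀ v ∈ K, v.2 ≠ b) :
    ∃ a a', lin a ≤ -N + 1 ∧ -1 ≤ lin a' ∧
      Conn (nbhd (strip (-N) 0 b) {v | v.2 = 0} K \ K) a a' := by
  set Λ := strip (-N) 0 b with hΛ
  set M := nbhd Λ {v | v.2 = 0} K with hM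
  have hMΛ : M ⊆ Λ := nbhd_subset hK
  set LO : Set Site := {v | 0 ≤ v.2 ∧ v.2 ≤ b ∧ lin v < -N} with hLO
  set RO : Set Site := {v | 0 ≤ v.2 ∧ v.2 ≤ b ∧ 0 < lin v} with hRO
  set B : Set Site := (M \ K) ∪ LO ∪ RO with hB
  have hBs : ∀ v ∈ B, 0 ≤ v.2 ∧ v.2 ≤ b := by
    rintro v ((h | h) | h)
    · exact ⟨(hMΛ h.1).1, (hMΛ h.1).2.1⟩
    · exact ⟨h.1, h.2.1⟩
    · exact ⟨h.1, h.2.1⟩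
  have hw : ∀ y, y < 0 ∨ b < y → Conn Bᶜ (-(N + b + 1), y) (N + b + 1, y) := by
    intro y hy
    refine conn_horiz (by omega) fun z h1 h2 h => ?_
    have := hBs _ h
    dsimp only at this
    omega
  have hd := duality (B := B) (l := (-(N + b + 1), b)) (l' := (-(N + b + 1), 0))
    (b := (-(N + b + 1), -1)) (b' := (N + b + 1, -1)) (r := (N + b + 1, 0)) (r' := (N + b + 1, b))
    (t := (N + b + 1, b + 1)) (t' := (-(N + b + 1), b + 1))
    (conn_vert (by omega) fun z h1 h2 => Or.inl (Or.inr ⟨h1, h2, by simp only [lin]; omega⟩)).symm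
    (hw _ (by omega))
    (conn_vert (by omega) fun z h1 h2 => Or.inr ⟨h1, h2, by simp only [lin]; omega⟩)
    (hw _ (by omega)).symm
    (by simp [adj_iff]) (by simp [adj_iff]) (by simp [adj_iff]) (by simp [adj_iff])
  rcases hd with hd | hd
  · obtain ⟨a0, a', b', b0, ha0, -, hb0, -, h1, h2, h3⟩ := hd.between (A := LO) (B := RO)
      ⟨by dsimp only; omega, by dsimp only; omega, by simp only [lin]; omega⟩
      ⟨by dsimp only; omega, by dsimp only; omega, by simp only [lin]; omega⟩
      (fun x _ hx hx' => by have := hx.2.2; have := hx'.2.2; omega)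
      (fun x _ y _ hx hy hxy => by
        have := hx.2.2; have := hy.2.2; rw [adj_iff] at hxy; simp only [lin] at *; omega)
    refine ⟨a', b', ?_, ?_, h3.mono ?_⟩
    · have := ha0.2.2; rw [adj_iff] at h1; simp only [lin] at *; omega
    · have := hb0.2.2; rw [adj_iff] at h2; simp only [lin] at *; omega
    · rintro v ⟨(h | h) | h, h'⟩
      · exact h
      · exact absurd (Or.inl h) h'
      · exact absurd (Or.inr h) h'
  · exfalso
    obtain ⟨a0, a', b', b0, ha0, -, hb0, -, h1, h2, h3⟩ := hd.between (A := {v | v.2 < 0})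
      (B := {v | b < v.2}) (by simp) (by simp)
      (fun x _ hx hx' => by simp only [Set.mem_ofPred_eq] at *; omega)
      (fun x _ y _ hx hy hxy => by
        rw [adj_iff] at hxy; simp only [Set.mem_ofPred_eq] at *; omega)
    have hin : ∀ v ∈ Bᶜ \ ({v | v.2 < 0} ∪ {v | b < v.2}), v ∈ Λ ∧ (v ∈ M → v ∈ K) := by
      rintro v ⟨hv, hv'⟩
      simp only [Set.mem_union, Set.mem_ofPred_eq, not_or, not_lt] at hv'
      refine ⟨⟨hv'.1, hv'.2, ?_, ?_⟩, fun h => ?_⟩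
      · by_contra h; exact hv (Or.inl (Or.inr ⟨hv'.1, hv'.2, by omega⟩))
      · by_contra h; exact hv (Or.inr ⟨hv'.1, hv'.2, by omega⟩)
      · by_contra h'; exact hv (Or.inl (Or.inl ⟨h, h'⟩))
    have hK' : b' ∈ K := by
      refine h3.ind ?_ ?_
      · have ha' := hin _ h3.left_mem
        refine ha'.2 (Or.inr ⟨ha'.1, Or.inl ?_⟩)
        have := ha'.1.1
        rw [adj_iff] at h1; simp only [Set.mem_ofPred_eq] at *; omega
      · intro u v hu huv hv ih
        have hv' := hin _ hv
        exact hv'.2 (Or.inr ⟨hv'.1, Or.inr ⟨u, ih, huv⟩⟩)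
    have := (hin _ h3.right_mem).1.2.1
    have := hKt _ hK'
    rw [adj_iff] at h2; simp only [Set.mem_ofPred_eq] at *; omega

theorem kap_misses_top {N b : ℤ} {ω : Config}
    (h : ω ∈ arm true (strip (-N) 0 b) {v | lin v ≤ -N + 1} {v | -1 ≤ lin v}) {v : Site}
    (hv : v ∈ kap false (strip (-N) 0 b) {v | v.2 = 0} ω) : v.2 ≠ b := by
  rintro hb
  obtain ⟨a, ha, a', ha', hc⟩ := h
  obtain ⟨z, hz, hzv⟩ := hv
  simp only [Set.mem_ofPred_eq] at ha ha' hz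
  obtain ⟨w, hw, hw'⟩ := hc.cross_lin hzv
    (fun v hv => by have := hv.2.2.2; omega)
    (fun v hv => by have := hv.2; have := this.1; have := hv.2.2.1; omega)
    (fun v hv => by have := hv.2; have := this.1; have := hv.2.2.1; omega)
  have h1 := hw.1
  have h2 := hw'.1
  simp only [col, Set.mem_ofPred_eq] at h1 h2
  simp [h1] at h2

theorem reach_axis {N b : ℤ} (hN : 4 ≤ N) {G : Set Site} (hG : G ⊆ strip (-N) 0 b) {a a' : Site}
    (ha : lin a ≤ -N + 1) (ha' : -1 ≤ lin a') (h : Conn G a a') :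
    ∃ e d, Conn G a e ∧ Adj e d ∧ Conn {v | mirror v ∈ G ∧ 1 ≤ lin v} d (mirror a) := by
  obtain ⟨c, c', h1, h2, h3, h4, -⟩ := h.exit (Q := {v | lin v ≤ -2})
    (by simp only [Set.mem_ofPred_eq]; omega) (by simp only [Set.mem_ofPred_eq]; omega)
  simp only [Set.mem_ofPred_eq, not_le] at h4
  have h0 := (hG h3).2.2.2
  have hm : Conn {v | mirror v ∈ G ∧ 1 ≤ lin v} (mirror c) (mirror a) := by
    refine h1.symm.map adj_mirror fun v hv => ⟨?_, ?_⟩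
    · rw [mirror_mirror]; exact hv.1
    · have := hv.2; rw [lin_mirror]; simp only [Set.mem_ofPred_eq] at this; omega
  have hac : Conn G a c' := (h1.mono Set.inter_subset_left).tail h2 h3
  rcases (by omega : lin c' = 0 ∨ lin c' = -1) with h5 | h5
  · refine ⟨c', mirror c, hac, ?_, hm⟩
    have e : mirror c' = c' := by
      simp only [lin] at h5
      ext <;> simp only [mirror]; omega
    have := adj_mirror _ _ h2
    rw [e] at this
    exact this.symm
  · have hc' : mirror c' ∈ {v | mirror v ∈ G ∧ 1 ≤ lin v} := by
      refine ⟨?_, ?_⟩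
      · rw [mirror_mirror]; exact h3
      · rw [lin_mirror]; omega
    refine ⟨c', mirror c', hac, ?_, (Conn.of_adj hc' hm.left_mem (adj_mirror _ _ h2.symm)).trans hm⟩
    simp only [lin] at h5; exact adj_iff.2 (Or.inl ⟨by simp only [mirror]; omega, rfl⟩)

/-- Sites painted black: the explored set `M`, the open sites away from `M` and its mirror image,
and two opposite quadrants outside the strip. -/
def painted (N b ℓ : ℤ) (M : Set Site) (ω : Config) : Set Site :=
  {v | v ∈ M ∨ (v ∈ strip (-N) N b ∧ v ∉ M ∧ mirror v ∉ M ∧ ω v = true) ∨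
    (v ∉ strip (-N) N b ∧ ((v.2 ≤ ℓ ∧ lin v ≤ 0) ∨ (ℓ < v.2 ∧ 0 ≤ lin v)))}

theorem painted_depOn (N b ℓ : ℤ) (M : Set Site) (P : Set Site → Prop) :
    DepOn (strip (-N) N b \ M) {ω | P (painted N b ℓ M ω)} := by
  intro ω ω' h hω
  have : painted N b ℓ M ω' = painted N b ℓ M ω := by
    ext v
    simp only [painted, Set.mem_ofPred_eq]
    refine or_congr_right (or_congr_left ⟨fun hv => ⟨hv.1, hv.2.1, hv.2.2.1, ?_⟩,
      fun hv => ⟨hv.1, hv.2.1, hv.2.2.1, ?_⟩⟩)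
    · rw [h v ⟨hv.1, hv.2.1⟩]; exact hv.2.2.2
    · rw [← h v ⟨hv.1, hv.2.1⟩]; exact hv.2.2.2
  rw [Set.mem_ofPred_eq, this]
  exact hω

theorem painted_mono (N b ℓ : ℤ) (M : Set Site) {ω ω' : Config} (h : col true ω ⊆ col true ω') :
    painted N b ℓ M ω ⊆ painted N b ℓ M ω' := by
  rintro v (hv | hv | hv)
  · exact Or.inl hv
  · exact Or.inr (Or.inl ⟨hv.1, hv.2.1, hv.2.2.1, h hv.2.2.2⟩)
  · exact Or.inr (Or.inr hv)

/-- The mirror as a permutation of the sites. -/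
def mirrorEquiv : Site ≃ Site := ⟨mirror, mirror, mirror_mirror, mirror_mirror⟩

theorem mirror_mem_strip {N b : ℤ} {v : Site} : mirror v ∈ strip (-N) N b ↔ v ∈ strip (-N) N b := by
  simp only [strip, Set.mem_ofPred_eq, lin_mirror]
  simp only [mirror]; omega

theorem mirror_white {N b ℓ : ℤ} {M : Set Site} {ω : Config} {v : Site} (hv : v ∈ (painted N b ℓ M ω)ᶜ) :
    mirror v ∈ painted N b ℓ M fun v => xor true (ω (mirrorEquiv v)) := by
  simp only [painted, Set.mem_compl_iff, Set.mem_ofPred_eq, not_or] at hv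
  obtain ⟨h1, h2, h3⟩ := hv
  by_cases hs : v ∈ strip (-N) N b
  · by_cases hm : mirror v ∈ M
    · exact Or.inl hm
    · refine Or.inr (Or.inl ⟨mirror_mem_strip.2 hs, hm, by rwa [mirror_mirror], ?_⟩)
      have : ω v ≠ true := fun h => h2 ⟨hs, h1, hm, h⟩
      simp only [mirrorEquiv, Equiv.coe_fn_mk, mirror_mirror]
      simpa using this
  · refine Or.inr (Or.inr ⟨fun h => hs (mirror_mem_strip.1 h), ?_⟩)
    have h4 : ¬((v.2 ≤ ℓ ∧ lin v ≤ 0) ∨ (ℓ < v.2 ∧ 0 ≤ lin v)) := fun h => h3 ⟨hs, h⟩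
    rw [lin_mirror]
    simp only [mirror]
    omega

theorem IsBernoulliHalf.painted_half {μ : Measure Config} (hμ : IsBernoulliHalf μ) {N b : ℤ}
    (hN : 4 ≤ N) (hb : 1 ≤ b) {M G : Set Site} (hM : M ⊆ strip (-N) 0 b) (hG : G ⊆ M)
    {a a' : Site} (ha : lin a ≤ -N + 1) (ha' : -1 ≤ lin a') (h : Conn G a a') :
    1 / 2 ≤ μ.real {ω | Conn (painted N b a.2 M ω) a (-a.1 - a.2 + 1, a.2 + 1)} := by
  have := hμ.prob
  obtain ⟨e, d, h1, h2, h3⟩ := reach_axis hN (hG.trans hM) ha ha' h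
  have haM := hM (hG h.left_mem)
  obtain ⟨u, ℓ⟩ := a
  simp only [strip, lin, Set.mem_ofPred_eq] at haM ha
  set E : Set Config := {ω | Conn (painted N b ℓ M ω) (u, ℓ) (-u - ℓ + 1, ℓ + 1)} with hE
  obtain ⟨x, hx⟩ : ∃ x : ℤ, 2 * x + b + 1 = 0 ∨ 2 * x + b + 1 = 1 := ⟨-((b + 1) / 2), by omega⟩
  have hblack : ∀ ω v, v ∉ strip (-N) N b → ((v.2 ≤ ℓ ∧ lin v ≤ 0) ∨ (ℓ < v.2 ∧ 0 ≤ lin v)) →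
      v ∈ painted N b ℓ M ω := fun ω v hv hv' => Or.inr (Or.inr ⟨hv, hv'⟩)
  have hwhite : ∀ ω v, v ∉ strip (-N) N b → ¬((v.2 ≤ ℓ ∧ lin v ≤ 0) ∨ (ℓ < v.2 ∧ 0 ≤ lin v)) →
      v ∈ (painted N b ℓ M ω)ᶜ := by
    rintro ω v hv hv' (hw | hw | hw)
    · refine hv ?_
      have := hM hw
      exact ⟨this.1, this.2.1, this.2.2.1, by have := this.2.2.2; omega⟩
    · exact hv hw.1
    · exact hv' hw.2
  have hright : ∀ ω, ∀ x', 0 ≤ 2 * x' + b + 1 → x' ≤ - u - ℓ + 1 →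
      Conn (painted N b ℓ M ω) (-u - ℓ + 1, ℓ + 1) (x', b + 1) := by
    intro ω x' hx' hx''
    refine (conn_vert (y' := b + 1) (by omega) fun z hz1 hz2 => hblack ω _ ?_ ?_).trans
      (conn_horiz hx'' fun z hz1 hz2 => hblack ω _ ?_ ?_).symm
    all_goals simp only [strip, lin, Set.mem_ofPred_eq]; omega
  have hcases : ∀ ω, Conn (painted N b ℓ M ω) (u, ℓ) (-u - ℓ + 1, ℓ + 1) ∨
      Conn (painted N b ℓ M ω)ᶜ d (x - 1, b + 1) := by
    intro ω
    have hGb : G ⊆ painted N b ℓ M ω := fun v hv => Or.inl (hG hv)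
    have e1 : Conn (painted N b ℓ M ω) (u - 1, ℓ) e := by
      refine (Conn.of_adj (hblack ω _ ?_ ?_) (hGb h1.left_mem) ?_).trans (h1.mono hGb)
      · simp only [strip, lin, Set.mem_ofPred_eq]; omega
      · simp only [lin]; omega
      · simp [adj_iff]
    have e2 : Conn (painted N b ℓ M ω)ᶜ d (-u - ℓ + 1, ℓ) := by
      refine (h3.mono ?_).tail (c := (-u - ℓ + 1, ℓ)) ?_ (hwhite ω _ ?_ ?_)
      · rintro v ⟨hv, hv'⟩ (hw | hw | hw)
        · have := (hM hw).2.2.2; omega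
        · exact hw.2.2.1 (hG hv)
        · have := hM (hG hv)
          refine hw.1 ⟨this.1, this.2.1, ?_, ?_⟩
          · omega
          · have := this.2.2.1; rw [lin_mirror] at this; omega
      · simp [adj_iff, mirror]
      · simp only [strip, lin, Set.mem_ofPred_eq]; omega
      · simp only [lin]; omega
    have e3 : Conn (painted N b ℓ M ω)ᶜ (x - 1, b + 1) (u - 2, ℓ + 1) := by
      refine ((conn_horiz (x := u - 2 - b) (by omega) fun z hz1 hz2 => hwhite ω _ ?_ ?_).symm.trans
        (conn_vert (y := ℓ + 1) (by omega) fun z hz1 hz2 => hwhite ω _ ?_ ?_).symm).trans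
        (conn_horiz (x := u - 2 - b) (by omega) fun z hz1 hz2 => hwhite ω _ ?_ ?_)
      all_goals simp only [strip, lin, Set.mem_ofPred_eq]; omega
    rcases duality e1 e2 (hright ω x (by omega) (by omega)) e3 h2 (by simp [adj_iff])
      (by simp [adj_iff]) (by simp [adj_iff]; omega) with hd | hd
    · left
      refine (Conn.of_adj (hGb h1.left_mem) hd.left_mem ?_).trans hd
      simp [adj_iff]
    · exact Or.inr hd
  have hdep : DepOn (strip (-N) N b) E :=
    (painted_depOn N b ℓ M fun S => Conn S (u, ℓ) (-u - ℓ + 1, ℓ + 1)).mono Set.sdiff_subset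
  have hfl := hμ.real_map mirrorEquiv true (finite_strip (-N) N b) hdep
  have hsub : Eᶜ ⊆ {ω | (fun v => xor true (ω (mirrorEquiv v))) ∈ E} := by
    intro ω hω
    have hw := (hcases ω).resolve_left hω
    have hm := hw.map adj_mirror fun v hv => mirror_white hv
    have h4 : Conn (painted N b ℓ M fun v => xor true (ω (mirrorEquiv v))) (u, ℓ) (mirror d) := by
      have := h3.symm.map adj_mirror fun v hv => hv.1
      rw [mirror_mirror] at this
      exact this.mono fun v hv => Or.inl (hG hv)
    refine (h4.trans hm).trans ?_
    refine Conn.trans (b := (-u - ℓ + 1, b + 1)) ?_ (hright _ (-u - ℓ + 1) (by omega) le_rfl).symm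
    refine conn_horiz (by simp only; omega) fun z hz1 hz2 => hblack _ _ ?_ ?_
    all_goals simp only [mirror, strip, lin, Set.mem_ofPred_eq] at *; omega
  have h5 : μ.real Eᶜ = 1 - μ.real E :=
    probReal_compl_eq_one_sub (hdep.measurableSet (finite_strip _ _ _))
  have h6 := measureReal_mono (μ := μ) hsub
  rw [hfl, h5] at h6
  linarith

theorem painted_decompose {N b ℓ : ℤ} {M : Set Site} {ω : Config} (hM : M ⊆ strip (-N) N b)
    {a r : Site} (ha : a ∈ M) (hr : r ∉ strip (-N) N b) (hr1 : ℓ < r.2) (hr2 : 0 ≤ lin r)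
    (h : Conn (painted N b ℓ M ω) a r) :
    ∃ a0 b0 w, (a0 ∉ strip (-N) N b ∧ ℓ < a0.2 ∧ 0 ≤ lin a0) ∧
      (b0 ∈ M ∨ (b0 ∉ strip (-N) N b ∧ b0.2 ≤ ℓ ∧ lin b0 ≤ 0)) ∧ Adj w a0 ∧
      (w = b0 ∨ ∃ b', Adj b0 b' ∧
        Conn {v | v ∈ strip (-N) N b ∧ v ∉ M ∧ mirror v ∉ M ∧ ω v = true} b' w) := by
  set CO : Set Site := {v | v ∉ strip (-N) N b ∧ ℓ < v.2 ∧ 0 ≤ lin v} with hCO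
  set PI : Set Site := {v | v ∈ strip (-N) N b ∧ v ∉ M ∧ mirror v ∉ M ∧ ω v = true} with hPI
  obtain ⟨c, c', h1, h2, h3, h4, -⟩ := h.symm.exit (Q := CO ∪ PI) (Or.inl ⟨hr, hr1, hr2⟩)
    (by rintro (h | h)
        · exact h.1 (hM ha)
        · exact h.2.1 ha)
  have hc' : c' ∈ M ∨ (c' ∉ strip (-N) N b ∧ c'.2 ≤ ℓ ∧ lin c' ≤ 0) := by
    rcases h3 with h3 | h3 | ⟨h3, h5 | h5⟩
    · exact Or.inl h3
    · exact absurd (Or.inr h3) h4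
    · exact Or.inr ⟨h3, h5⟩
    · exact absurd (Or.inl ⟨h3, h5⟩) h4
  rcases h1.right_mem.2 with hc | hc
  · exact ⟨c, c', c', hc, hc', h2.symm, Or.inl rfl⟩
  · obtain ⟨w, a0, h5, h6, h7, h8, -⟩ := h1.symm.exit (Q := COᶜ) (fun h => h.1 hc.1)
      (fun h => h ⟨hr, hr1, hr2⟩)
    refine ⟨a0, c', w, not_not.1 h8, hc', h6, Or.inr ⟨c, h2.symm, h5.mono ?_⟩⟩
    rintro v ⟨⟨-, hv | hv⟩, hv'⟩
    · exact absurd hv hv'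
    · exact hv

theorem painted_real {N b : ℤ} (hN : 4 ≤ N) (hb : 1 ≤ b) {K : Set Site} {ω : Config}
    (hK : K ⊆ strip (-N) 0 b) (hKz : ∀ v ∈ K, ∃ z : Site, z.2 = 0 ∧ Conn K v z)
    (hopen : ∀ v ∈ nbhd (strip (-N) 0 b) {v | v.2 = 0} K \ K, ω v = true) {a a' : Site}
    (ha : lin a ≤ -N + 1) (ha' : -1 ≤ lin a')
    (hc : Conn (nbhd (strip (-N) 0 b) {v | v.2 = 0} K \ K) a a')
    (h : Conn (painted N b a.2 (nbhd (strip (-N) 0 b) {v | v.2 = 0} K) ω) a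
      (-a.1 - a.2 + 1, a.2 + 1)) :
    ω ∈ arm true (strip (-N) N b) {v | lin v ≤ -N + 1} {v | N - 1 ≤ lin v ∨ (v.2 = b ∧ -1 ≤ lin v)} := by
  set Λ := strip (-N) 0 b with hΛ
  set M := nbhd Λ {v | v.2 = 0} K with hM
  set G := M \ K with hG
  have hMΛ : M ⊆ Λ := nbhd_subset hK
  have hGΛ : G ⊆ Λ := Set.sdiff_subset.trans hMΛ
  have hΛs : Λ ⊆ strip (-N) N b := fun v hv => ⟨hv.1, hv.2.1, hv.2.2.1, by have := hv.2.2.2; omega⟩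
  obtain ⟨e, d, h1, h2, h3⟩ := reach_axis hN hGΛ ha ha' hc
  obtain ⟨u, ℓ⟩ := a
  have haG := hc.left_mem
  have haΛ := hGΛ haG
  simp only [hΛ, strip, lin, Set.mem_ofPred_eq] at haΛ ha
  dsimp only at h
  set PI : Set Site := {v | v ∈ strip (-N) N b ∧ v ∉ M ∧ mirror v ∉ M ∧ ω v = true} with hPI
  obtain ⟨a0, b0, w, ⟨hA1, hA2, hA3⟩, hB, hw, hwb⟩ := painted_decompose (hMΛ.trans hΛs) haG.1
    (by simp only [strip, lin, Set.mem_ofPred_eq]; omega) (by simp only; omega)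
    (by simp only [lin]; omega) h
  have hfin : ∀ x ∈ strip (-N) N b, Adj x a0 → N - 1 ≤ lin x ∨ (x.2 = b ∧ -1 ≤ lin x) := by
    intro x hx hxa
    rw [adj_iff] at hxa
    simp only [strip, lin, Set.mem_ofPred_eq] at *
    omega
  have hreal : ∀ x, Conn (G ∪ PI) (u, ℓ) x → Adj x a0 →
      ω ∈ arm true (strip (-N) N b) {v | lin v ≤ -N + 1} {v | N - 1 ≤ lin v ∨ (v.2 = b ∧ -1 ≤ lin v)} := by
    intro x hx hxa
    have hx' : Conn (col true ω ∩ strip (-N) N b) (u, ℓ) x := hx.mono (by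
      rintro v (hv | hv)
      · exact ⟨hopen v hv, hΛs (hGΛ hv)⟩
      · exact ⟨hv.2.2.2, hv.1⟩)
    exact ⟨_, by simp only [lin, Set.mem_ofPred_eq]; omega, x, hfin x hx'.right_mem.2 hxa, hx'⟩
  by_cases hbC : Conn G (u, ℓ) b0
  · rcases hwb with rfl | ⟨b', hb', hcb⟩
    · exact hreal _ (hbC.mono Set.subset_union_left) hw
    · exact hreal _ (((hbC.mono Set.subset_union_left).tail hb' (Or.inr hcb.left_mem)).trans
        (hcb.mono Set.subset_union_right)) hw
  by_cases hbA : b0 ∉ strip (-N) N b ∧ b0.2 = ℓ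
  · obtain ⟨hb1, hb2⟩ := hbA
    have hlin : lin b0 < -N := by
      have : lin b0 ≤ 0 := by
        rcases hB with hB | hB
        · exact absurd (hΛs (hMΛ hB)) hb1
        · exact hB.2.2
      simp only [strip, lin, Set.mem_ofPred_eq] at *; omega
    rcases hwb with rfl | ⟨b', hb', hcb⟩
    · exfalso
      rw [adj_iff] at hw
      simp only [strip, lin, Set.mem_ofPred_eq] at *; omega
    · have hadj : Adj (u, ℓ) b' := by
        have hne : b' ≠ (u, ℓ) := fun h => hcb.left_mem.2.1 (h ▸ haG.1)
        have hs := hcb.left_mem.1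
        obtain ⟨p, q⟩ := b'
        rw [adj_iff] at *
        simp only [strip, lin, Set.mem_ofPred_eq, ne_eq, Prod.mk.injEq] at *
        omega
      exact hreal _ ((Conn.of_adj (Or.inl haG) (Or.inr hcb.left_mem) hadj).trans
        (hcb.mono Set.subset_union_right)) hw
  exfalso
  set X := N + b + 5 with hX
  set S : Set Site := {v | Conn G (u, ℓ) v} ∪ {v | mirror v ∈ G ∧ 1 ≤ lin v} ∪
    {v | v.2 = ℓ ∧ (v.1 ≤ u ∨ -u - ℓ ≤ v.1)} with hS
  have hSc : Conn S (-X, ℓ) (X, ℓ) := by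
    refine (((conn_horiz (by omega) fun z hz1 hz2 => Or.inr ⟨rfl, Or.inl hz2⟩).trans
      (h1.in_cluster.mono fun v hv => Or.inl (Or.inl hv))).tail h2 (Or.inl (Or.inr h3.left_mem))).trans
      ((h3.mono fun v hv => Or.inl (Or.inr hv)).trans
      (conn_horiz (by simp only; omega) fun z hz1 hz2 => Or.inr ⟨rfl, Or.inr hz1⟩))
  set T : Set Site := {v | v ∉ S ∧ -X ≤ v.1 ∧ v.1 ≤ X} with hT
  have hstripX : ∀ v ∈ strip (-N) N b, -X + 2 ≤ v.1 ∧ v.1 ≤ X - 2 := by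
    intro v hv; simp only [strip, lin, Set.mem_ofPred_eq] at hv; omega
  have hPT : PI ⊆ T := by
    intro v hv
    have := hstripX v hv.1
    refine ⟨?_, by omega, by omega⟩
    rintro ((h | h) | h)
    · exact hv.2.1 (Conn.right_mem h).1
    · exact hv.2.2.1 h.1.1
    · have hs := hv.1
      have h5 : v ≠ (u, ℓ) := fun h => hv.2.1 (h ▸ haG.1)
      have h6 : mirror v ≠ (u, ℓ) := fun h => hv.2.2.1 (h ▸ haG.1)
      obtain ⟨p, q⟩ := v
      simp only [mirror, strip, lin, Set.mem_ofPred_eq, ne_eq, Prod.mk.injEq] at *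
      omega
  have hMT : ∀ v ∈ M, ¬ Conn G (u, ℓ) v → v ∈ T := by
    intro v hv hv'
    have hs := hMΛ hv
    have := hstripX v (hΛs hs)
    refine ⟨?_, by omega, by omega⟩
    rintro ((h | h) | h)
    · exact hv' h
    · have := h.2; have := hs.2.2.2; omega
    · have h5 : v ≠ (u, ℓ) := fun h => hv' (by rw [h]; exact Conn.refl haG)
      obtain ⟨p, q⟩ := v
      simp only [hΛ, strip, lin, Set.mem_ofPred_eq, ne_eq, Prod.mk.injEq] at *
      omega
  have hKT : K ⊆ T := fun v hv => hMT v (Or.inl hv) fun h => h.right_mem.2 hv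
  have hlow : ∀ v : Site, v.2 < 0 → -X ≤ v.1 → v.1 ≤ X → v ∈ T := by
    intro v hv h5 h6
    refine ⟨?_, h5, h6⟩
    rintro ((h | h) | h)
    · have := (hGΛ (Conn.right_mem h)).1; omega
    · have := (hGΛ h.1).1; simp only [mirror] at this; omega
    · have := h.1; omega
  have hup : Conn T (a0.1, a0.2) (a0.1, a0.2 + b + 1) := by
    have ha0 : -X ≤ a0.1 ∧ a0.1 ≤ X := by
      have hws : -X + 1 ≤ w.1 ∧ w.1 ≤ X - 1 := by
        rcases hwb with rfl | ⟨b', -, hcb⟩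
        · rcases hB with hB | hB
          · have := hstripX _ (hΛs (hMΛ hB)); omega
          · exfalso
            rw [adj_iff] at hw
            simp only [strip, lin, Set.mem_ofPred_eq] at hA1 hA3 hB; omega
        · have := hstripX _ hcb.right_mem.1; omega
      rw [adj_iff] at hw; omega
    refine conn_vert (by omega) fun z hz1 hz2 => ⟨?_, ha0⟩
    rintro ((h | h) | h)
    · have := hGΛ (Conn.right_mem h)
      simp only [hΛ, strip, lin, Set.mem_ofPred_eq] at this hA1 hA3 hz1; omega
    · have := hGΛ h.1
      simp only [hΛ, strip, lin, mirror, Set.mem_ofPred_eq] at this hA1 hA3 hz1; omega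
    · have := h.1; simp only at this; omega
  have hdown : ∃ z : Site, z.2 < 0 ∧ Conn T b0 z := by
    have hK0 : ∀ k ∈ K, ∃ z : Site, z.2 < 0 ∧ Conn T k z := by
      intro k hk
      obtain ⟨z, hz, hkz⟩ := hKz k hk
      have := hstripX z (hΛs (hK hkz.right_mem))
      refine ⟨(z.1, -1), by simp only; omega, (hkz.mono hKT).tail ?_ (hlow _ ?_ ?_ ?_)⟩
      · exact adj_iff.2 (Or.inr (Or.inr (Or.inr (Or.inl ⟨rfl, by simp only; omega⟩))))
      all_goals simp only; omega
    rcases hB with hB | hB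
    · by_cases hbK : b0 ∈ K
      · exact hK0 _ hbK
      · have hb0T := hMT _ hB hbC
        rcases hB with hB | ⟨hB, hB' | ⟨k, hk, hkb⟩⟩
        · exact absurd hB hbK
        · refine ⟨(b0.1, -1), by simp only; omega, (Conn.refl hb0T).tail ?_ (hlow _ ?_ ?_ ?_)⟩
          · simp only [Set.mem_ofPred_eq] at hB'
            exact adj_iff.2 (Or.inr (Or.inr (Or.inr (Or.inl ⟨rfl, by simp only; omega⟩))))
          · simp only; omega
          · exact hb0T.2.1
          · exact hb0T.2.2
        · obtain ⟨z, hz, hkz⟩ := hK0 k hk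
          exact ⟨z, hz, (Conn.of_adj hb0T hkz.left_mem hkb.symm).trans hkz⟩
    · have hb2 : b0.2 ≠ ℓ := fun h => hbA ⟨hB.1, h⟩
      have hb0 : -X ≤ b0.1 ∧ b0.1 ≤ X := by
        rcases hwb with rfl | ⟨b', hb', hcb⟩
        · exfalso
          rw [adj_iff] at hw; omega
        · have := hstripX _ hcb.left_mem.1
          rw [adj_iff] at hb'; omega
      refine ⟨(b0.1, b0.2 - ℓ - 1), by simp only; omega, Conn.symm (conn_vert (by omega) ?_)⟩
      intro z hz1 hz2
      refine ⟨?_, hb0⟩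
      rintro ((h | h) | h)
      · have := hGΛ (Conn.right_mem h)
        simp only [hΛ, strip, lin, Set.mem_ofPred_eq] at *; omega
      · have := hGΛ h.1
        simp only [hΛ, strip, lin, mirror, Set.mem_ofPred_eq] at *; omega
      · have := h.1; simp only at this; omega
  obtain ⟨z, hz, hbz⟩ := hdown
  have hmid : Conn T b0 a0 := by
    rcases hwb with rfl | ⟨b', hb', hcb⟩
    · exact Conn.of_adj hbz.left_mem hup.left_mem hw
    · exact ((Conn.of_adj hbz.left_mem (hPT hcb.left_mem) hb').trans (hcb.mono hPT)).tail hw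
        hup.left_mem
  obtain ⟨v, hv, hv'⟩ := hSc.cross (hbz.symm.trans (hmid.trans hup)) (fun v hv => hv.2) (by
    rintro v ((h | h) | h)
    · have := hGΛ (Conn.right_mem h); simp only [hΛ, strip, Set.mem_ofPred_eq] at this; simp only; omega
    · have := hGΛ h.1; simp only [hΛ, strip, mirror, Set.mem_ofPred_eq] at this; simp only; omega
    · have := h.1; simp only; omega)
  exact hv'.1 hv

/-- An open crossing of the window `lo ≤ lin ≤ hi` of the strip of height `b`. -/
def windowCross (lo hi b : ℤ) : Set Config :=
  arm true (strip lo hi b) {v | lin v ≤ lo + 1} {v | hi - 1 ≤ lin v}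

theorem comp_mem_arm (e : Site ≃ Site) (he : ∀ u v, Adj (e u) (e v) ↔ Adj u v) (s : Bool)
    {G G' I I' O O' : Set Site} (hG' : ∀ v, e v ∈ G' ↔ v ∈ G) (hI : ∀ v, e v ∈ I' ↔ v ∈ I)
    (hO : ∀ v, e v ∈ O' ↔ v ∈ O) (ω : Config) :
    (fun v => xor false (ω (e v))) ∈ arm s G I O ↔ ω ∈ arm s G' I' O' := by
  constructor
  · rintro ⟨a, ha, b, hb, h⟩
    refine ⟨e a, (hI _).2 ha, e b, (hO _).2 hb, h.map (fun u v h => (he u v).2 h) ?_⟩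
    rintro v ⟨h1, h2⟩
    refine ⟨?_, (hG' _).2 h2⟩
    simp only [col, Set.mem_ofPred_eq, Bool.false_xor] at h1 ⊢
    exact h1
  · rintro ⟨a, ha, b, hb, h⟩
    have he' : ∀ v, e (e.symm v) = v := e.apply_symm_apply
    refine ⟨e.symm a, (hI _).1 (by rwa [he']), e.symm b, (hO _).1 (by rwa [he']), h.map ?_ ?_⟩
    · intro u v h; rwa [← he, he', he']
    · rintro v ⟨h1, h2⟩
      refine ⟨?_, (hG' _).1 (by rwa [he'])⟩
      simp only [col, Set.mem_ofPred_eq, he', Bool.false_xor] at h1 ⊢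
      exact h1

theorem IsBernoulliHalf.real_arm_map {μ : Measure Config} (hμ : IsBernoulliHalf μ) (e : Site ≃ Site)
    (he : ∀ u v, Adj (e u) (e v) ↔ Adj u v) (s : Bool) {G G' I I' O O' : Set Site} (hG : G.Finite)
    (hG' : ∀ v, e v ∈ G' ↔ v ∈ G) (hI : ∀ v, e v ∈ I' ↔ v ∈ I) (hO : ∀ v, e v ∈ O' ↔ v ∈ O) :
    μ.real (arm s G' I' O') = μ.real (arm s G I O) := by
  rw [← hμ.real_map e false hG (arm_depOn s G I O)]
  congr 1
  ext ω
  exact (comp_mem_arm e he s hG' hI hO ω).symm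

theorem IsBernoulliHalf.real_arm_col {μ : Measure Config} (hμ : IsBernoulliHalf μ) (s t : Bool)
    {G I O : Set Site} (hG : G.Finite) : μ.real (arm s G I O) = μ.real (arm t G I O) := by
  have h := hμ.real_flip hG (arm_depOn s G I O)
  rw [flip_arm] at h
  cases s <;> cases t <;> simp_all

/-- Translation of the lattice. -/
def shift (k l : ℤ) : Site ≃ Site :=
  ⟨fun v => (v.1 + k, v.2 + l), fun v => (v.1 - k, v.2 - l), fun v => by simp, fun v => by simp⟩

theorem adj_shift (k l : ℤ) (u v : Site) : Adj (shift k l u) (shift k l v) ↔ Adj u v := by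
  simp only [adj_iff, shift, Equiv.coe_fn_mk]; omega

theorem adj_swap (u v : Site) : Adj (Equiv.prodComm ℤ ℤ u) (Equiv.prodComm ℤ ℤ v) ↔ Adj u v := by
  simp only [adj_iff, Equiv.prodComm_apply, Prod.fst_swap, Prod.snd_swap]; omega

theorem IsBernoulliHalf.windowCross_half {μ : Measure Config} (hμ : IsBernoulliHalf μ) {N b : ℤ}
    (hN : 4 ≤ N) (hb : 1 ≤ b) :
    1 / 2 * μ.real (windowCross (-N) 0 b) ≤
      μ.real (arm true (strip (-N) N b) {v | lin v ≤ -N + 1}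
        {v | N - 1 ≤ lin v ∨ (v.2 = b ∧ -1 ≤ lin v)}) := by
  have := hμ.prob
  set Λ := strip (-N) 0 b with hΛ
  set Z : Set Site := {v | v.2 = 0} with hZ
  have hA : ∀ K : Set Site, ∃ A : Set Config, (K ⊆ Λ ∧ ∀ v ∈ K, v.2 ≠ b) → ∃ a a', lin a ≤ -N + 1 ∧
      -1 ≤ lin a' ∧ Conn (nbhd Λ Z K \ K) a a' ∧
      A = {ω | Conn (painted N b a.2 (nbhd Λ Z K) ω) a (-a.1 - a.2 + 1, a.2 + 1)} := by
    intro K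
    by_cases hK : K ⊆ Λ ∧ ∀ v ∈ K, v.2 ≠ b
    · obtain ⟨a, a', h1, h2, h3⟩ := strip_lower (by omega) hb hK.1 hK.2
      exact ⟨_, fun _ => ⟨a, a', h1, h2, h3, rfl⟩⟩
    · exact ⟨∅, fun h => absurd h hK⟩
  choose A hA using hA
  have hsub : ∀ ω, kap false Λ Z ω ⊆ Λ := fun ω => kap_subset.trans Set.inter_subset_right
  have hex := hμ.explore (D := Λ) (finite_strip (-N) N b)
    (fun v hv => ⟨hv.1, hv.2.1, hv.2.2.1, by have := hv.2.2.2; omega⟩) false Z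
    (fun K => ∀ v ∈ K, v.2 ≠ b) (O := Set.univ) (fun _ _ _ _ => trivial) (fun _ _ _ _ => trivial) A
    (1 / 2) (by
      intro ω hQ
      obtain ⟨a, a', h1, h2, h3, h4⟩ := hA _ ⟨hsub ω, hQ⟩
      rw [h4]
      refine ⟨fun ω ω' h hω => Conn.mono (painted_mono _ _ _ _ h) hω, painted_depOn _ _ _ _ fun S =>
        Conn S a (-a.1 - a.2 + 1, a.2 + 1), ?_⟩
      exact hμ.painted_half hN hb (nbhd_subset (hsub ω)) Set.sdiff_subset h1 h2 h3)
  refine (mul_le_mul_of_nonneg_left (measureReal_mono fun ω hω => ?_) (by norm_num)).trans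
    (hex.trans (measureReal_mono fun ω hω => ?_))
  · exact ⟨fun v hv => kap_misses_top (by simpa [windowCross] using hω) hv, trivial⟩
  · obtain ⟨hQ, -, hω⟩ := hω
    obtain ⟨a, a', h1, h2, h3, h4⟩ := hA _ ⟨hsub ω, hQ⟩
    rw [h4] at hω
    refine painted_real hN hb (hsub ω) ?_ (fun v hv => ?_) h1 h2 h3 hω
    · rintro v ⟨z, hz, hzv⟩
      exact ⟨z, hz, Conn.symm (hzv.in_cluster.mono fun x hx => ⟨z, hz, hx⟩)⟩
    · exact kap_nbhd hv.1 hv.2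

theorem windowCross_of_mirror {N b : ℤ} (hN : 4 ≤ N) (hb : 1 ≤ b) {W : Set Site}
    (hW : W ⊆ strip (-N) N b) {a a₂ v w : Site} (ha : lin a ≤ -N + 1) (ha₂ : N - 1 ≤ lin a₂)
    (h1 : Conn W a v) (h2 : Conn W a₂ w) (hv : v.2 = b) (hv' : -1 ≤ lin v) (hw : w.2 = b)
    (hw' : lin w ≤ 1) : Conn W a a₂ := by
  by_cases hvw : v.1 ≤ w.1
  · have hvw' : v = w ∨ Adj v w := by
      rw [adj_iff]
      simp only [lin] at hv' hw'
      rw [Prod.ext_iff]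
      omega
    rcases hvw' with rfl | hvw'
    · exact h1.trans h2.symm
    · exact (h1.tail hvw' h2.right_mem).trans h2.symm
  push Not at hvw
  set X := N + b + 5 with hX
  have hWX : ∀ x ∈ W, -X ≤ x.1 ∧ x.1 ≤ X ∧ 0 ≤ x.2 ∧ x.2 ≤ b := by
    intro x hx; have := hW hx; simp only [strip, lin, Set.mem_ofPred_eq] at this; omega
  have haW := hW h1.left_mem
  have haW₂ := hW h2.left_mem
  have haX := hWX _ h1.left_mem
  have haX₂ := hWX _ h2.left_mem
  have hvX := hWX _ h1.right_mem
  have hwX := hWX _ h2.right_mem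
  obtain ⟨a1, a2⟩ := a
  obtain ⟨c1, c2⟩ := a₂
  obtain ⟨v1, v2⟩ := v
  obtain ⟨w1, w2⟩ := w
  simp only [strip, lin, Set.mem_ofPred_eq] at *
  subst hv hw
  have hS : Conn ({x | Conn W (a1, a2) x} ∪ {x | x.2 = a2 ∧ x.1 < a1} ∪
      {x | x.2 = w2 + 1 ∧ v1 ≤ x.1}) (-X, a2) (X, w2 + 1) := by
    refine Conn.trans (b := (a1, a2)) (conn_horiz haX.1 fun z hz1 hz2 => ?_)
      ((h1.in_cluster.mono fun x hx => Or.inl (Or.inl hx)).trans (Conn.trans (b := (v1, w2 + 1))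
      (conn_vert (by omega) fun z hz1 hz2 => ?_) (conn_horiz hvX.2.1 fun z hz1 hz2 => ?_)))
    · rcases hz2.lt_or_eq with h | h
      · exact Or.inl (Or.inr ⟨rfl, h⟩)
      · subst h; exact Or.inl (Or.inl (Conn.refl h1.left_mem))
    · rcases hz1.lt_or_eq with h | h
      · exact Or.inr ⟨by simp only; omega, le_rfl⟩
      · subst h; exact Or.inl (Or.inl h1)
    · exact Or.inr ⟨rfl, hz1⟩
  have hT : Conn ({x | Conn W (c1, c2) x} ∪ {x | x.1 = w1 ∧ w2 < x.2} ∪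
      {x | c1 < x.1 ∧ c2 = x.2 ∧ x.1 ≤ X} ∪ {x | x.1 = X ∧ x.2 ≤ c2})
      (X, -1) (w1, w2 + 1) := by
    refine Conn.trans (b := (X, c2)) (conn_vert (by omega) fun z hz1 hz2 => Or.inr ⟨rfl, hz2⟩)
      (Conn.trans (b := (c1, c2)) (Conn.symm (conn_horiz haX₂.2.1 fun z hz1 hz2 => ?_))
      (((h2.in_cluster.mono fun x hx => Or.inl (Or.inl (Or.inl hx)))).trans
      (conn_vert (by omega) fun z hz1 hz2 => ?_)))
    · rcases hz1.lt_or_eq with h | h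
      · exact Or.inl (Or.inr ⟨h, rfl, hz2⟩)
      · subst h; exact Or.inl (Or.inl (Or.inl (Conn.refl h2.left_mem)))
    · rcases hz1.lt_or_eq with h | h
      · exact Or.inl (Or.inl (Or.inr ⟨rfl, h⟩))
      · subst h; exact Or.inl (Or.inl (Or.inl h2))
  obtain ⟨x, hx, hx'⟩ := hS.cross hT (by
    rintro x (((h | h) | h) | h)
    · have := hWX x (Conn.right_mem h); omega
    · have := h.1; omega
    · have := h.1; have := h.2.2; simp only; omega
    · have := h.1; simp only; omega) (by
    rintro x ((h | h) | h)
    · have := hWX x (Conn.right_mem h); simp only; omega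
    · have := h.1; simp only; omega
    · have := h.1; simp only; omega)
  have hWs : ∀ x ∈ W, 0 ≤ x.2 ∧ x.2 ≤ w2 ∧ -N ≤ 2 * x.1 + x.2 ∧ 2 * x.1 + x.2 ≤ N := hW
  rcases hx with (hx | hx) | hx
  · have := hWs x (Conn.right_mem hx)
    rcases hx' with ((hx' | hx') | hx') | hx'
    · exact Conn.trans hx hx'.symm
    all_goals simp only [Set.mem_ofPred_eq] at hx'; omega
  all_goals
    simp only [Set.mem_ofPred_eq] at hx
    rcases hx' with ((hx' | hx') | hx') | hx'
    · have := hWs x (Conn.right_mem hx'); omega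
    all_goals simp only [Set.mem_ofPred_eq] at hx'; omega

theorem adj_mirrorEquiv (u v : Site) : Adj (mirrorEquiv u) (mirrorEquiv v) ↔ Adj u v := by
  refine ⟨fun h => ?_, adj_mirror u v⟩
  have := adj_mirror _ _ h
  rwa [show mirrorEquiv u = mirror u from rfl, show mirrorEquiv v = mirror v from rfl, mirror_mirror,
    mirror_mirror] at this

theorem IsBernoulliHalf.windowCross_sq {μ : Measure Config} (hμ : IsBernoulliHalf μ) {N b : ℤ}
    (hN : 4 ≤ N) (hb : 1 ≤ b) :
    (1 / 2 * μ.real (windowCross (-N) 0 b)) ^ 2 ≤ μ.real (windowCross (-N) N b) := by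
  have := hμ.prob
  have h1 := hμ.windowCross_half hN hb
  set E₁ := arm true (strip (-N) N b) {v | lin v ≤ -N + 1}
        {v | N - 1 ≤ lin v ∨ (v.2 = b ∧ -1 ≤ lin v)} with hE₁
  set E₂ := arm true (strip (-N) N b) {v | N - 1 ≤ lin v}
        {v | lin v ≤ -N + 1 ∨ (v.2 = b ∧ lin v ≤ 1)} with hE₂
  have h2 : μ.real E₂ = μ.real E₁ := by
    refine hμ.real_arm_map mirrorEquiv adj_mirrorEquiv true (finite_strip _ _ _) ?_ ?_ ?_
    · exact fun v => mirror_mem_strip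
    · intro v
      rw [Set.mem_ofPred_eq, Set.mem_ofPred_eq, show mirrorEquiv v = mirror v from rfl, lin_mirror]
      omega
    · intro v
      rw [Set.mem_ofPred_eq, Set.mem_ofPred_eq, show mirrorEquiv v = mirror v from rfl, lin_mirror]
      simp only [mirror]
      omega
  have h3 := hμ.harrisC true (finite_strip (-N) N b) (arm_depOn true _ _ _) (arm_depOn true _ _ _)
    (arm_incrC true (strip (-N) N b) {v | lin v ≤ -N + 1}
        {v | N - 1 ≤ lin v ∨ (v.2 = b ∧ -1 ≤ lin v)})
    (arm_incrC true (strip (-N) N b) {v | N - 1 ≤ lin v} {v | lin v ≤ -N + 1 ∨ (v.2 = b ∧ lin v ≤ 1)})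
  rw [← hE₁, ← hE₂, h2] at h3
  have h4 : E₁ ∩ E₂ ⊆ windowCross (-N) N b := by
    rintro ω ⟨⟨a, ha, v, hv, hav⟩, a₂, ha₂, w, hw, haw⟩
    simp only [Set.mem_ofPred_eq] at ha hv ha₂ hw
    rcases hv with hv | ⟨hv, hv'⟩
    · exact ⟨a, ha, v, hv, hav⟩
    rcases hw with hw | ⟨hw, hw'⟩
    · exact ⟨w, hw, a₂, ha₂, haw.symm⟩
    exact ⟨a, ha, a₂, ha₂, windowCross_of_mirror hN hb Set.inter_subset_right ha ha₂ hav haw hv hv'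
      hw hw'⟩
  calc (1 / 2 * μ.real (windowCross (-N) 0 b)) ^ 2 ≤ μ.real E₁ ^ 2 := by gcongr
    _ = μ.real E₁ * μ.real E₁ := sq _
    _ ≤ μ.real (windowCross (-N) N b) := h3.trans (measureReal_mono h4)

theorem IsBernoulliHalf.windowCross_shift {μ : Measure Config} (hμ : IsBernoulliHalf μ)
    (k lo hi b : ℤ) : μ.real (windowCross (lo + 2 * k) (hi + 2 * k) b) = μ.real (windowCross lo hi b) := by
  refine hμ.real_arm_map (shift k 0) (adj_shift k 0) true (finite_strip _ _ _) ?_ ?_ ?_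
  all_goals
    intro v
    simp only [shift, strip, lin, Equiv.coe_fn_mk, Set.mem_ofPred_eq]
    omega

theorem rect_dual {x₀ x₁ y₀ y₁ : ℤ} (hx : x₀ ≤ x₁) (hy : y₀ ≤ y₁) (ω : Config) :
    ω ∈ arm true (rect x₀ x₁ y₀ y₁) {v | v.1 = x₀} {v | v.1 = x₁} ∨
      ω ∈ arm false (rect x₀ x₁ y₀ y₁) {v | v.2 = y₀} {v | v.2 = y₁} := by
  set R := rect x₀ x₁ y₀ y₁ with hR
  set L : Set Site := {v | y₀ ≤ v.2 ∧ v.2 ≤ y₁ ∧ v.1 < x₀} with hL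
  set L' : Set Site := {v | y₀ ≤ v.2 ∧ v.2 ≤ y₁ ∧ x₁ < v.1} with hL'
  set B : Set Site := (col true ω ∩ R) ∪ L ∪ L' with hB
  have hBs : ∀ v ∈ B, y₀ ≤ v.2 ∧ v.2 ≤ y₁ := by
    rintro v ((h | h) | h)
    · exact ⟨h.2.2.2.1, h.2.2.2.2⟩
    · exact ⟨h.1, h.2.1⟩
    · exact ⟨h.1, h.2.1⟩
  have hw : ∀ y, y < y₀ ∨ y₁ < y → Conn Bᶜ (x₀ - 1, y) (x₁ + 1, y) := by
    intro y hy
    refine conn_horiz (by omega) fun z h1 h2 h => ?_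
    have := hBs _ h
    dsimp only at this
    omega
  rcases duality (B := B) (l := (x₀ - 1, y₁)) (l' := (x₀ - 1, y₀)) (b := (x₀ - 1, y₀ - 1))
    (b' := (x₁ + 1, y₀ - 1)) (r := (x₁ + 1, y₀)) (r' := (x₁ + 1, y₁)) (t := (x₁ + 1, y₁ + 1))
    (t' := (x₀ - 1, y₁ + 1))
    (conn_vert hy fun z h1 h2 => Or.inl (Or.inr ⟨h1, h2, by simp only; omega⟩)).symm
    (hw _ (by omega))
    (conn_vert hy fun z h1 h2 => Or.inr ⟨h1, h2, by simp only; omega⟩)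
    (hw _ (by omega)).symm
    (by simp [adj_iff]) (by simp [adj_iff]) (by simp [adj_iff]) (by simp [adj_iff]) with hd | hd
  · left
    obtain ⟨a0, a', b', b0, ha0, -, hb0, -, h1, h2, h3⟩ := hd.between (A := L) (B := L')
      ⟨by simp only; omega, by simp only; omega, by simp only; omega⟩
      ⟨by simp only; omega, by simp only; omega, by simp only; omega⟩
      (fun x _ hx hx' => by have := hx.2.2; have := hx'.2.2; omega)
      (fun x _ y _ hx hy hxy => by
        have := hx.2.2; have := hy.2.2; rw [adj_iff] at hxy; omega)
    have h4 : Conn (col true ω ∩ R) a' b' := h3.mono (by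
      rintro v ⟨(h | h) | h, h'⟩
      · exact h
      · exact absurd (Or.inl h) h'
      · exact absurd (Or.inr h) h')
    have h5 := h4.left_mem.2.1
    have h6 := h4.right_mem.2.2.1
    refine ⟨a', ?_, b', ?_, h4⟩
    · have := ha0.2.2; rw [adj_iff] at h1; simp only [Set.mem_ofPred_eq]; omega
    · have := hb0.2.2; rw [adj_iff] at h2; simp only [Set.mem_ofPred_eq]; omega
  · right
    obtain ⟨a0, a', b', b0, ha0, -, hb0, -, h1, h2, h3⟩ := hd.between (A := {v | v.2 < y₀})
      (B := {v | y₁ < v.2}) (by simp) (by simp)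
      (fun x _ hx hx' => by simp only [Set.mem_ofPred_eq] at *; omega)
      (fun x _ y _ hx hy hxy => by
        rw [adj_iff] at hxy; simp only [Set.mem_ofPred_eq] at *; omega)
    have h4 : Conn (col false ω ∩ R) a' b' := h3.mono (by
      rintro v ⟨hv, hv'⟩
      simp only [Set.mem_union, Set.mem_ofPred_eq, not_or, not_lt] at hv'
      have hvR : v ∈ R := by
        refine ⟨?_, ?_, hv'.1, hv'.2⟩
        · by_contra h; exact hv (Or.inl (Or.inr ⟨hv'.1, hv'.2, by omega⟩))
        · by_contra h; exact hv (Or.inr ⟨hv'.1, hv'.2, by omega⟩)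
      refine ⟨?_, hvR⟩
      have : ω v ≠ true := fun h => hv (Or.inl (Or.inl ⟨h, hvR⟩))
      simpa [col] using this)
    have h5 := h4.left_mem.2.2.2.1
    have h6 := h4.right_mem.2.2.2.2
    refine ⟨a', ?_, b', ?_, h4⟩
    · simp only [Set.mem_ofPred_eq] at ha0 ⊢; rw [adj_iff] at h1; omega
    · simp only [Set.mem_ofPred_eq] at hb0 ⊢; rw [adj_iff] at h2; omega

theorem IsBernoulliHalf.rhombus_half {μ : Measure Config} (hμ : IsBernoulliHalf μ) {b : ℤ}
    (hb : 0 ≤ b) : 1 / 2 ≤ μ.real (arm true (rect 0 b 0 b) {v | v.1 = 0} {v | v.1 = b}) := by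
  have := hμ.prob
  have h1 : μ.real (arm false (rect 0 b 0 b) {v | v.2 = 0} {v | v.2 = b}) =
      μ.real (arm false (rect 0 b 0 b) {v | v.1 = 0} {v | v.1 = b}) := by
    refine hμ.real_arm_map (Equiv.prodComm ℤ ℤ) adj_swap false (finite_rect _ _ _ _) ?_ ?_ ?_
    · intro v
      simp only [rect, Equiv.prodComm_apply, Prod.fst_swap, Prod.snd_swap, Set.mem_ofPred_eq]
      omega
    · intro v; simp
    · intro v; simp
  rw [hμ.real_arm_col false true (I := {v | v.1 = 0}) (finite_rect _ _ _ _)] at h1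
  have h2 : (1 : ℝ) ≤ μ.real (arm true (rect 0 b 0 b) {v | v.1 = 0} {v | v.1 = b}) +
      μ.real (arm false (rect 0 b 0 b) {v | v.2 = 0} {v | v.2 = b}) := by
    refine le_trans ?_ (measureReal_union_le _ _)
    rw [show arm true (rect 0 b 0 b) {v | v.1 = 0} {v | v.1 = b} ∪
      arm false (rect 0 b 0 b) {v | v.2 = 0} {v | v.2 = b} = Set.univ from
      Set.eq_univ_of_forall fun ω => rect_dual hb hb ω]
    simp
  linarith

/-- The lower bounds obtained by repeatedly doubling the length of a crossing. -/
noncomputable def doubling : ℕ → ℝ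
  | 0 => 1 / 2
  | k + 1 => (1 / 2 * doubling k) ^ 2

theorem doubling_pos : ∀ k, 0 < doubling k
  | 0 => by norm_num [doubling]
  | k + 1 => by have := doubling_pos k; rw [doubling]; positivity

theorem IsBernoulliHalf.exists_windowCross {μ : Measure Config} (hμ : IsBernoulliHalf μ) {b : ℤ}
    (hb : 3 ≤ b) (k : ℕ) : ∃ lo hi : ℤ, 2 ∣ lo ∧ 2 ∣ hi ∧ 4 ≤ hi - lo ∧ 2 ^ k * b ≤ hi - lo ∧
      doubling k ≤ μ.real (windowCross lo hi b) := by
  have := hμ.prob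
  induction k with
  | zero =>
    refine ⟨2 * (b / 2), 2 * b, by omega, by omega, by omega, by rw [pow_zero]; omega,
      (hμ.rhombus_half (by omega : 0 ≤ b)).trans (measureReal_mono ?_)⟩
    rintro ω ⟨a, ha, a', ha', h⟩
    have h1 := h.left_mem.2.2.2
    have h2 := h.right_mem.2.2.2
    simp only [Set.mem_ofPred_eq] at ha ha'
    obtain ⟨c, c', hc, hc', hcc⟩ := h.window lin 2
      (fun u v h => by rw [adj_iff] at h; simp only [lin]; omega) (lo := 2 * (b / 2)) (hi := 2 * b)
      (by omega) (by simp only [lin]; omega) (by simp only [lin]; omega)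
    refine ⟨c, by simp only [Set.mem_ofPred_eq]; omega, c', by simp only [Set.mem_ofPred_eq]; omega,
      hcc.mono ?_⟩
    rintro v ⟨⟨h1, -, -, h2, h3⟩, h4, h5⟩
    exact ⟨h1, h2, h3, h4, h5⟩
  | succ k ih =>
    obtain ⟨lo, hi, ⟨i, rfl⟩, ⟨j, rfl⟩, h1, h2, h3⟩ := ih
    refine ⟨-(2 * j - 2 * i), 2 * j - 2 * i, by omega, by omega, by omega, by rw [pow_succ]; linarith,
      le_trans ?_ (hμ.windowCross_sq (by omega) (by omega))⟩
    have h4 := hμ.windowCross_shift (-j) (2 * i) (2 * j) b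
    rw [show 2 * i + 2 * -j = -(2 * j - 2 * i) by ring, show 2 * j + 2 * -j = 0 by ring] at h4
    rw [doubling, h4]
    have := doubling_pos k
    gcongr

/-- The Russo–Seymour–Welsh bound for horizontal crossings. -/
theorem IsBernoulliHalf.rsw_horiz {μ : Measure Config} (hμ : IsBernoulliHalf μ) (k : ℕ) (s : Bool)
    (x₀ y₀ : ℤ) {w b : ℤ} (hb : 3 ≤ b) (hw : 1 ≤ w) (hwb : 2 * w + b + 1 ≤ 2 ^ k * b) :
    doubling k ≤ μ.real (arm s (rect x₀ (x₀ + w) y₀ (y₀ + b)) {v | v.1 = x₀} {v | v.1 = x₀ + w}) := by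
  have := hμ.prob
  obtain ⟨lo, hi, ⟨i, rfl⟩, -, h1, h2, h3⟩ := hμ.exists_windowCross hb k
  have h4 := hμ.windowCross_shift (-i) (2 * i) hi b
  rw [← h4] at h3
  have h5 : μ.real (arm s (rect x₀ (x₀ + w) y₀ (y₀ + b)) {v | v.1 = x₀} {v | v.1 = x₀ + w}) =
      μ.real (arm true (rect 0 w 0 b) {v | v.1 = 0} {v | v.1 = w}) := by
    rw [hμ.real_arm_col s true (finite_rect _ _ _ _)]
    refine hμ.real_arm_map (shift x₀ y₀) (adj_shift x₀ y₀) true (finite_rect _ _ _ _) ?_ ?_ ?_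
    all_goals
      intro v
      simp only [shift, rect, Equiv.coe_fn_mk, Set.mem_ofPred_eq]
      omega
  rw [h5]
  refine h3.trans (measureReal_mono ?_)
  rintro ω ⟨a, ha, a', ha', h⟩
  have h6 := h.left_mem.2
  have h7 := h.right_mem.2
  simp only [strip, lin, Set.mem_ofPred_eq] at ha ha' h6 h7
  obtain ⟨c, c', hc, hc', hcc⟩ := h.window Prod.fst 1
      (fun u v h => by rw [adj_iff] at h; omega) (lo := 0) (hi := w)
      (by omega) (by omega) (by omega)
  have h8 := hcc.left_mem.2
  have h9 := hcc.right_mem.2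
  simp only [Set.mem_ofPred_eq] at h8 h9
  refine ⟨c, by simp only [Set.mem_ofPred_eq]; omega, c', by simp only [Set.mem_ofPred_eq]; omega,
    hcc.mono ?_⟩
  rintro v ⟨⟨h1, h2, h3, -, -⟩, h4, h5⟩
  exact ⟨h1, h4, h5, h2, h3⟩

/-- The Russo–Seymour–Welsh bound for vertical crossings. -/
theorem IsBernoulliHalf.rsw_vert {μ : Measure Config} (hμ : IsBernoulliHalf μ) (k : ℕ) (s : Bool)
    (x₀ y₀ : ℤ) {w b : ℤ} (hb : 3 ≤ b) (hw : 1 ≤ w) (hwb : 2 * w + b + 1 ≤ 2 ^ k * b) :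
    doubling k ≤ μ.real (arm s (rect x₀ (x₀ + b) y₀ (y₀ + w)) {v | v.2 = y₀} {v | v.2 = y₀ + w}) := by
  refine (hμ.rsw_horiz k s y₀ x₀ hb hw hwb).trans_eq (Eq.symm ?_)
  refine hμ.real_arm_map (Equiv.prodComm ℤ ℤ) adj_swap s (finite_rect _ _ _ _) ?_ ?_ ?_
  · intro v
    simp only [rect, Equiv.prodComm_apply, Prod.fst_swap, Prod.snd_swap, Set.mem_ofPred_eq]
    omega
  · intro v; simp
  · intro v; simp

/-! ### Half-annuli around a point of the boundary column -/

/-- The half ball of radius `r` around `(0, s)`. -/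
def halfBall (s r : ℤ) : Set Site := rect 0 r (s - r) (s + r)

/-- The half annulus of radii `r` and `4 * r` around `(0, s)`. -/
def halfAnn (s r : ℤ) : Set Site := halfBall s (4 * r) \ halfBall s r

/-- Sites at distance at least `R` from `(0, s)`. -/
def far (s R : ℤ) : Set Site := {v | R ≤ v.1 ∨ s + R ≤ v.2 ∨ v.2 ≤ s - R}

/-- A half circuit of colour `c` in the half annulus. -/
def circ (c : Bool) (s r : ℤ) : Set Config :=
  arm c (halfAnn s r) {v | v.1 = 0 ∧ s + r < v.2} {v | v.1 = 0 ∧ v.2 < s - r}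

theorem finite_halfBall (s r : ℤ) : (halfBall s r).Finite := finite_rect _ _ _ _

theorem finite_halfAnn (s r : ℤ) : (halfAnn s r).Finite := (finite_halfBall _ _).sdiff

theorem mem_halfBall {s r : ℤ} {v : Site} :
    v ∈ halfBall s r ↔ 0 ≤ v.1 ∧ v.1 ≤ r ∧ s - r ≤ v.2 ∧ v.2 ≤ s + r := Iff.rfl

theorem halfCircuit_of_crossings {s r : ℤ} {W : Set Site}
    (h1 : Linked (W ∩ rect 0 (4 * r) (s + r + 1) (s + 4 * r)) {v | v.1 = 0} {v | v.1 = 4 * r})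
    (h2 : Linked (W ∩ rect (r + 1) (4 * r) (s - 4 * r) (s + 4 * r)) {v | v.2 = s - 4 * r}
      {v | v.2 = s + 4 * r})
    (h3 : Linked (W ∩ rect 0 (4 * r) (s - 4 * r) (s - r - 1)) {v | v.1 = 0} {v | v.1 = 4 * r}) :
    Linked (W ∩ halfAnn s r) {v | v.1 = 0 ∧ s + r < v.2} {v | v.1 = 0 ∧ v.2 < s - r} := by
  obtain ⟨a, ha, a', ha', haa⟩ := h1
  obtain ⟨b, hb, b', hb', hbb⟩ := h2
  obtain ⟨c, hc, c', hc', hcc⟩ := h3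
  simp only [Set.mem_ofPred_eq] at ha ha' hb hb' hc hc'
  have ha2 := haa.left_mem.2
  have hc2 := hcc.left_mem.2
  simp only [rect, Set.mem_ofPred_eq] at ha2 hc2
  obtain ⟨v, hv, hv'⟩ := haa.in_cluster.cross hbb.in_cluster
    (fun v hv => by have := (Conn.right_mem hv).2.1; have := (Conn.right_mem hv).2.2.1; omega)
    (fun v hv => by have := (Conn.right_mem hv).2.2.2.1; have := (Conn.right_mem hv).2.2.2.2; omega)
  obtain ⟨w, hw, hw'⟩ := hcc.in_cluster.cross hbb.in_cluster
    (fun v hv => by have := (Conn.right_mem hv).2.1; have := (Conn.right_mem hv).2.2.1; omega)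
    (fun v hv => by have := (Conn.right_mem hv).2.2.2.1; have := (Conn.right_mem hv).2.2.2.2; omega)
  have m1 : W ∩ rect 0 (4 * r) (s + r + 1) (s + 4 * r) ⊆ W ∩ halfAnn s r := by
    rintro x ⟨hx, h⟩
    simp only [rect, Set.mem_ofPred_eq] at h
    exact ⟨hx, mem_halfBall.2 (by omega), fun h' => by have := mem_halfBall.1 h'; omega⟩
  have m2 : W ∩ rect (r + 1) (4 * r) (s - 4 * r) (s + 4 * r) ⊆ W ∩ halfAnn s r := by
    rintro x ⟨hx, h⟩
    simp only [rect, Set.mem_ofPred_eq] at h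
    exact ⟨hx, mem_halfBall.2 (by omega), fun h' => by have := mem_halfBall.1 h'; omega⟩
  have m3 : W ∩ rect 0 (4 * r) (s - 4 * r) (s - r - 1) ⊆ W ∩ halfAnn s r := by
    rintro x ⟨hx, h⟩
    simp only [rect, Set.mem_ofPred_eq] at h
    exact ⟨hx, mem_halfBall.2 (by omega), fun h' => by have := mem_halfBall.1 h'; omega⟩
  refine ⟨a, ⟨ha, by omega⟩, c, ⟨hc, by omega⟩, (Conn.mono m1 hv).trans ?_⟩
  exact ((Conn.mono m2 hv').symm.trans (Conn.mono m2 hw')).trans (Conn.mono m3 hw).symm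

/-- The lower bound for the probability of a half circuit. -/
noncomputable def circBd : ℝ := doubling 3 * doubling 3 * doubling 3

theorem circBd_pos : 0 < circBd := by
  have := doubling_pos 3
  unfold circBd
  positivity

theorem IsBernoulliHalf.circ_ge {μ : Measure Config} (hμ : IsBernoulliHalf μ) (c : Bool) (s : ℤ)
    {r : ℤ} (hr : 2 ≤ r) : circBd ≤ μ.real (circ c s r) := by
  have := hμ.prob
  have h1 := hμ.rsw_horiz 3 c 0 (s + r + 1) (w := 4 * r) (b := 3 * r - 1) (by omega) (by omega)
    (by omega)
  have h2 := hμ.rsw_vert 3 c (r + 1) (s - 4 * r) (w := 8 * r) (b := 3 * r - 1) (by omega) (by omega)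
    (by omega)
  have h3 := hμ.rsw_horiz 3 c 0 (s - 4 * r) (w := 4 * r) (b := 3 * r - 1) (by omega) (by omega)
    (by omega)
  rw [show s + r + 1 + (3 * r - 1) = s + 4 * r by ring, zero_add] at h1
  rw [show r + 1 + (3 * r - 1) = 4 * r by ring, show s - 4 * r + 8 * r = s + 4 * r by ring] at h2
  rw [show s - 4 * r + (3 * r - 1) = s - r - 1 by ring, zero_add] at h3
  set E₁ := arm c (rect 0 (4 * r) (s + r + 1) (s + 4 * r)) {v | v.1 = 0} {v | v.1 = 4 * r}
  set E₂ := arm c (rect (r + 1) (4 * r) (s - 4 * r) (s + 4 * r)) {v | v.2 = s - 4 * r}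
      {v | v.2 = s + 4 * r}
  set E₃ := arm c (rect 0 (4 * r) (s - 4 * r) (s - r - 1)) {v | v.1 = 0} {v | v.1 = 4 * r}
  have hd : ∀ x₀ x₁ y₀ y₁ I O, 0 ≤ x₀ → x₁ ≤ 4 * r → s - 4 * r ≤ y₀ → y₁ ≤ s + 4 * r →
      DepOn (halfBall s (4 * r)) (arm c (rect x₀ x₁ y₀ y₁) I O) := by
    intro x₀ x₁ y₀ y₁ I O g1 g2 g3 g4
    refine (arm_depOn _ _ _ _).mono fun v hv => mem_halfBall.2 ?_
    simp only [rect, Set.mem_ofPred_eq] at hv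
    omega
  have d1 : DepOn (halfBall s (4 * r)) E₁ := hd _ _ _ _ _ _ le_rfl le_rfl (by omega) le_rfl
  have d2 : DepOn (halfBall s (4 * r)) E₂ := hd _ _ _ _ _ _ (by omega) le_rfl le_rfl le_rfl
  have d3 : DepOn (halfBall s (4 * r)) E₃ := hd _ _ _ _ _ _ le_rfl le_rfl le_rfl (by omega)
  have i12 := hμ.harrisC c (finite_halfBall _ _) d1 d2 (arm_incrC _ _ _ _) (arm_incrC _ _ _ _)
  have i123 := hμ.harrisC c (finite_halfBall _ _) (d1.inter d2) d3
    ((arm_incrC _ _ _ _).inter (arm_incrC _ _ _ _)) (arm_incrC _ _ _ _)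
  have hp := doubling_pos 3
  calc circBd ≤ μ.real E₁ * μ.real E₂ * μ.real E₃ := by unfold circBd; gcongr
    _ ≤ μ.real (E₁ ∩ E₂) * μ.real E₃ := by gcongr
    _ ≤ μ.real (E₁ ∩ E₂ ∩ E₃) := i123
    _ ≤ μ.real (circ c s r) := measureReal_mono ?_
  rintro ω ⟨⟨e1, e2⟩, e3⟩
  have key := halfCircuit_of_crossings (W := col c ω ∩ {v | 0 ≤ v.1}) (s := s) (r := r)
    (e1.mono (fun v hv => ⟨⟨hv.1, hv.2.1⟩, hv.2⟩) le_rfl le_rfl)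
    (e2.mono (fun v hv => ⟨⟨hv.1, by have := hv.2.1; simp only [Set.mem_ofPred_eq]; omega⟩, hv.2⟩) le_rfl le_rfl)
    (e3.mono (fun v hv => ⟨⟨hv.1, hv.2.1⟩, hv.2⟩) le_rfl le_rfl)
  exact key.mono (fun v hv => ⟨hv.1.1, hv.2⟩) le_rfl le_rfl

theorem circ_meets {s r : ℤ} (hr : 0 ≤ r) {C T : Set Site} (hC : C ⊆ halfAnn s r)
    (hCc : Linked C {v | v.1 = 0 ∧ s + r < v.2} {v | v.1 = 0 ∧ v.2 < s - r})
    (hT : T ⊆ {v | 0 ≤ v.1}) (hTc : Linked T (halfBall s r) (far s (4 * r))) : ∃ v ∈ C, v ∈ T := by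
  obtain ⟨⟨a1, a2⟩, ⟨ha1, ha2⟩, ⟨b1, b2⟩, ⟨hb1, hb2⟩, hab⟩ := hCc
  obtain ⟨c, hc, d, hd, hcd⟩ := hTc
  simp only at ha1 ha2 hb1 hb2
  subst ha1 hb1
  have hd0 := hT hcd.right_mem
  have hz : ∃ z, Adj d z ∧ z ∉ halfBall s (4 * r) ∧ 0 ≤ z.1 := by
    simp only [Set.mem_ofPred_eq] at hd0
    rcases hd with hd | hd | hd
    · exact ⟨(d.1 + 1, d.2), by simp [adj_iff], fun h => by have := mem_halfBall.1 h; simp only at this; omega,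
        by simp only; omega⟩
    · exact ⟨(d.1, d.2 + 1), by simp [adj_iff], fun h => by have := mem_halfBall.1 h; simp only at this; omega,
        by simp only; omega⟩
    · exact ⟨(d.1, d.2 - 1), by simp [adj_iff], fun h => by have := mem_halfBall.1 h; simp only at this; omega,
        by simp only; omega⟩
  obtain ⟨z, hdz, hz, hz0⟩ := hz
  have hc' : Conn (T ∪ halfBall s r ∪ {z}) (0, s) z := by
    refine Conn.trans (b := c) ?_ ((hcd.mono fun v hv => Or.inl (Or.inl hv)).tail hdz (Or.inr rfl))
    refine Conn.mono (S := halfBall s r) (fun v hv => Or.inl (Or.inr hv)) (conn_rect ?_ hc)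
    exact ⟨le_rfl, hr, by simp only; omega, by simp only; omega⟩
  obtain ⟨v, hv, hv'⟩ := hab.symm.leftSep (hC.trans Set.sdiff_subset) hc' (by
    rintro v ((h | h) | h)
    · exact hT h
    · exact h.1
    · rw [Set.mem_singleton_iff.1 h]; exact hz0) hz (by omega) (by omega)
  rcases hv' with (h | h) | h
  · exact ⟨v, hv, h⟩
  · exact absurd h (hC hv).2
  · exact absurd (hC hv).1 (by rw [Set.mem_singleton_iff.1 h]; exact hz)

theorem arm_disjoint_circ {c : Bool} {s r : ℤ} (hr : 0 ≤ r) {G : Set Site} (hG : G ⊆ {v | 0 ≤ v.1})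
    {ω : Config} (h : ω ∈ arm c G (halfBall s r) (far s (4 * r))) : ω ∉ circ (!c) s r := by
  intro h'
  obtain ⟨v, h1, h2⟩ := circ_meets hr Set.inter_subset_right h' (Set.inter_subset_right.trans hG) h
  have h3 := h1.1
  have h4 := h2.1
  simp only [col, Set.mem_ofPred_eq] at h3 h4
  simp [h4] at h3

theorem IsBernoulliHalf.arm_le {μ : Measure Config} (hμ : IsBernoulliHalf μ) (c : Bool) (s : ℤ)
    {r : ℤ} (hr : 2 ≤ r) {G : Set Site} (hG : G ⊆ {v | 0 ≤ v.1}) :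
    μ.real (arm c G (halfBall s r) (far s (4 * r))) ≤ 1 - circBd := by
  have := hμ.prob
  have h1 := hμ.circ_ge (!c) s hr
  have h2 : μ.real (circ (!c) s r)ᶜ = 1 - μ.real (circ (!c) s r) :=
    probReal_compl_eq_one_sub ((arm_depOn _ _ _ _).measurableSet (finite_halfAnn _ _))
  have hsub : arm c G (halfBall s r) (far s (4 * r)) ⊆ (circ (!c) s r)ᶜ :=
    fun ω hω => arm_disjoint_circ (by omega) hG hω
  have h3 := measureReal_mono (μ := μ) hsub
  linarith

theorem circBd_lt_one : circBd < 1 := by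
  norm_num [circBd, doubling]

theorem IsBernoulliHalf.one_arm_le {μ : Measure Config} (hμ : IsBernoulliHalf μ) (c : Bool) (s : ℤ)
    {G : Set Site} (hG : G ⊆ {v | 0 ≤ v.1}) (J : ℕ) :
    μ.real (arm c G {(0, s)} (far s (2 * 4 ^ J))) ≤ (1 - circBd) ^ J := by
  have := hμ.prob
  set F : ℕ → Set Config := fun J => {ω | ∀ j < J, ω ∉ circ (!c) s (2 * 4 ^ j)} with hF
  have hdep : ∀ J, DepOn (halfBall s (2 * 4 ^ J)) (F J) := by
    intro J ω ω' h hω j hj h'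
    refine hω j hj (((arm_depOn _ _ _ _).mono ?_).iff h |>.2 h')
    refine Set.sdiff_subset.trans fun v hv => ?_
    have h1 : (4 : ℤ) ^ (j + 1) ≤ 4 ^ J := pow_le_pow_right₀ (by norm_num) hj
    rw [pow_succ] at h1
    rw [mem_halfBall] at hv ⊢
    omega
  have hle : ∀ J, μ.real (F J) ≤ (1 - circBd) ^ J := by
    intro J
    induction J with
    | zero => simp
    | succ J ih =>
      have h1 : F (J + 1) = F J ∩ (circ (!c) s (2 * 4 ^ J))ᶜ := by
        ext ω
        simp only [hF, Set.mem_ofPred_eq, Set.mem_inter_iff, Set.mem_compl_iff]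
        constructor
        · exact fun h => ⟨fun j hj => h j (by omega), h J (by omega)⟩
        · intro h j hj
          rcases (by omega : j < J ∨ j = J) with hj | rfl
          · exact h.1 j hj
          · exact h.2
      have hd : DepOn (halfAnn s (2 * 4 ^ J)) (circ (!c) s (2 * 4 ^ J)) := arm_depOn _ _ _ _
      have h2 := hμ.circ_ge (!c) s (r := 2 * 4 ^ J) (by
        have : (1 : ℤ) ≤ 4 ^ J := one_le_pow₀ (by norm_num)
        omega)
      have h3 : μ.real (circ (!c) s (2 * 4 ^ J))ᶜ = 1 - μ.real (circ (!c) s (2 * 4 ^ J)) :=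
        probReal_compl_eq_one_sub (hd.measurableSet (finite_halfAnn _ _))
      rw [h1, hμ.indep (finite_halfBall _ _) (finite_halfAnn _ _) Set.disjoint_sdiff_right (hdep J)
        hd.compl, pow_succ]
      have := circBd_lt_one
      refine mul_le_mul ih (by linarith) measureReal_nonneg (pow_nonneg (by linarith) _)
  refine (measureReal_mono fun ω hω j hj => ?_).trans (hle J)
  have h1 : (4 : ℤ) ^ (j + 1) ≤ 4 ^ J := pow_le_pow_right₀ (by norm_num) hj
  have h2 : (0 : ℤ) < 4 ^ j := by positivity
  refine arm_disjoint_circ (by positivity) hG (hω.mono le_rfl ?_ ?_)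
  · rintro v rfl
    rw [mem_halfBall]; simp only; omega
  · intro v hv
    rw [pow_succ] at h1
    simp only [far, Set.mem_ofPred_eq] at hv ⊢
    omega

/-! ### The lower bound -/

/-- The closed cluster of the bottom side of a rectangle. -/
def botCluster (x₀ x₁ y₀ y₁ : ℤ) (ω : Config) : Set Site :=
  kap false (rect x₀ x₁ y₀ y₁) {v | v.2 = y₀} ω

/-- The open sites on the upper boundary of the closed cluster of the bottom side. -/
def botBoundary (x₀ x₁ y₀ y₁ : ℤ) (ω : Config) : Set Site :=
  {v | v ∈ col true ω ∩ rect x₀ x₁ y₀ y₁ ∧ (v.2 = y₀ ∨ ∃ u ∈ botCluster x₀ x₁ y₀ y₁ ω, Adj u v)}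

theorem col_ne {ω : Config} {v : Site} (h : v ∈ col true ω) (h' : v ∈ col false ω) : False := by
  simp only [col, Set.mem_ofPred_eq] at h h'
  simp [h] at h'

theorem mem_col_of_not {ω : Config} {v : Site} {s : Bool} (h : v ∉ col s ω) : v ∈ col (!s) ω := by
  cases s <;> simpa [col] using h

theorem botBoundary_conn {x₁ y₀ y₁ t : ℤ} (hx : 1 ≤ x₁) (hy : y₀ ≤ t) (hy' : t ≤ y₁) {ω : Config}
    (h1 : (0, t - 1) ∈ botCluster 0 x₁ y₀ y₁ ω ∨ t = y₀)
    (h2 : ∀ j, t ≤ j → (0, j) ∉ botCluster 0 x₁ y₀ y₁ ω)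
    (h3 : ∀ v ∈ botCluster 0 x₁ y₀ y₁ ω, v.2 < y₁) :
    ∃ z : Site, z.1 = x₁ ∧ Conn (botBoundary 0 x₁ y₀ y₁ ω) (0, t) z := by
  set K := botCluster 0 x₁ y₀ y₁ ω with hK
  set A := botBoundary 0 x₁ y₀ y₁ ω with hA
  have hKR : K ⊆ col false ω ∩ rect 0 x₁ y₀ y₁ := kap_subset
  have hAR : A ⊆ col true ω ∩ rect 0 x₁ y₀ y₁ := fun v hv => hv.1
  set L : Set Site := {v | y₀ ≤ v.2 ∧ v.2 ≤ t ∧ v.1 < 0} with hL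
  set R : Set Site := {v | y₀ ≤ v.2 ∧ v.2 ≤ y₁ ∧ x₁ < v.1} with hR
  set B : Set Site := A ∪ L ∪ R with hB
  have hBs : ∀ v ∈ B, y₀ ≤ v.2 ∧ v.2 ≤ y₁ := by
    rintro v ((h | h) | h)
    · exact ⟨(hAR h).2.2.2.1, (hAR h).2.2.2.2⟩
    · exact ⟨h.1, h.2.1.trans hy'⟩
    · exact ⟨h.1, h.2.1⟩
  have hw : ∀ y, y < y₀ ∨ y₁ < y → Conn Bᶜ (-1, y) (x₁ + 1, y) := by
    intro y hy
    refine conn_horiz (by omega) fun z h1 h2 h => ?_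
    have := hBs _ h
    dsimp only at this
    omega
  have hyA : (0, t) ∈ A := by
    have hR0 : ((0, t) : Site) ∈ rect 0 x₁ y₀ y₁ := ⟨le_rfl, by simp only; omega, hy, hy'⟩
    refine ⟨⟨?_, hR0⟩, h1.symm.imp id fun h => ⟨_, h, by simp [adj_iff]⟩⟩
    by_contra hc
    rcases h1 with ⟨z, hz, hc'⟩ | h1
    · exact h2 t le_rfl ⟨z, hz, hc'.tail (by simp [adj_iff]) ⟨mem_col_of_not hc, hR0⟩⟩
    · exact h2 t le_rfl ⟨(0, t), h1, Conn.refl ⟨mem_col_of_not hc, hR0⟩⟩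
  have ht : Conn Bᶜ (-1, t + 1) (-1, y₁ + 1) := by
    refine conn_vert (by omega) fun z h1 h2 => ?_
    rintro ((h | h) | h)
    · have := (hAR h).2.1; simp only at this; omega
    · have := h.2.1; simp only at this; omega
    · have := h.2.2; simp only at this; omega
  rcases duality (B := B) (l := (-1, t)) (l' := (-1, y₀)) (b := (-1, y₀ - 1))
    (b' := (x₁ + 1, y₀ - 1)) (r := (x₁ + 1, y₀)) (r' := (x₁ + 1, y₁)) (t := (x₁ + 1, y₁ + 1))
    (t' := (-1, t + 1))
    (conn_vert hy fun z h1 h2 => Or.inl (Or.inr ⟨h1, h2, by simp only; omega⟩)).symm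
    (hw _ (by omega))
    (conn_vert (by omega) fun z h1 h2 => Or.inr ⟨h1, h2, by simp only; omega⟩)
    ((hw _ (by omega)).symm.trans ht.symm)
    (by simp [adj_iff]) (by simp [adj_iff]) (by simp [adj_iff]) (by simp [adj_iff]) with hd | hd
  · obtain ⟨a0, a', b', b0, ha0, ha0', hb0, -, g1, g2, g3⟩ := hd.between (A := L ∪ {(0, t)}) (B := R)
      (Or.inl ⟨hy, le_rfl, by simp only; omega⟩)
      ⟨le_rfl, by simp only; omega, by simp only; omega⟩
      (by
        rintro x - (hx | rfl) hx'
        · have := hx.2.2; have := hx'.2.2; omega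
        · have := hx'.2.2; simp only at this; omega)
      (by
        rintro x - y - (hx | rfl) hy hxy
        · have := hx.2.2; have := hy.2.2; rw [adj_iff] at hxy; omega
        · have := hy.2.2; rw [adj_iff] at hxy; simp only at *; omega)
    have g4 : Conn (A \ {(0, t)}) a' b' := g3.mono (by
      rintro v ⟨(h | h) | h, h'⟩
      · exact ⟨h, fun h'' => h' (Or.inl (Or.inr h''))⟩
      · exact absurd (Or.inl (Or.inl h)) h'
      · exact absurd (Or.inr h) h')
    have g5 := (hAR g4.left_mem.1).2
    have g6 := (hAR g4.right_mem.1).2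
    have hb' : b'.1 = x₁ := by
      have := hb0.2.2; rw [adj_iff] at g2; have := g6.2.1; omega
    rcases ha0 with ha0 | rfl
    · exfalso
      obtain ⟨a1, a2⟩ := a'
      have e1 := ha0.2.1
      have e2 := ha0.2.2
      have e3 := g5.1
      rw [adj_iff] at g1
      simp only at g1 e3
      have e4 : a2 ≠ t ∨ a1 ≠ 0 := by
        by_contra hc
        push Not at hc
        exact g4.left_mem.2 (by simp [hc])
      obtain rfl : a1 = 0 := by omega
      rcases h1 with h1 | rfl
      swap
      · have := g5.2.2.1
        simp only at this
        omega
      have e5 : a2 ≠ t - 1 := by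
        rintro rfl
        exact col_ne (hAR g4.left_mem.1).1 (hKR h1).1
      obtain ⟨z, hz, hc⟩ := h1
      obtain ⟨v, hv, hv'⟩ := g4.leftRightBot (fun v hv => (hAR hv.1).2) hb' hc.symm
        (fun v hv => hv.2) hz (by omega)
      exact col_ne (hAR hv.1).1 hv'.1
    · exact ⟨b', hb', (Conn.of_adj hyA g4.left_mem.1 g1).trans (g4.mono Set.sdiff_subset)⟩
  · exfalso
    obtain ⟨c, c', e1, e2, e3, e4, -⟩ := hd.exit (Q := K ∪ {v | v.2 < y₀}) (Or.inr (by simp)) (by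
      rintro (h | h)
      · have := (hKR h).2.2.2.2; simp only at this; omega
      · simp only [Set.mem_ofPred_eq] at h; omega)
    have hc' : c' ∉ rect 0 x₁ y₀ y₁ := by
      intro hR0
      by_cases ho : c' ∈ col true ω
      · refine e3 (Or.inl (Or.inl ⟨⟨ho, hR0⟩, ?_⟩))
        rcases e1.right_mem.2 with h | h
        · exact Or.inr ⟨c, h, e2⟩
        · left
          have := hR0.2.2.1
          simp only [Set.mem_ofPred_eq] at h
          rw [adj_iff] at e2
          omega
      · refine e4 (Or.inl ?_)
        rcases e1.right_mem.2 with ⟨z, hz, h⟩ | h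
        · exact ⟨z, hz, h.tail e2 ⟨mem_col_of_not ho, hR0⟩⟩
        · refine ⟨c', ?_, Conn.refl ⟨mem_col_of_not ho, hR0⟩⟩
          have := hR0.2.2.1
          simp only [Set.mem_ofPred_eq] at h ⊢
          rw [adj_iff] at e2
          omega
    have f1 : ¬ c'.2 < y₀ := fun h => e4 (Or.inr h)
    have f2 : c' ∉ L := fun h => e3 (Or.inl (Or.inr h))
    have f3 : c' ∉ R := fun h => e3 (Or.inr h)
    simp only [rect, hL, hR, Set.mem_ofPred_eq] at hc' f2 f3
    rw [adj_iff] at e2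
    rcases e1.right_mem.2 with h | h
    · have k1 := h3 c h
      have k2 := (hKR h).2
      simp only [rect, Set.mem_ofPred_eq] at k2
      have : c.1 = 0 := by omega
      refine h2 c.2 (by omega) ?_
      rwa [← this]
    · simp only [Set.mem_ofPred_eq] at h
      omega

/-- An open path from `(0, t)` to the right side and a closed path from `(0, t - 1)` to the bottom
side. -/
def lowStart (x₁ y₀ y₁ t : ℤ) : Set Config :=
  arm true (rect 0 x₁ y₀ y₁) {(0, t)} {v | v.1 = x₁} ∩
    arm false (rect 0 x₁ y₀ y₁) {(0, t - 1)} {v | v.2 = y₀}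

theorem lowest_of_lowStart {x₁ y₀ y₁ t : ℤ} (hx : 1 ≤ x₁) (hy : y₀ < t) (hy' : t ≤ y₁) {ω : Config}
    (h : ω ∈ lowStart x₁ y₀ y₁ t) :
    ∃ p, IsLowestCrossing 0 x₁ y₀ y₁ ω p ∧ p.head? = some (0, t) := by
  obtain ⟨⟨_, rfl, z, hz, ho⟩, ⟨_, rfl, d, hd, hc⟩⟩ := h
  have hK : botCluster 0 x₁ y₀ y₁ ω ⊆ col false ω ∩ rect 0 x₁ y₀ y₁ := kap_subset
  obtain ⟨z', hz', h⟩ := botBoundary_conn hx hy.le hy' (Or.inl ⟨d, hd, hc.symm⟩) (by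
    rintro j hj ⟨e, he, hje⟩
    rcases hj.eq_or_lt with rfl | hj
    · exact col_ne ho.left_mem.1 hje.right_mem.1
    · obtain ⟨v, hv, hv'⟩ := ho.leftRightBot (fun v hv => hv.2) hz hje.symm (fun v hv => hv.2) he hj
      exact col_ne hv.1 hv'.1) (by
    rintro v ⟨e, he, hje⟩
    by_contra hcon
    obtain ⟨w, hw, hw'⟩ := ho.cross hje
      (fun w hw => ⟨hw.2.1, by rw [Set.mem_ofPred_eq] at hz; rw [hz]; exact hw.2.2.1⟩)
      (fun w hw => ⟨by rw [Set.mem_ofPred_eq] at he; rw [he]; exact hw.2.2.2.1,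
        by have := hw.2.2.2.2; omega⟩)
    exact col_ne hw.1 hw'.1)
  obtain ⟨p, hp, hp1, hp2⟩ := h.exists_path
  refine ⟨p, ⟨⟨⟨hp.1, fun v hv => (hp.2 v hv).1.2⟩, fun v hv => (hp.2 v hv).1.1,
    ⟨_, ⟨h.left_mem.1.2, rfl⟩, hp1⟩, ⟨_, ⟨h.right_mem.1.2, hz'⟩, hp2⟩⟩, fun q hq v hv => ?_⟩, hp1⟩
  refine ⟨(hp.2 v hv).1.2, ?_⟩
  by_contra hcon
  push Not at hcon
  obtain ⟨hvq, r, hr, hr1, w, hw, hr2⟩ := hcon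
  obtain ⟨hqR, hqo, ⟨a, ha, hqa⟩, ⟨b, hb, hqb⟩⟩ := hq
  have hvw : Conn (rect 0 x₁ y₀ y₁ \ {w | w ∈ q}) v w := (hr.conn hr1 hr2).mono hr.2
  obtain ⟨e, he, hev⟩ : ∃ e : Site, e.2 = y₀ ∧ Conn (rect 0 x₁ y₀ y₁ \ {w | w ∈ q}) e v := by
    rcases (hp.2 v hv).2 with hv0 | ⟨u, ⟨e, he, hue⟩, huv⟩
    · exact ⟨v, hv0, Conn.refl hvw.left_mem⟩
    · exact ⟨e, he, (Conn.mono (T := rect 0 x₁ y₀ y₁ \ {w | w ∈ q})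
        (fun x hx => ⟨hx.2, fun hxq => col_ne (hqo x hxq) hx.1⟩) hue).tail huv
        hvw.left_mem⟩
  obtain ⟨x, hx, hx'⟩ := (hqR.conn hqa hqb).cross (hev.trans hvw)
    (fun x hx => ⟨by rw [ha.2]; exact hx.1.1, by rw [hb.2]; exact hx.1.2.1⟩)
    (fun x hx => ⟨by rw [he]; exact (hqR.2 x hx).2.2.1, by rw [hw.2]; exact (hqR.2 x hx).2.2.2⟩)
  exact hx'.2 hx

theorem lowStart_shift {μ : Measure Config} (hμ : IsBernoulliHalf μ) (x₁ y₀ y₁ t k : ℤ) :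
    μ.real (lowStart x₁ (y₀ + k) (y₁ + k) (t + k)) = μ.real (lowStart x₁ y₀ y₁ t) := by
  rw [← hμ.real_map (shift 0 k) false (finite_rect 0 x₁ y₀ y₁) (A := lowStart x₁ y₀ y₁ t)
    ((arm_depOn _ _ _ _).inter (arm_depOn _ _ _ _))]
  congr 1
  ext ω
  have hR : ∀ v, shift 0 k v ∈ rect 0 x₁ (y₀ + k) (y₁ + k) ↔ v ∈ rect 0 x₁ y₀ y₁ := by
    intro v
    simp only [rect, shift, Equiv.coe_fn_mk, Set.mem_ofPred_eq]
    omega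
  refine (and_congr (comp_mem_arm (shift 0 k) (adj_shift 0 k) true hR ?_ ?_ ω)
    (comp_mem_arm (shift 0 k) (adj_shift 0 k) false hR ?_ ?_ ω)).symm
  · rintro ⟨v1, v2⟩; simp [shift]
  · intro v; simp [shift]
  · rintro ⟨v1, v2⟩
    simp only [shift, Equiv.coe_fn_mk, Set.mem_singleton_iff, Prod.mk.injEq]
    omega
  · intro v; simp [shift]

theorem exists_lowStart {x₁ h m : ℤ} (hx : 1 ≤ x₁) (hm : h ≤ m) {ω : Config}
    (h1 : ω ∈ arm true (rect 0 x₁ 1 h) {v | v.1 = 0} {v | v.1 = x₁})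
    (h2 : ω ∈ arm false (rect 0 x₁ (-h) (-1)) {v | v.1 = 0} {v | v.1 = x₁})
    (h3 : ω ∈ arm false (rect 0 x₁ (-m) (-1)) {v | v.2 = -m} {v | v.2 = -1}) :
    ∃ s, -h < s ∧ s ≤ h ∧ ∀ lo hi, -m ≤ lo → lo ≤ -h → h ≤ hi → ω ∈ lowStart x₁ lo hi s := by
  obtain ⟨⟨a1, a2⟩, ha, b, hb, hab⟩ := h1
  obtain ⟨⟨c1, c2⟩, hc, d, hd, hcd⟩ := h2
  obtain ⟨e, he, f, hf, hef⟩ := h3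
  simp only [Set.mem_ofPred_eq] at ha hb hc hd he hf
  subst ha hc
  have ha2 := hab.left_mem.2
  have hc2 := hcd.left_mem.2
  simp only [rect, Set.mem_ofPred_eq] at ha2 hc2
  set K := botCluster 0 x₁ (-m) h ω with hK
  have hKR : K ⊆ col false ω ∩ rect 0 x₁ (-m) h := kap_subset
  have hmono : ∀ y₀ y₁, -m ≤ y₀ → y₁ ≤ h → col false ω ∩ rect 0 x₁ y₀ y₁ ⊆
      col false ω ∩ rect 0 x₁ (-m) h := by
    rintro y₀ y₁ g1 g2 v ⟨g3, g4, g5, g6, g7⟩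
    exact ⟨g3, g4, g5, g1.trans g6, g7.trans g2⟩
  have hcK : (0, c2) ∈ K := by
    obtain ⟨v, hv, hv'⟩ := hcd.in_cluster.cross hef.in_cluster
      (fun v hv => ⟨(Conn.right_mem hv).2.1, by rw [hd]; exact (Conn.right_mem hv).2.2.1⟩)
      (fun v hv => ⟨by rw [he]; have := (Conn.right_mem hv).2.2.2.1; omega,
        by rw [hf]; exact (Conn.right_mem hv).2.2.2.2⟩)
    exact ⟨e, he, (Conn.mono (hmono _ _ le_rfl (by omega)) hv').trans
      (Conn.mono (hmono _ _ (by omega) (by omega)) hv).symm⟩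
  have htop : ∀ v ∈ K, v.2 < h := by
    rintro v ⟨g, hg, hgv⟩
    by_contra hcon
    obtain ⟨w, hw, hw'⟩ := hab.cross hgv
      (fun w hw => ⟨hw.2.1, by rw [hb]; exact hw.2.2.1⟩)
      (fun w hw => ⟨by rw [hg]; have := hw.2.2.2.1; omega, by have := hw.2.2.2.2; omega⟩)
    exact col_ne hw.1 hw'.1
  obtain ⟨j, hj, hj'⟩ := Int.exists_greatest_of_bdd (P := fun j => (0, j) ∈ K)
    ⟨h, fun z hz => (htop _ hz).le⟩ ⟨c2, hcK⟩
  have hjc := hj' c2 hcK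
  have hjh := htop _ hj
  simp only at hjh
  refine ⟨j + 1, by omega, by omega, fun lo hi g1 g2 g3 => ?_⟩
  obtain ⟨z, hz, hzA⟩ := botBoundary_conn (t := j + 1) hx (by omega) (by omega)
    (Or.inl (by simpa using hj)) (fun i hi hiK => by have := hj' i hiK; omega) htop
  have hA : botBoundary 0 x₁ (-m) h ω ⊆ col true ω ∩ rect 0 x₁ (-m) h := fun v hv => hv.1
  have hlow : ∀ v, Conn (botBoundary 0 x₁ (-m) h ω) (0, j + 1) v → -h ≤ v.2 := by
    intro v hv
    by_contra hcon
    obtain ⟨c, c', k1, k2, k3, k4, -⟩ := hv.exit (Q := {v | -h ≤ v.2})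
      (by simp only [Set.mem_ofPred_eq]; omega) hcon
    have k5 := k1.right_mem.2
    simp only [Set.mem_ofPred_eq] at k4 k5
    have k6 := (hA k3).2
    obtain ⟨x, hx, hx'⟩ := hcd.leftRightBot (x₁ := x₁) (y₀ := -h - 1) (y₁ := h)
      (T := botBoundary 0 x₁ (-m) h ω ∩ {v | -h - 1 ≤ v.2}) (z' := c') (w := j + 1)
      (fun x hx => ⟨hx.2.1, hx.2.2.1, by have := hx.2.2.2.1; omega, by have := hx.2.2.2.2; omega⟩) hd
      (Conn.tail (Conn.mono (T := botBoundary 0 x₁ (-m) h ω ∩ {v | -h - 1 ≤ v.2})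
        (fun x hx => ⟨hx.1, by have := hx.2; simp only [Set.mem_ofPred_eq] at *; omega⟩) k1) k2
        ⟨k3, by rw [adj_iff] at k2; simp only [Set.mem_ofPred_eq]; omega⟩)
      (fun x hx => ⟨(hA hx.1).2.1, (hA hx.1).2.2.1, hx.2, (hA hx.1).2.2.2.2⟩)
      (by rw [adj_iff] at k2; omega) (by omega)
    exact col_ne (hA hx'.1).1 hx.1
  have hzA' : Conn (botBoundary 0 x₁ (-m) h ω ∩ {v | -h ≤ v.2}) (0, j + 1) z :=
    hzA.in_cluster.mono fun v hv => ⟨Conn.right_mem hv, hlow v hv⟩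
  refine ⟨⟨_, rfl, z, hz, hzA'.mono ?_⟩, ⟨(0, j + 1 - 1), rfl, ?_⟩⟩
  · rintro v ⟨hv, hv'⟩
    have := (hA hv).2
    simp only [rect, Set.mem_ofPred_eq] at this hv'
    exact ⟨(hA hv).1, this.1, this.2.1, by omega, by omega⟩
  · obtain ⟨g, hg, hgj⟩ := hj
    simp only [Set.mem_ofPred_eq] at hg
    have key : ∃ b : Site, b.2 = lo ∧ Conn (col false ω ∩ rect 0 x₁ (-m) h ∩ {v | lo ≤ v.2}) (0, j) b := by
      by_cases hlo : lo = -m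
      · exact ⟨g, by omega, hgj.symm.mono fun v hv => ⟨hv, hlo ▸ hv.2.2.2.1⟩⟩
      · obtain ⟨c, c', k1, k2, k3, k4, -⟩ := hgj.symm.exit (Q := {v | lo ≤ v.2})
          (by simp only [Set.mem_ofPred_eq]; omega) (by simp only [Set.mem_ofPred_eq]; omega)
        refine ⟨c, ?_, k1⟩
        have := k1.right_mem.2
        rw [adj_iff] at k2
        simp only [Set.mem_ofPred_eq] at this k4
        omega
    obtain ⟨b, hb, hjb⟩ := key
    refine ⟨b, hb, ?_⟩
    rw [add_sub_cancel_right]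
    refine hjb.mono ?_
    rintro v ⟨⟨k1, k2⟩, k3⟩
    simp only [rect, Set.mem_ofPred_eq] at k2 k3
    exact ⟨k1, k2.1, k2.2.1, k3, by omega⟩

theorem IsBernoulliHalf.lowStart_ge_of_large {μ : Measure Config} (hμ : IsBernoulliHalf μ) {n t : ℤ}
    (hn : 16 ≤ n) (ht : -n ≤ 2 * t) (ht' : 2 * t ≤ n) :
    doubling 5 ^ 3 ≤ n * μ.real (lowStart (2 * n) (-n) n t) := by
  have := hμ.prob
  set h := n / 4 with hh
  set m := n + t + h with hm
  have h1 := hμ.rsw_horiz 5 true 0 1 (w := 2 * n) (b := h - 1) (by omega) (by omega) (by omega)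
  have h2 := hμ.rsw_horiz 5 false 0 (-h) (w := 2 * n) (b := h - 1) (by omega) (by omega) (by omega)
  have h3 := hμ.rsw_vert 5 false 0 (-m) (w := m - 1) (b := 2 * n) (by omega) (by omega) (by omega)
  rw [show 1 + (h - 1) = h by ring, zero_add] at h1
  rw [show -h + (h - 1) = -1 by ring, zero_add] at h2
  rw [show -m + (m - 1) = -1 by ring, zero_add] at h3
  set E₁ := arm true (rect 0 (2 * n) 1 h) {v | v.1 = 0} {v | v.1 = 2 * n}
  set E₂ := arm false (rect 0 (2 * n) (-h) (-1)) {v | v.1 = 0} {v | v.1 = 2 * n}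
  set E₃ := arm false (rect 0 (2 * n) (-m) (-1)) {v | v.2 = -m} {v | v.2 = -1}
  have d2 : DepOn (rect 0 (2 * n) (-m) (-1)) E₂ := (arm_depOn _ _ _ _).mono fun v hv =>
    ⟨hv.1, hv.2.1, by have := hv.2.2.1; omega, hv.2.2.2⟩
  have d3 : DepOn (rect 0 (2 * n) (-m) (-1)) E₃ := arm_depOn _ _ _ _
  have i23 := hμ.harrisC false (finite_rect _ _ _ _) d2 d3 (arm_incrC _ _ _ _) (arm_incrC _ _ _ _)
  have i1 : μ.real (E₁ ∩ (E₂ ∩ E₃)) = μ.real E₁ * μ.real (E₂ ∩ E₃) :=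
    hμ.indep (finite_rect _ _ _ _) (finite_rect _ _ _ _) (Set.disjoint_left.2 fun v hv hv' => by
      have := hv.2.2.1; have := hv'.2.2.2; omega) (arm_depOn _ _ _ _) (d2.inter d3)
  have hsub : E₁ ∩ (E₂ ∩ E₃) ⊆ ⋃ s ∈ Finset.Ioc (-h) h,
      lowStart (2 * n) (-n + (s - t)) (n + (s - t)) (t + (s - t)) := by
    rintro ω ⟨e1, e2, e3⟩
    obtain ⟨s, hs, hs', hω⟩ := exists_lowStart (by omega) (by omega) e1 e2 e3
    simp only [Set.mem_iUnion, Finset.mem_Ioc]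
    refine ⟨s, ⟨hs, hs'⟩, ?_⟩
    rw [show t + (s - t) = s by ring]
    exact hω _ _ (by omega) (by omega) (by omega)
  have hp := doubling_pos 5
  calc doubling 5 ^ 3 = doubling 5 * (doubling 5 * doubling 5) := by ring
    _ ≤ μ.real E₁ * (μ.real E₂ * μ.real E₃) := by gcongr
    _ ≤ μ.real E₁ * μ.real (E₂ ∩ E₃) := by gcongr
    _ = μ.real (E₁ ∩ (E₂ ∩ E₃)) := i1.symm
    _ ≤ ∑ s ∈ Finset.Ioc (-h) h, μ.real (lowStart (2 * n) (-n + (s - t)) (n + (s - t)) (t + (s - t))) :=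
      (measureReal_mono hsub (measure_ne_top _ _)).trans (measureReal_biUnion_finset_le _ _)
    _ = ((h - -h).toNat : ℝ) * μ.real (lowStart (2 * n) (-n) n t) := by
      simp only [lowStart_shift hμ, Finset.sum_const, Int.card_Ioc, nsmul_eq_mul]
    _ ≤ n * μ.real (lowStart (2 * n) (-n) n t) := by
      gcongr
      have : ((h - -h).toNat : ℤ) ≤ n := by omega
      exact_mod_cast this

theorem IsBernoulliHalf.lowStart_ge {μ : Measure Config} (hμ : IsBernoulliHalf μ) {n t : ℤ}
    (hn : 1 ≤ n) (ht : -n ≤ 2 * t) (ht' : 2 * t ≤ n) :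
    min (doubling 5 ^ 3) ((1 / 2) ^ 961) ≤ n * μ.real (lowStart (2 * n) (-n) n t) := by
  have := hμ.prob
  rcases le_or_gt 16 n with h16 | h16
  · exact (min_le_left _ _).trans (hμ.lowStart_ge_of_large h16 ht ht')
  refine (min_le_right _ _).trans ?_
  set F : Finset Site := Finset.Icc 0 (2 * n) ×ˢ Finset.Icc (-n) n with hF
  have hcard : F.card ≤ 961 := by
    simp only [hF, Finset.card_product, Int.card_Icc]
    calc (2 * n + 1 - 0).toNat * (n + 1 - -n).toNat ≤ 31 * 31 := Nat.mul_le_mul (by omega) (by omega)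
      _ = 961 := by norm_num
  have hsub : {ω : Config | ∀ v ∈ F, ω v = decide (t ≤ v.2)} ⊆ lowStart (2 * n) (-n) n t := by
    intro ω hω
    have hω' : ∀ a b : ℤ, 0 ≤ a → a ≤ 2 * n → -n ≤ b → b ≤ n → ω (a, b) = decide (t ≤ b) :=
      fun a b h1 h2 h3 h4 => hω (a, b) (by simp [hF, h1, h2, h3, h4])
    refine ⟨⟨(0, t), rfl, (2 * n, t), rfl, conn_horiz (by omega) ?_⟩,
      ⟨(0, t - 1), rfl, (0, -n), rfl, (conn_vert (by omega) ?_).symm⟩⟩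
    · intro z h1 h2
      refine ⟨?_, h1, h2, by simp only; omega, by simp only; omega⟩
      simp only [col, Set.mem_ofPred_eq]
      rw [hω' z t h1 h2 (by omega) (by omega)]; simp
    · intro z h1 h2
      refine ⟨?_, le_rfl, by simp only; omega, by simp only; omega, by simp only; omega⟩
      simp only [col, Set.mem_ofPred_eq]
      rw [hω' 0 z le_rfl (by omega) (by omega) (by omega)]; simp; omega
  have hn1 : (1 : ℝ) ≤ n := by exact_mod_cast hn
  calc ((1 / 2 : ℝ)) ^ 961 ≤ (1 / 2) ^ F.card :=
        pow_le_pow_of_le_one (by norm_num) (by norm_num) hcard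
    _ = μ.real {ω : Config | ∀ v ∈ F, ω v = decide (t ≤ v.2)} := (hμ.real_cyl F _).symm
    _ ≤ μ.real (lowStart (2 * n) (-n) n t) := measureReal_mono hsub
    _ ≤ n * μ.real (lowStart (2 * n) (-n) n t) := le_mul_of_one_le_left measureReal_nonneg hn1

/-! ### The half-plane three-arm event -/

/-- Three arms of colours open, closed, open issued from the neighbours `(a + 1, b)`,
`(a + 1, b - 1)`, `(a, b - 1)` of an open site `(a, b)` to distance `R`, in the half plane to the
right of the column of `(a, b)`; the last arm avoids that column above `(a, b)`, and the others
avoid it altogether. -/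
def threeArm (a b R : ℤ) : Set Config :=
  (arm true (rect (a + 1) (a + R) (b - R) (b + R)) {(a + 1, b)}
      {v | v.1 = a + R ∨ v.2 = b - R ∨ v.2 = b + R} ∩
    arm false (rect (a + 1) (a + R) (b - R) (b + R)) {(a + 1, b - 1)}
      {v | v.1 = a + R ∨ v.2 = b - R ∨ v.2 = b + R}) ∩
  (arm true (rect a (a + R) (b - R) (b + R) \ {v | v.1 = a ∧ b ≤ v.2}) {(a, b - 1)}
      {v | v.1 = a + R ∨ v.2 = b - R ∨ v.2 = b + R} ∩
    arm true {(a, b)} {(a, b)} {(a, b)})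

theorem threeArm_depOn {a b R : ℤ} (hR : 0 ≤ R) :
    DepOn (rect a (a + R) (b - R) (b + R)) (threeArm a b R) := by
  have h : rect (a + 1) (a + R) (b - R) (b + R) ⊆ rect a (a + R) (b - R) (b + R) :=
    fun v hv => ⟨by have := hv.1; omega, hv.2⟩
  refine (((arm_depOn _ _ _ _).mono h).inter ((arm_depOn _ _ _ _).mono h)).inter
    (((arm_depOn _ _ _ _).mono Set.sdiff_subset).inter ((arm_depOn _ _ _ _).mono ?_))
  rintro v rfl
  exact ⟨le_rfl, by simp only; omega, by simp only; omega, by simp only; omega⟩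

theorem threeArm_shift {μ : Measure Config} (hμ : IsBernoulliHalf μ) (a b k l : ℤ) {R : ℤ}
    (hR : 0 ≤ R) : μ.real (threeArm (a + k) (b + l) R) = μ.real (threeArm a b R) := by
  rw [← hμ.real_map (shift k l) false (finite_rect _ _ _ _) (threeArm_depOn (a := a) (b := b) hR)]
  congr 1
  ext ω
  have hp : ∀ c d c' d' : ℤ, c' = c + k → d' = d + l →
      ∀ v, shift k l v ∈ ({(c', d')} : Set Site) ↔ v ∈ ({(c, d)} : Set Site) := by
    rintro c d _ _ rfl rfl ⟨v1, v2⟩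
    simp only [shift, Equiv.coe_fn_mk, Set.mem_singleton_iff, Prod.mk.injEq]
    omega
  refine (and_congr (and_congr (comp_mem_arm (shift k l) (adj_shift k l) true ?_ ?_ ?_ ω)
    (comp_mem_arm (shift k l) (adj_shift k l) false ?_ ?_ ?_ ω))
    (and_congr (comp_mem_arm (shift k l) (adj_shift k l) true ?_ ?_ ?_ ω)
    (comp_mem_arm (shift k l) (adj_shift k l) true ?_ ?_ ?_ ω))).symm
  all_goals
    first
    | exact hp _ _ _ _ (by ring) (by ring)
    | intro v
      simp only [rect, shift, Equiv.coe_fn_mk, Set.mem_ofPred_eq, Set.mem_sdiff]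
      omega

theorem threeArm_sep {a b a' b' R N : ℤ} {ω : Config} (hx : ω ∈ threeArm a b R)
    (hx' : ω ∈ threeArm a' b' R) (h : a + 2 ≤ a' ∨ a = a' ∧ b < b') (ha : 1 ≤ a) (ha' : a' ≤ N)
    (hb : -N ≤ b) (hb' : b' ≤ N) (hbN : b ≤ N) (hbN' : -N ≤ b') (h1 : N < a + R) (h2 : N < b + R)
    (h3 : b - R < -N) (h2' : N < b' + R) (h3' : b' - R < -N) :
    ¬ Conn (col false ω ∩ rect 0 N (-N) N) (a + 1, b - 1) (a' + 1, b' - 1) := by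
  intro hW
  rcases h with h | ⟨rfl, h⟩
  · obtain ⟨⟨⟨_, rfl, g, hg, hgc⟩, -⟩, ⟨_, rfl, d, hd, hdc⟩, ⟨_, rfl, _, rfl, hux⟩⟩ := hx'
    refine enclosure (u := (a', b')) (S := (col false ω ∩ rect 0 N (-N) N) ∪ rect 0 (a' - 1) (-N) N)
      (x₀ := 0) (x₁ := N) (y₀ := -N) (y₁ := N) ⟨by simp only; omega, ha', hbN', hb'⟩ ?_ hgc ?_ hdc ?_
      ?_ ?_ ?_ ?_ ?_ ?_
    · rintro v (hv | hv)
      · exact hv.2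
      · exact ⟨hv.1, by have := hv.2.1; omega, hv.2.2⟩
    · intro hg'
      simp only [rect, Set.mem_ofPred_eq] at hg hg'
      omega
    · intro hg'
      simp only [rect, Set.mem_ofPred_eq] at hd hg'
      omega
    · rintro v (hv | hv) hv'
      · exact col_ne hv'.1 hv.1
      · have := hv.2.1; have := hv'.2.1; omega
    · rintro v (hv | hv) hv'
      · exact col_ne hv'.1 hv.1
      · have := hv.2.1; have := hv'.2.1.1; omega
    · rintro (hv | hv)
      · exact col_ne hux.left_mem.1 hv.1
      · have := hv.2.1; simp only at this; omega
    · intro hv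
      have := hv.2.1; simp only at this; omega
    · intro hv
      exact hv.2.2 ⟨rfl, le_rfl⟩
    · refine (hW.symm.mono Set.subset_union_left).trans
        (Conn.mono Set.subset_union_right (conn_rect ?_ ?_))
      · have := hW.left_mem.2
        simp only [rect, Set.mem_ofPred_eq] at this ⊢
        omega
      · simp only [rect, Set.mem_ofPred_eq]
        omega
  · obtain ⟨-, -, ⟨_, rfl, _, rfl, hux'⟩⟩ := hx'
    obtain ⟨⟨⟨_, rfl, g, hg, hgc⟩, -⟩, ⟨_, rfl, d, hd, hdc⟩, ⟨_, rfl, _, rfl, hux⟩⟩ := hx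
    refine enclosure (u := (a, b)) (S := (col false ω ∩ rect 0 N (-N) N) ∪
      ({(a, b')} ∪ rect 0 (a - 1) (-N) N))
      (x₀ := 0) (x₁ := N) (y₀ := -N) (y₁ := N) ⟨by simp only; omega, ha', hb, hbN⟩ ?_ hgc ?_ hdc ?_
      ?_ ?_ ?_ ?_ ?_ ?_
    · rintro v (hv | rfl | hv)
      · exact hv.2
      · exact ⟨by simp only; omega, ha', hbN', hb'⟩
      · exact ⟨hv.1, by have := hv.2.1; omega, hv.2.2⟩
    · intro hg'
      simp only [rect, Set.mem_ofPred_eq] at hg hg'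
      omega
    · intro hg'
      simp only [rect, Set.mem_ofPred_eq] at hd hg'
      omega
    · rintro v (hv | rfl | hv) hv'
      · exact col_ne hv'.1 hv.1
      · have := hv'.2.1; simp only at this; omega
      · have := hv.2.1; have := hv'.2.1; omega
    · rintro v (hv | rfl | hv) hv'
      · exact col_ne hv'.1 hv.1
      · exact hv'.2.2 ⟨rfl, h.le⟩
      · have := hv.2.1; have := hv'.2.1.1; omega
    · rintro (hv | hv | hv)
      · exact col_ne hux.left_mem.1 hv.1
      · simp only [Set.mem_singleton_iff, Prod.mk.injEq] at hv; omega
      · have := hv.2.1; simp only at this; omega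
    · intro hv
      have := hv.2.1; simp only at this; omega
    · intro hv
      exact hv.2.2 ⟨rfl, le_rfl⟩
    · refine ((hW.mono Set.subset_union_left).tail (c := (a, b')) (by simp [adj_iff])
        (Or.inr (Or.inl rfl))).trans (Conn.trans (b := (a - 1, b')) ?_
        (Conn.mono (S := rect 0 (a - 1) (-N) N) (fun v hv => Or.inr (Or.inr hv)) (conn_rect ?_ ?_)))
      · refine Conn.of_adj (Or.inr (Or.inl rfl)) (Or.inr (Or.inr ?_)) (by simp [adj_iff])
        simp only [rect, Set.mem_ofPred_eq]; omega
      · simp only [rect, Set.mem_ofPred_eq]; omega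
      · simp only [rect, Set.mem_ofPred_eq]; omega

theorem IsBernoulliHalf.threeArm_le_of_large {μ : Measure Config} (hμ : IsBernoulliHalf μ)
    (a b : ℤ) {m R : ℤ} (hm : 1 ≤ m) (hR : 18 * m ≤ R) :
    (m : ℝ) ^ 2 * μ.real (threeArm a b R) ≤ 1 / circBd := by
  set J : Finset (ℤ × ℤ) := Finset.Icc 1 m ×ˢ Finset.Icc 1 m with hJ
  have key := hμ.sum_arms_le false (G := rect 0 (16 * m) (-(16 * m)) (16 * m))
    (S := rect 0 (16 * m + R) (-R) (m + R))
    (Inn := halfBall 0 (4 * m)) (Out := far 0 (4 * (4 * m))) (finite_rect _ _ _ _)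
    (finite_rect _ _ _ _) (ρ := 1 - circBd) (by have := circBd_pos; linarith)
    (hμ.arm_le false 0 (by omega) fun v hv => hv.1) J (fun i => threeArm (2 * i.1) i.2 R) (by
      intro i hi
      simp only [hJ, Finset.mem_product, Finset.mem_Icc] at hi
      refine (threeArm_depOn (by omega)).mono fun v hv => ?_
      simp only [rect, Set.mem_ofPred_eq] at hv ⊢
      omega) (fun ω => ⟨fun i => (2 * i.1 + 1, i.2 - 1), ?_, ?_⟩)
  · rw [sub_sub_cancel] at key
    refine le_trans (le_of_eq ?_) key
    have : ∀ i ∈ J, μ.real (threeArm (2 * i.1) i.2 R) = μ.real (threeArm a b R) := by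
      intro i _
      rw [← threeArm_shift hμ a b (2 * i.1 - a) (i.2 - b) (by omega)]
      congr 2 <;> ring
    rw [Finset.sum_congr rfl this]
    simp only [hJ, Finset.sum_const, Finset.card_product, Int.card_Icc, nsmul_eq_mul,
      add_sub_cancel_right]
    have hmm : ((m.toNat : ℕ) : ℝ) = (m : ℝ) := by
      have : ((m.toNat : ℕ) : ℤ) = m := Int.toNat_of_nonneg (by omega)
      exact_mod_cast this
    push_cast
    rw [hmm]
    ring
  · rintro ⟨i, j⟩ hi ⟨⟨-, ⟨_, rfl, d, hd, hc⟩⟩, -⟩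
    simp only [hJ, Finset.mem_product, Finset.mem_Icc] at hi hc
    refine ⟨mem_halfBall.2 (by simp only; omega), ?_⟩
    obtain ⟨c, c', h1, h2, h3, h4, -⟩ := hc.exit (Q := rect 0 (16 * m) (-(16 * m)) (16 * m))
      (by simp only [rect, Set.mem_ofPred_eq]; omega)
      (by simp only [rect, Set.mem_ofPred_eq] at hd ⊢; omega)
    refine ⟨c, ?_, h1.mono fun v hv => ⟨hv.1.1, hv.2⟩⟩
    have h5 := h1.right_mem.2
    have h6 := h3.2.1
    rw [adj_iff] at h2
    simp only [rect, far, Set.mem_ofPred_eq] at h4 h5 h6 ⊢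
    omega
  · rintro ⟨i, j⟩ hi ⟨i', j'⟩ hi' hne hω hω'
    simp only [hJ, Finset.mem_product, Finset.mem_Icc] at hi hi'
    have hne' : i ≠ i' ∨ j ≠ j' := by
      by_contra hcon
      push Not at hcon
      exact hne (by rw [hcon.1, hcon.2])
    rcases (by omega : (2 * i + 2 ≤ 2 * i' ∨ 2 * i = 2 * i' ∧ j < j') ∨
      (2 * i' + 2 ≤ 2 * i ∨ 2 * i' = 2 * i ∧ j' < j)) with h | h
    · exact threeArm_sep hω hω' h (by omega) (by omega) (by omega) (by omega) (by omega) (by omega)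
        (by omega) (by omega) (by omega) (by omega) (by omega)
    · exact fun hc => threeArm_sep hω' hω h (by omega) (by omega) (by omega) (by omega) (by omega)
        (by omega) (by omega) (by omega) (by omega) (by omega) (by omega) hc.symm

theorem IsBernoulliHalf.threeArm_le {μ : Measure Config} (hμ : IsBernoulliHalf μ)
    (a b : ℤ) {R : ℤ} (hR : 1 ≤ R) :
    (R : ℝ) ^ 2 * μ.real (threeArm a b R) ≤ 1296 / circBd := by
  have := hμ.prob
  have hc := circBd_pos
  rcases le_or_gt 18 R with h | h
  · have h1 := hμ.threeArm_le_of_large a b (m := R / 18) (R := R) (by omega) (by omega)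
    have h2 : (R : ℝ) ≤ 36 * ((R / 18 : ℤ) : ℝ) := by
      have : R ≤ 36 * (R / 18) := by omega
      exact_mod_cast this
    have h3 : (0 : ℝ) ≤ R := by exact_mod_cast (by omega : (0 : ℤ) ≤ R)
    calc (R : ℝ) ^ 2 * μ.real (threeArm a b R)
        ≤ (36 * ((R / 18 : ℤ) : ℝ)) ^ 2 * μ.real (threeArm a b R) := by gcongr
      _ = 1296 * (((R / 18 : ℤ) : ℝ) ^ 2 * μ.real (threeArm a b R)) := by ring
      _ ≤ 1296 * (1 / circBd) := by gcongr
      _ = 1296 / circBd := by ring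
  · have h1 : (R : ℝ) ≤ 36 := by exact_mod_cast (by omega : R ≤ 36)
    have h3 : (0 : ℝ) ≤ R := by exact_mod_cast (by omega : (0 : ℤ) ≤ R)
    calc (R : ℝ) ^ 2 * μ.real (threeArm a b R) ≤ 36 ^ 2 * 1 := by
          gcongr
          exact measureReal_le_one
      _ ≤ 1296 / circBd := by
          rw [le_div_iff₀ hc]
          have := circBd_lt_one
          linarith

/-! ### The two-arm event around a boundary site -/

/-- The part of a rectangle outside of a half ball. -/
def outside (x₁ y₀ y₁ t r : ℤ) : Set Site := rect 0 x₁ y₀ y₁ \ halfBall t r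

/-- The sites adjacent to a half ball. -/
def rim (t r : ℤ) : Set Site := {v | ∃ u ∈ halfBall t r, Adj u v}

theorem finite_outside (x₁ y₀ y₁ t r : ℤ) : (outside x₁ y₀ y₁ t r).Finite :=
  (finite_rect _ _ _ _).sdiff

/-- An open arm from a half ball to the right side, and a closed arm to the bottom side. -/
def farArms (x₁ y₀ y₁ t r : ℤ) : Set Config :=
  arm true (outside x₁ y₀ y₁ t r) (rim t r) {v | v.1 = x₁} ∩
    arm false (outside x₁ y₀ y₁ t r) (rim t r) {v | v.2 = y₀}

/-- An open arm from the left side above a half ball to the right side, and a closed arm from the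
left side below the half ball to the bottom side. -/
def rootedArms (x₁ y₀ y₁ t r : ℤ) : Set Config :=
  arm true (outside x₁ y₀ y₁ t r) {v | v.1 = 0 ∧ t + r < v.2 ∧ v.2 ≤ t + 4 * r} {v | v.1 = x₁} ∩
    arm false (outside x₁ y₀ y₁ t r) {v | v.1 = 0 ∧ t - 4 * r ≤ v.2 ∧ v.2 < t - r} {v | v.2 = y₀}

theorem Conn.first_hit {M P : Set Site} {p v : Site} (h : Conn M p v) (hv : v ∈ P) :
    ∃ c ∈ P, c ∈ M ∧ Conn ((M \ P) ∪ {c}) p c := by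
  by_cases hp : p ∈ P
  · exact ⟨p, hp, h.left_mem, Conn.refl (Or.inr rfl)⟩
  · obtain ⟨c, c', h1, h2, h3, h4, -⟩ := h.exit (Q := Pᶜ) hp (fun h => h hv)
    refine ⟨c', not_not.mp h4, h3, Conn.tail ?_ h2 (Or.inr rfl)⟩
    exact Conn.mono (fun x hx => Or.inl hx) h1

/-- A path made of sites of a closed set `K` and of open sites, meeting an open cluster, either
extends that cluster or has a piece from its start to `K` avoiding the cluster. -/
theorem Conn.reroute {s : Bool} {ω : Config} {D K M : Set Site} {a p v : Site}
    (hK : K ⊆ col s ω ∩ D) (hM : M ⊆ D) (hMK : ∀ x ∈ M, x ∈ K ∨ ω x = !s) (h : Conn M p v)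
    (hv : Conn (col (!s) ω ∩ D) a v) :
    Conn (col (!s) ω ∩ D) p a ∨
      ∃ c ∈ K, Conn (D \ {x | Conn (col (!s) ω ∩ D) a x}) p c := by
  obtain ⟨c, hc, hcM, h1⟩ := h.first_hit (P := K ∪ {x | Conn (col (!s) ω ∩ D) a x}) (Or.inr hv)
  rcases hc with hc | hc
  · refine Or.inr ⟨c, hc, Conn.mono ?_ h1⟩
    rintro x (hx | rfl)
    · exact ⟨hM hx.1, fun h' => hx.2 (Or.inr h')⟩
    · refine ⟨hM hcM, fun h' => ?_⟩
      have h2 := (hK hc).1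
      have h3 := h'.right_mem.1
      simp only [col, Set.mem_ofPred_eq] at h2 h3
      rw [h2] at h3
      cases s <;> simp at h3
  · refine Or.inl (Conn.trans (Conn.mono ?_ h1) hc.symm)
    rintro x (hx | rfl)
    · refine ⟨?_, hM hx.1⟩
      rcases hMK x hx.1 with h' | h'
      · exact absurd (Or.inl h') hx.2
      · exact h'
    · exact hc.right_mem

theorem IsBernoulliHalf.explore_circ {μ : Measure Config} (hμ : IsBernoulliHalf μ)
    {x₁ y₀ y₁ t r : ℤ} (hr : 2 ≤ r) (hx : 4 * r ≤ x₁) (hy : y₀ ≤ t - 4 * r) (hy' : t + 4 * r ≤ y₁)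
    (s : Bool) (Z : Set Site) (Q : Set Site → Prop) (I O : Set Site) :
    circBd * μ.real {ω | Q (kap s (outside x₁ y₀ y₁ t r) Z ω) ∧
        ω ∈ arm (!s) (outside x₁ y₀ y₁ t r) I O} ≤
      μ.real {ω | Q (kap s (outside x₁ y₀ y₁ t r) Z ω) ∧
        ω ∈ arm (!s) (outside x₁ y₀ y₁ t r) I O ∧
        paint (nbhd (outside x₁ y₀ y₁ t r) Z (kap s (outside x₁ y₀ y₁ t r) Z ω)) (fun _ => !s) ω ∈
          circ (!s) t r} := by
  have := hμ.prob
  refine hμ.explore (D := outside x₁ y₀ y₁ t r) (S := rect 0 x₁ y₀ y₁) (finite_rect _ _ _ _)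
    Set.sdiff_subset s Z Q
    ((arm_depOn _ _ _ _).mono Set.sdiff_subset) (arm_incrC _ _ _ _) (fun κ =>
      {ω | paint (nbhd (outside x₁ y₀ y₁ t r) Z κ) (fun _ => !s) ω ∈ circ (!s) t r}) circBd
    fun ω _ => ⟨paint_incrC (arm_incrC _ _ _ _), paint_depOn ((arm_depOn _ _ _ _).mono ?_), ?_⟩
  · intro v hv
    have := hv.1
    simp only [mem_halfBall, rect, Set.mem_ofPred_eq] at this ⊢
    omega
  · refine (hμ.circ_ge (!s) t hr).trans (measureReal_mono (fun ω' h => ?_) (measure_ne_top _ _))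
    refine arm_incrC _ _ _ _ _ _ (fun v hv => ?_) h
    simp only [col, Set.mem_ofPred_eq] at hv ⊢
    by_cases h' : v ∈ nbhd (outside x₁ y₀ y₁ t r) Z (kap s (outside x₁ y₀ y₁ t r) Z ω)
    · rw [paint_of_mem h']
    · rw [paint_of_notMem h', hv]

/-- The painted circuit gives a path of explored or unexplored sites meeting the arm. -/
theorem painted_meets {x₁ y₀ y₁ t r : ℤ} (hr : 2 ≤ r) (hx : 4 * r ≤ x₁) (hy : y₀ ≤ t - 4 * r)
    (hy' : t + 4 * r ≤ y₁) {s : Bool} {Z : Set Site} {ω : Config} {a b : Site}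
    (hc : paint (nbhd (outside x₁ y₀ y₁ t r) Z (kap s (outside x₁ y₀ y₁ t r) Z ω)) (fun _ => !s) ω ∈
          circ (!s) t r) (ha : a ∈ rim t r) (hb : b ∈ far t (4 * r))
    (hab : Conn (col (!s) ω ∩ outside x₁ y₀ y₁ t r) a b) :
    ∃ u w : ℤ, t + r < u ∧ u ≤ t + 4 * r ∧ t - 4 * r ≤ w ∧ w < t - r ∧ ∀ p : ℤ, p = u ∨ p = w →
      (Conn (col (!s) ω ∩ outside x₁ y₀ y₁ t r) (0, p) a ∨
        ∃ c ∈ kap s (outside x₁ y₀ y₁ t r) Z ω, Conn (outside x₁ y₀ y₁ t r \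
          {x | Conn (col (!s) ω ∩ outside x₁ y₀ y₁ t r) a x}) (0, p) c) := by
  obtain ⟨⟨_, u⟩, ⟨rfl, hu⟩, ⟨_, w⟩, ⟨rfl, hw⟩, h⟩ := hc
  simp only at hu hw
  set ζ := col (!s) (paint (nbhd (outside x₁ y₀ y₁ t r) Z (kap s (outside x₁ y₀ y₁ t r) Z ω))
    (fun _ => !s) ω) ∩ halfAnn t r with hζ
  have hζD : ζ ⊆ outside x₁ y₀ y₁ t r := by
    intro v hv
    refine ⟨?_, hv.2.2⟩
    have := hv.2.1
    simp only [mem_halfBall, rect, Set.mem_ofPred_eq] at this ⊢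
    omega
  have hζK : ∀ x ∈ ζ, x ∈ kap s (outside x₁ y₀ y₁ t r) Z ω ∨ ω x = !s := by
    intro x hx
    by_cases hxK : x ∈ kap s (outside x₁ y₀ y₁ t r) Z ω
    · exact Or.inl hxK
    · by_cases hxN : x ∈ nbhd (outside x₁ y₀ y₁ t r) Z (kap s (outside x₁ y₀ y₁ t r) Z ω)
      · exact Or.inr (kap_nbhd hxN hxK)
      · have := hx.1
        simp only [col, Set.mem_ofPred_eq, paint_of_notMem hxN] at this
        exact Or.inr this
  obtain ⟨u₀, hu₀, hau⟩ := ha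
  obtain ⟨v, hv, hv'⟩ := circ_meets (s := t) (r := r) (by omega) (C := {x | Conn ζ (0, u) x})
    (T := {u₀} ∪ {x | Conn (col (!s) ω ∩ outside x₁ y₀ y₁ t r) a x}) (fun v hv => hv.right_mem.2)
    ⟨(0, u), ⟨rfl, hu⟩, (0, w), ⟨rfl, hw⟩, h.in_cluster⟩
    (by
      rintro v (rfl | hv)
      · exact hu₀.1
      · exact hv.right_mem.2.1.1)
    ⟨u₀, hu₀, b, hb, (Conn.of_adj (Or.inl rfl) (Or.inr (Conn.refl hab.left_mem)) hau).trans
      (Conn.mono Set.subset_union_right hab.in_cluster)⟩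
  have hv'' : Conn (col (!s) ω ∩ outside x₁ y₀ y₁ t r) a v := by
    rcases hv' with rfl | hv'
    · exact absurd hu₀ hv.right_mem.2.2
    · exact hv'
  refine ⟨u, w, hu, h.left_mem.2.1.2.2.2, h.right_mem.2.1.2.2.1, hw, fun p hp => ?_⟩
  refine Conn.reroute kap_subset hζD hζK (v := v) ?_ hv''
  rcases hp with rfl | rfl
  · exact hv
  · exact h.symm.trans hv

theorem IsBernoulliHalf.farArms_le {μ : Measure Config} (hμ : IsBernoulliHalf μ)
    {x₁ y₀ y₁ t r : ℤ} (hr : 2 ≤ r) (hx : 4 * r ≤ x₁) (hy : y₀ ≤ t - 4 * r)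
    (hy' : t + 4 * r ≤ y₁) :
    circBd ^ 2 * μ.real (farArms x₁ y₀ y₁ t r) ≤ μ.real (rootedArms x₁ y₀ y₁ t r) := by
  have := hμ.prob
  set D := outside x₁ y₀ y₁ t r with hD
  have hDr : D ⊆ rect 0 x₁ y₀ y₁ := Set.sdiff_subset
  have hBr : halfBall t r ⊆ rect 0 x₁ y₀ y₁ := by
    intro v hv
    simp only [mem_halfBall, rect, Set.mem_ofPred_eq] at hv ⊢
    omega
  have htB : ((0, t) : Site) ∈ halfBall t r := by
    simp only [mem_halfBall]; omega
  have hext : ∀ {M : Set Site} {a b : Site}, a ∈ rim t r → Conn M a b →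
      Conn (halfBall t r ∪ {x | Conn M a x}) (0, t) b := by
    rintro M a b ⟨u, hu, hua⟩ h
    exact ((Conn.mono Set.subset_union_left (conn_rect htB hu)).tail hua
      (Or.inr (Conn.refl h.left_mem))).trans (Conn.mono Set.subset_union_right h.in_cluster)
  have h1 := hμ.explore_circ hr hx hy hy' false {v | v.2 = y₀} (fun K => ∃ v ∈ K, v ∈ rim t r)
    (rim t r) {v | v.1 = x₁}
  have h2 := hμ.explore_circ hr hx hy hy' true {v | v.1 = x₁}
    (fun K => ∃ v ∈ K, v.1 = 0 ∧ t + r < v.2 ∧ v.2 ≤ t + 4 * r) (rim t r) {v | v.2 = y₀}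
  rw [← hD] at h1 h2
  simp only [Bool.not_true, Bool.not_false] at h1 h2
  have h12 : farArms x₁ y₀ y₁ t r ⊆ {ω | (∃ v ∈ kap false D {v | v.2 = y₀} ω, v ∈ rim t r) ∧
      ω ∈ arm true D (rim t r) {v | v.1 = x₁}} := by
    rintro ω ⟨h, a, ha, b, hb, hab⟩
    exact ⟨⟨a, ⟨b, hb, hab.symm⟩, ha⟩, h⟩
  refine le_trans ?_ (h2.trans (measureReal_mono ?_ (measure_ne_top _ _)))
  · rw [pow_two, mul_assoc]
    refine mul_le_mul_of_nonneg_left ?_ circBd_pos.le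
    refine (mul_le_mul_of_nonneg_left (measureReal_mono h12 (measure_ne_top _ _))
      circBd_pos.le).trans (h1.trans (measureReal_mono ?_ (measure_ne_top _ _)))
    rintro ω ⟨⟨v, ⟨z, hz, hzv⟩, hv⟩, ⟨a, ha, b, hb, hab⟩, hc⟩
    obtain ⟨u, _, hu, hu', -, -, hp⟩ := painted_meets hr hx hy hy' (s := false) hc ha
      (b := b) (Or.inl (by rw [show b.1 = x₁ from hb]; exact hx)) hab
    refine ⟨?_, v, hv, z, hz, hzv.symm⟩
    rcases hp u (Or.inl rfl) with h | ⟨c, ⟨z', hz', hzc⟩, h⟩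
    · exact ⟨(0, u), ⟨b, hb, (h.trans hab).symm⟩, rfl, hu, hu'⟩
    · exfalso
      obtain ⟨x, hx, hx'⟩ := (hext ha hab).leftRightBot (x₁ := x₁) (y₀ := y₀) (y₁ := y₁)
        (Set.union_subset hBr fun x hx => hDr hx.right_mem.2) hb
        (h.trans (Conn.mono (fun x hx => ⟨hx.2, fun h => col_ne h.right_mem.1 hx.1⟩) hzc.symm))
        (fun x hx => hDr hx.1) hz' (by omega)
      rcases hx with hx | hx
      · exact hx'.1.2 hx
      · exact hx'.2 hx
  · rintro ω ⟨⟨v, ⟨z, hz, hzv⟩, hv⟩, ⟨a, ha, b, hb, hab⟩, hc⟩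
    obtain ⟨_, w, -, -, hw', hw, hp⟩ := painted_meets hr hx hy hy' (s := true) hc ha
      (b := b) (Or.inr (Or.inr (by rw [show b.2 = y₀ from hb]; exact hy))) hab
    refine ⟨⟨v, hv, z, hz, hzv.symm⟩, ?_⟩
    rcases hp w (Or.inr rfl) with h | ⟨c, ⟨z', hz', hzc⟩, h⟩
    · exact ⟨(0, w), ⟨rfl, hw', hw⟩, b, hb, h.trans hab⟩
    · exfalso
      obtain ⟨x, hx', hx⟩ := (h.trans (Conn.mono
        (fun x hx => ⟨hx.2, fun h => col_ne hx.1 h.right_mem.1⟩) hzc.symm)).leftRightBot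
        (x₁ := x₁) (y₀ := y₀) (y₁ := y₁) (fun x hx => hDr hx.1) hz' (hext ha hab)
        (Set.union_subset hBr fun x hx => hDr hx.right_mem.2) hb (by omega)
      rcases hx with hx | hx
      · exact hx'.1.2 hx
      · exact hx'.2 hx

theorem rootedArms_shift {μ : Measure Config} (hμ : IsBernoulliHalf μ) (x₁ y₀ y₁ t r k : ℤ) :
    μ.real (rootedArms x₁ (y₀ + k) (y₁ + k) (t + k) r) = μ.real (rootedArms x₁ y₀ y₁ t r) := by
  rw [← hμ.real_map (shift 0 k) false (S := outside x₁ y₀ y₁ t r)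
    (A := rootedArms x₁ y₀ y₁ t r) (finite_outside _ _ _ _ _) ((arm_depOn _ _ _ _).inter (arm_depOn _ _ _ _))]
  congr 1
  ext ω
  refine (and_congr (comp_mem_arm (shift 0 k) (adj_shift 0 k) true ?_ ?_ ?_ ω)
    (comp_mem_arm (shift 0 k) (adj_shift 0 k) false ?_ ?_ ?_ ω)).symm
  all_goals
    intro v
    simp only [outside, mem_halfBall, rect, shift, Equiv.coe_fn_mk, Set.mem_ofPred_eq, Set.mem_sdiff]
    omega

theorem IsBernoulliHalf.rootedArms_le {μ : Measure Config} (hμ : IsBernoulliHalf μ)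
    {x₁ y₀ y₁ t r : ℤ} (hr : 2 ≤ r) (m : ℕ) (hm : 1 ≤ m) (hx : 64 * (r * m) < x₁)
    (hy : y₀ + 73 * (r * m) < t) :
    (m : ℝ) * μ.real (rootedArms x₁ y₀ y₁ t r) ≤ 1 / circBd := by
  have hrm : r ≤ r * m := le_mul_of_one_le_right (by omega) (by exact_mod_cast hm)
  set N := 16 * (r * m) with hN
  have hi : ∀ i ∈ Finset.range m, 0 ≤ r * (i : ℤ) ∧ r * (i : ℤ) + r ≤ r * m := by
    intro i hi
    have : (i : ℤ) + 1 ≤ m := by exact_mod_cast Finset.mem_range.1 hi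
    constructor <;> nlinarith
  have key := hμ.sum_arms_le true (G := rect 0 (4 * N) (t - 4 * N) (t + 4 * N))
    (S := rect 0 x₁ y₀ (y₁ + 9 * (r * m)) ∪ rect 0 (4 * N) (t - 4 * N) (t + 4 * N))
    (Inn := halfBall t N) (Out := far t (4 * N)) (finite_rect _ _ _ _)
    ((finite_rect _ _ _ _).union (finite_rect _ _ _ _)) (ρ := 1 - circBd)
    (by have := circBd_pos; linarith)
    (hμ.arm_le true t (by omega) fun v hv => hv.1) (Finset.range m)
    (fun i => rootedArms x₁ (y₀ + 9 * (r * i)) (y₁ + 9 * (r * i)) (t + 9 * (r * i)) r) (by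
      intro i hi'
      refine ((arm_depOn _ _ _ _).inter (arm_depOn _ _ _ _)).mono fun v hv => Or.inl ?_
      have h1 := hv.1
      have := hi i hi'
      simp only [rect, Set.mem_ofPred_eq] at h1 ⊢
      omega) (fun ω => ?_)
  · rw [sub_sub_cancel] at key
    refine le_trans (le_of_eq ?_) key
    simp [rootedArms_shift hμ]
  · have hch : ∀ i, ∃ a : Site, i ∈ Finset.range m →
        ω ∈ rootedArms x₁ (y₀ + 9 * (r * i)) (y₁ + 9 * (r * i)) (t + 9 * (r * i)) r →
        a.1 = 0 ∧ t + 9 * (r * i) + r < a.2 ∧ a.2 ≤ t + 9 * (r * i) + 4 * r ∧ a ∈ halfBall t N ∧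
        ∃ b ∈ far t (4 * N), Conn (col true ω ∩ rect 0 (4 * N) (t - 4 * N) (t + 4 * N)) a b := by
      intro i
      by_cases h : i ∈ Finset.range m ∧
        ω ∈ rootedArms x₁ (y₀ + 9 * (r * i)) (y₁ + 9 * (r * i)) (t + 9 * (r * i)) r
      · obtain ⟨a, ⟨ha1, ha2, ha3⟩, b, hb, hab⟩ := h.2.1
        have := hi i h.1
        have hb' : b.1 = x₁ := hb
        have ha4 : 0 ≤ a.1 ∧ a.1 ≤ 4 * N ∧ t - 4 * N ≤ a.2 ∧ a.2 ≤ t + 4 * N := by omega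
        obtain ⟨c, c', h1, h2, h3, h4, -⟩ := hab.exit
          (Q := rect 0 (4 * N) (t - 4 * N) (t + 4 * N)) ha4 (fun h => by have := h.2.1; omega)
        refine ⟨a, fun _ _ => ⟨ha1, ha2, ha3, by rw [mem_halfBall]; omega, c, ?_,
          h1.mono fun v hv => ⟨hv.1.1, hv.2⟩⟩⟩
        have h5 := h1.right_mem.2
        have h6 := h3.2.1.1
        rw [adj_iff] at h2
        simp only [rect, far, Set.mem_ofPred_eq] at h4 h5 h6 ⊢
        omega
      · exact ⟨0, fun h1 h2 => absurd ⟨h1, h2⟩ h⟩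
    choose a ha using hch
    have sep : ∀ i ∈ Finset.range m, ∀ j ∈ Finset.range m, i < j →
        ω ∈ rootedArms x₁ (y₀ + 9 * (r * i)) (y₁ + 9 * (r * i)) (t + 9 * (r * i)) r →
        ω ∈ rootedArms x₁ (y₀ + 9 * (r * j)) (y₁ + 9 * (r * j)) (t + 9 * (r * j)) r →
        ¬ Conn (col true ω ∩ rect 0 (4 * N) (t - 4 * N) (t + 4 * N)) (a i) (a j) := by
      intro i hi' j hj' hij h1 h2 hc
      have hij' : r * (i : ℤ) + r ≤ r * j := by
        have : (i : ℤ) + 1 ≤ j := by exact_mod_cast hij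
        nlinarith
      have h3 := ha i hi' h1
      have h4 := ha j hj' h2
      obtain ⟨⟨w1, w2⟩, ⟨hw1, hw2, hw3⟩, b, hb, hwb⟩ := h2.2
      have hjm := hi j hj'
      simp only at hw1 hw2 hw3
      subst hw1
      rw [show a i = (0, (a i).2) from Prod.ext h3.1 rfl,
        show a j = (0, (a j).2) from Prod.ext h4.1 rfl] at hc
      obtain ⟨x, hx, hx'⟩ := hc.leftSep Set.inter_subset_right hwb (fun v hv => hv.2.1.1)
        (fun h => by
          have h5 := h.2.2.1
          rw [show b.2 = _ from hb] at h5
          omega) (by omega) (by omega)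
      exact col_ne hx.1 hx'.1
    refine ⟨a, fun i h1 h2 => ⟨(ha i h1 h2).2.2.2.1, (ha i h1 h2).2.2.2.2⟩,
      fun i hi j hj hij h1 h2 hc => ?_⟩
    rcases lt_or_gt_of_ne hij with h | h
    · exact sep i hi j hj h h1 h2 hc
    · exact sep j hj i hi h h2 h1 hc.symm

/-- The event `farArms`, or the sure event when the half ball is not small. -/
def farArmsIf (n t r : ℤ) : Set Config := {ω | 150 * r ≤ n → ω ∈ farArms (2 * n) (-n) n t r}

theorem farArmsIf_depOn (n t r : ℤ) : DepOn (outside (2 * n) (-n) n t r) (farArmsIf n t r) :=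
  fun ω ω' h hω hr => ((arm_depOn _ _ _ _).inter (arm_depOn _ _ _ _)) ω ω' h (hω hr)

theorem IsBernoulliHalf.farArmsIf_le {μ : Measure Config} (hμ : IsBernoulliHalf μ) {n t r : ℤ}
    (hr : 2 ≤ r) (ht : -n ≤ 2 * t) (ht' : 2 * t ≤ n) :
    n * μ.real (farArmsIf n t r) ≤ 300 / circBd ^ 3 * r := by
  have := hμ.prob
  have hc := circBd_pos
  have hr' : (2 : ℝ) ≤ r := by exact_mod_cast hr
  have hn' : (0 : ℝ) ≤ n := by exact_mod_cast (by omega : 0 ≤ n)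
  rcases le_or_gt (150 * r) n with h | h
  · obtain ⟨m, hm⟩ : ∃ m : ℕ, (m : ℤ) = n / (150 * r) :=
      ⟨(n / (150 * r)).toNat, Int.toNat_of_nonneg (Int.ediv_nonneg (by omega) (by omega))⟩
    have hm1 : 1 ≤ m := by
      have : (1 : ℤ) ≤ m := by rw [hm]; exact (Int.le_ediv_iff_mul_le (by omega)).2 (by omega)
      exact_mod_cast this
    have hmn : 150 * (r * m) ≤ n := by
      have := Int.mul_ediv_self_le (x := n) (k := 150 * r) (by omega)
      rw [← hm] at this
      linarith
    have hnm : n ≤ 300 * (r * m) := by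
      have := Int.lt_mul_ediv_self_add (x := n) (k := 150 * r) (by omega)
      rw [← hm] at this
      have : r ≤ r * m := le_mul_of_one_le_right (by omega) (by exact_mod_cast hm1)
      linarith
    have hrm : r ≤ r * m := le_mul_of_one_le_right (by omega) (by exact_mod_cast hm1)
    have h1 := hμ.farArms_le (x₁ := 2 * n) (y₀ := -n) (y₁ := n) (t := t) hr (by omega) (by omega)
      (by omega)
    have h2 := hμ.rootedArms_le (x₁ := 2 * n) (y₀ := -n) (y₁ := n) (t := t) hr m hm1 (by omega)
      (by omega)
    have h3 : farArmsIf n t r = farArms (2 * n) (-n) n t r := by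
      ext ω
      exact ⟨fun hω => hω h, fun hω _ => hω⟩
    have hnm' : (n : ℝ) ≤ 300 * (r * m) := by exact_mod_cast hnm
    have h4 : (m : ℝ) * μ.real (farArms (2 * n) (-n) n t r) ≤ 1 / circBd ^ 3 := by
      rw [le_div_iff₀ (by positivity)]
      rw [le_div_iff₀ hc] at h2
      calc (m : ℝ) * μ.real (farArms (2 * n) (-n) n t r) * circBd ^ 3
          = m * (circBd ^ 2 * μ.real (farArms (2 * n) (-n) n t r)) * circBd := by ring
        _ ≤ m * μ.real (rootedArms (2 * n) (-n) n t r) * circBd := by gcongr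
        _ ≤ 1 := h2
    rw [h3]
    calc (n : ℝ) * μ.real (farArms (2 * n) (-n) n t r)
        ≤ 300 * (r * m) * μ.real (farArms (2 * n) (-n) n t r) := by gcongr
      _ = 300 * r * (m * μ.real (farArms (2 * n) (-n) n t r)) := by ring
      _ ≤ 300 * r * (1 / circBd ^ 3) := by gcongr
      _ = 300 / circBd ^ 3 * r := by ring
  · have h1 : (n : ℝ) ≤ 150 * r := by exact_mod_cast h.le
    have h2 : (300 : ℝ) ≤ 300 / circBd ^ 3 := by
      rw [le_div_iff₀ (by positivity)]
      have := pow_le_one₀ hc.le circBd_lt_one.le (n := 3)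
      linarith
    calc (n : ℝ) * μ.real (farArmsIf n t r) ≤ 150 * r * 1 := by
          gcongr
          exact measureReal_le_one
      _ ≤ 300 * r := by linarith
      _ ≤ 300 / circBd ^ 3 * r := by gcongr

/-! ### The structure of the lowest crossing near its starting point -/

theorem List.exists_split_last {α : Type*} {P : α → Prop} : ∀ {l : List α}, (∃ x ∈ l, P x) →
    ∃ d y g, l = d ++ y :: g ∧ P y ∧ ∀ x ∈ g, ¬ P x := by
  intro l
  induction l with
  | nil => simp
  | cons a l ih =>
    rintro ⟨x, hx, hP⟩
    by_cases h : ∃ x ∈ l, P x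
    · obtain ⟨d, y, g, rfl, h1, h2⟩ := ih h
      exact ⟨a :: d, y, g, rfl, h1, h2⟩
    · push Not at h
      rcases List.mem_cons.1 hx with rfl | hx
      · exact ⟨[], x, l, rfl, hP, h⟩
      · exact absurd hP (h x hx)

theorem exists_above_of_mem_onOrBelow {x₁ y₀ y₁ h : ℤ} {q : List Site}
    (hq : (0, h) ∈ OnOrBelow 0 x₁ y₀ y₁ q) : ∃ h', h ≤ h' ∧ (0, h') ∈ q := by
  by_contra hcon
  push Not at hcon
  obtain ⟨⟨h1, h2, h3, h4⟩, h5⟩ := hq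
  rcases h5 with h5 | h5
  · exact hcon h le_rfl h5
  · have hc : Conn (rect 0 x₁ y₀ y₁ \ {w | w ∈ q}) (0, h) (0, y₁) :=
      conn_vert h4 fun y hy hy' => ⟨⟨h1, h2, h3.trans hy, hy'⟩, hcon y hy⟩
    obtain ⟨r, hr, hr1, hr2⟩ := hc.exists_path
    exact h5 ⟨r, hr, hr1, (0, y₁), ⟨hc.right_mem.1, rfl⟩, hr2⟩

/-- An open crossing of a rectangle yields one made of sites adjacent to the closed cluster of the
bottom side. -/
theorem exists_botCrossing {x₁ y₀ y₁ t : ℤ} (hx : 1 ≤ x₁) {ω : Config} {b : Site} (hb : b.1 = x₁)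
    (h : Conn (col true ω ∩ rect 0 x₁ y₀ y₁) (0, t) b) :
    ∃ q, HorizCrossing 0 x₁ y₀ y₁ ω q ∧ ∀ v ∈ q, v ∈ botBoundary 0 x₁ y₀ y₁ ω := by
  have hK : ∀ j, t ≤ j → (0, j) ∉ botCluster 0 x₁ y₀ y₁ ω := by
    rintro j hj ⟨e, he, hje⟩
    rcases hj.eq_or_lt with rfl | hj
    · exact col_ne h.left_mem.1 hje.right_mem.1
    · obtain ⟨v, hv, hv'⟩ := h.leftRightBot (fun v hv => hv.2) hb hje.symm (fun v hv => hv.2) he hj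
      exact col_ne hv.1 hv'.1
  have ht := h.left_mem.2.2.2
  have hmem : ∀ j, (0, j) ∈ botCluster 0 x₁ y₀ y₁ ω → y₀ ≤ j := fun j hj => (kap_subset hj).2.2.2.1
  obtain ⟨s, hs0, hs1, hs2, hs3⟩ : ∃ s, y₀ ≤ s ∧ s ≤ t ∧
      ((0, s - 1) ∈ botCluster 0 x₁ y₀ y₁ ω ∨ s = y₀) ∧
      ∀ j, s ≤ j → (0, j) ∉ botCluster 0 x₁ y₀ y₁ ω := by
    by_cases hex : ∃ j, (0, j) ∈ botCluster 0 x₁ y₀ y₁ ω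
    · obtain ⟨j, hj, hj'⟩ := Int.exists_greatest_of_bdd
        (P := fun j => (0, j) ∈ botCluster 0 x₁ y₀ y₁ ω)
        ⟨t, fun z hz => by by_contra hc; exact hK z (by omega) hz⟩ hex
      have h1 := hmem j hj
      have h2 : j < t := by by_contra hc; exact hK j (by omega) hj
      exact ⟨j + 1, by omega, by omega, Or.inl (by simpa using hj),
        fun i hi hiK => by have := hj' i hiK; omega⟩
    · exact ⟨y₀, le_rfl, ht.1, Or.inr rfl, fun j _ hj => hex ⟨j, hj⟩⟩
  obtain ⟨z, hz, hc⟩ := botBoundary_conn hx hs0 (hs1.trans ht.2) hs2 hs3 (by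
    rintro v ⟨e, he, hje⟩
    by_contra hcon
    obtain ⟨w, hw, hw'⟩ := h.cross hje
      (fun w hw => ⟨hw.2.1, by rw [hb]; exact hw.2.2.1⟩)
      (fun w hw => ⟨by rw [Set.mem_ofPred_eq] at he; rw [he]; exact hw.2.2.2.1,
        by have := hw.2.2.2.2; omega⟩)
    exact col_ne hw.1 hw'.1)
  obtain ⟨q, hq, hq1, hq2⟩ := hc.exists_path
  exact ⟨q, ⟨⟨hq.1, fun v hv => (hq.2 v hv).1.2⟩, fun v hv => (hq.2 v hv).1.1,
    ⟨_, ⟨hc.left_mem.1.2, rfl⟩, hq1⟩, ⟨_, ⟨hc.right_mem.1.2, hz⟩, hq2⟩⟩, hq.2⟩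

/-- The last visit `(0, T)` of the lowest crossing to the left side is adjacent to a closed path to
the bottom; if `T` exceeds the height `t` of the starting point, it has three arms. -/
theorem IsLowestCrossing.structure {x₁ y₀ y₁ t : ℤ} (hx : 1 ≤ x₁) (hy : y₀ < t) {ω : Config}
    {p : List Site} (hp : IsLowestCrossing 0 x₁ y₀ y₁ ω p) (hh : p.head? = some (0, t)) :
    ∃ T, t ≤ T ∧ T ≤ y₁ ∧
      (∃ b : Site, b.1 = x₁ ∧ Conn (col true ω ∩ rect 0 x₁ y₀ y₁) (0, t) b) ∧
      (∃ u, Adj (0, T) u ∧ ∃ w : Site, w.2 = y₀ ∧ Conn (col false ω ∩ rect 0 x₁ y₀ y₁) u w) ∧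
      (t + 2 ≤ T → (0, T) ∈ col true ω ∧
        (∃ b : Site, b.1 = x₁ ∧ Conn (col true ω ∩ rect 1 x₁ y₀ y₁) (1, T) b) ∧
        (∃ w : Site, w.2 = y₀ ∧
          Conn ((col false ω ∩ rect 0 x₁ y₀ y₁) \ {v | v.1 = 0 ∧ t ≤ v.2}) (1, T - 1) w) ∧
        Conn ((col true ω ∩ rect 0 x₁ y₀ y₁) \ {v | v.1 = 0 ∧ T ≤ v.2}) (0, T - 1) (0, t)) := by
  obtain ⟨⟨hpR, hpo, -, ⟨b, hb, hpb⟩⟩, hlow⟩ := hp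
  have hpA : ∀ v ∈ p, v ∈ col true ω ∩ rect 0 x₁ y₀ y₁ := fun v hv => ⟨hpo v hv, hpR.2 v hv⟩
  have hpc : Conn (col true ω ∩ rect 0 x₁ y₀ y₁) (0, t) b := (hpR.conn hh hpb).mono hpA
  have hK : ∀ j, t ≤ j → (0, j) ∉ botCluster 0 x₁ y₀ y₁ ω := by
    rintro j hj ⟨e, he, hje⟩
    rcases hj.eq_or_lt with rfl | hj
    · exact col_ne hpc.left_mem.1 hje.right_mem.1
    · obtain ⟨v, hv, hv'⟩ := hpc.leftRightBot (fun v hv => hv.2) hb.2 hje.symm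
        (fun v hv => hv.2) he hj
      exact col_ne hv.1 hv'.1
  have htp : (0, t) ∈ p := List.mem_of_mem_head? hh
  obtain ⟨d, ⟨_, T⟩, g, hpd, hT0, hg0⟩ := List.exists_split_last (P := fun v : Site => v.1 = 0)
    ⟨_, htp, rfl⟩
  simp only at hT0
  subst hT0
  have hchain : (d ++ (0, T) :: g).IsChain Adj := hpd ▸ hpR.1.2.2
  have hnodup : (d ++ (0, T) :: g).Nodup := hpd ▸ hpR.1.2.1
  rw [List.isChain_append] at hchain
  obtain ⟨hcd, hcg, hcdg⟩ := hchain
  rw [List.nodup_append'] at hnodup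
  obtain ⟨-, hng, hdis⟩ := hnodup
  have hsub : ∀ v ∈ (0, T) :: g, v ∈ p := fun v hv => hpd ▸ List.mem_append_right _ hv
  have hsubd : ∀ v ∈ d, v ∈ p := fun v hv => hpd ▸ List.mem_append_left _ hv
  have hTp : (0, T) ∈ p := hsub _ List.mem_cons_self
  have hqb : ((0, T) :: g).getLast? = some b := by
    rw [hpd, List.getLast?_append] at hpb
    simpa using hpb
  have hq : HorizCrossing 0 x₁ y₀ y₁ ω ((0, T) :: g) :=
    ⟨⟨⟨by simp, hng, hcg⟩, fun v hv => hpR.2 v (hsub v hv)⟩, fun v hv => hpo v (hsub v hv),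
      ⟨_, ⟨hpR.2 _ hTp, rfl⟩, rfl⟩, ⟨b, hb, hqb⟩⟩
  have hq0 : ∀ h, (0, h) ∈ (0, T) :: g → h = T := by
    intro h hh'
    rcases List.mem_cons.1 hh' with h1 | h1
    · exact (Prod.mk.inj h1).2
    · exact absurd rfl (hg0 _ h1)
  have hmax : ∀ h, (0, h) ∈ p → h ≤ T := by
    intro h hh'
    obtain ⟨h', h1, h2⟩ := exists_above_of_mem_onOrBelow (hlow _ hq _ hh')
    rwa [hq0 _ h2] at h1
  have htT := hmax t htp
  have hTR := hpR.2 _ hTp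
  have hqc : Conn {v | v ∈ (0, T) :: g} (0, T) b := hq.1.conn rfl hqb
  have habove : ∀ j, T < j → ∀ u, Adj (0, j) u → u ∉ botCluster 0 x₁ y₀ y₁ ω := by
    rintro j hj u hju ⟨e, he, hue⟩
    obtain ⟨v, hv, hv'⟩ := hqc.leftRightBot (x₁ := x₁) (y₀ := y₀) (y₁ := max y₁ j)
      (fun v hv => by
        have := hq.1.2 v hv
        simp only [rect, Set.mem_ofPred_eq] at this ⊢
        omega) hb.2
      (T := {(0, j)} ∪ (col false ω ∩ rect 0 x₁ y₀ y₁))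
      ((Conn.of_adj (Or.inl rfl) (Or.inr hue.right_mem) hju).trans
        (Conn.mono Set.subset_union_right hue.symm))
      (by
        rintro v (rfl | hv)
        · simp only [rect, Set.mem_ofPred_eq] at hTR ⊢; omega
        · have := hv.2
          simp only [rect, Set.mem_ofPred_eq] at this ⊢
          omega) he hj
    rcases hv' with rfl | hv'
    · have := hq0 _ hv; omega
    · exact col_ne (hq.2.1 v hv) hv'.1
  obtain ⟨u, huK, hu⟩ : ∃ u ∈ botCluster 0 x₁ y₀ y₁ ω, Adj (0, T) u := by
    obtain ⟨q', hq', hq'A⟩ := exists_botCrossing hx hb.2 hpc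
    obtain ⟨h', h1, h2⟩ := exists_above_of_mem_onOrBelow (hlow _ hq' _ hTp)
    rcases (hq'A _ h2).2 with h3 | ⟨u, hu, hu'⟩
    · simp only at h3; omega
    · rcases h1.eq_or_lt with rfl | h1
      · exact ⟨u, hu, hu'.symm⟩
      · exact absurd hu (habove h' h1 u hu'.symm)
  refine ⟨T, htT, hTR.2.2.2, ⟨b, hb.2, hpc⟩, ⟨u, hu, ?_⟩, fun hk => ?_⟩
  · obtain ⟨w, hw, hwu⟩ := huK
    exact ⟨w, hw, hwu.symm⟩
  have huA := kap_subset huK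
  have hu' : u = (1, T) ∨ u = (1, T - 1) := by
    obtain ⟨u1, u2⟩ := u
    have h1 := huA.2.1
    have h2 : u1 = 0 → u2 < t := by
      rintro rfl
      by_contra hc
      exact hK u2 (by omega) huK
    rw [adj_iff] at hu
    simp only [Prod.mk.injEq] at *
    omega
  have hu1 : u = (1, T - 1) := by
    rcases hu' with rfl | h
    · exact absurd huK (habove (T + 1) (by omega) _ (by simp [adj_iff]))
    · exact h
  subst hu1
  obtain - | ⟨g₀, g⟩ := g
  · simp only [List.getLast?_singleton, Option.some.injEq] at hqb
    subst hqb
    have := hb.2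
    simp only at this
    omega
  rw [List.isChain_cons_cons] at hcg
  have hg₀ : g₀ = (1, T) := by
    obtain ⟨a1, a2⟩ := g₀
    have h1 := hg0 _ List.mem_cons_self
    have h2 := (hpR.2 _ (hsub _ (List.mem_cons_of_mem _ List.mem_cons_self))).1
    have h3 : ¬ (a1 = 1 ∧ a2 = T - 1) := by
      rintro ⟨rfl, rfl⟩
      exact col_ne (hpA _ (hsub _ (List.mem_cons_of_mem _ List.mem_cons_self))).1 huA.1
    have h4 := hcg.1
    rw [adj_iff] at h4
    simp only [Prod.mk.injEq] at *
    omega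
  subst hg₀
  rw [List.getLast?_cons_cons] at hqb
  refine ⟨(hpA _ hTp).1, ⟨b, hb.2, Conn.of_isChain hcg.2 (fun v hv => ?_) rfl hqb⟩, ?_, ?_⟩
  · have h1 := hpA v (hsub _ (List.mem_cons_of_mem _ hv))
    have h2 := hg0 v hv
    have h3 := h1.2.1
    exact ⟨h1.1, by omega, h1.2.2⟩
  · obtain ⟨w, hw, hwu⟩ := huK
    refine ⟨w, hw, (Conn.mono (T := (col false ω ∩ rect 0 x₁ y₀ y₁) \ {v | v.1 = 0 ∧ t ≤ v.2})
      (fun x hx => ⟨Conn.right_mem hx, ?_⟩) hwu.in_cluster).symm⟩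
    rintro ⟨h1, h2⟩
    refine hK x.2 h2 ⟨w, hw, ?_⟩
    rwa [show ((0, x.2) : Site) = x from Prod.ext h1.symm rfl]
  · obtain rfl | ⟨d', e, rfl⟩ := List.eq_nil_or_concat' d
    · rw [hpd] at hh
      simp only [List.nil_append, List.head?_cons, Option.some.injEq, Prod.mk.injEq] at hh
      omega
    have he : e = (0, T - 1) := by
      have h1 : e ∈ d' ++ [e] := by simp
      have h2 := hpA _ (hsubd _ h1)
      have h3 : e ≠ (1, T - 1) := by
        rintro rfl
        exact col_ne h2.1 huA.1
      have h4 : e ≠ (1, T) := by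
        rintro rfl
        exact hdis h1 (by simp)
      have h5 := hcdg e (by simp) (0, T) (by simp)
      obtain ⟨e1, e2⟩ := e
      have h6 := h2.2.1
      have h7 : e1 = 0 → e2 ≤ T := by
        rintro rfl
        exact hmax _ (hsubd _ h1)
      rw [adj_iff] at h5
      simp only [Prod.mk.injEq, ne_eq] at *
      omega
    subst he
    refine (Conn.of_isChain (S := (col true ω ∩ rect 0 x₁ y₀ y₁) \ {v | v.1 = 0 ∧ T ≤ v.2})
      (b := (0, T - 1)) hcd (fun v hv => ⟨hpA v (hsubd v hv), ?_⟩) ?_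
      (by simp)).symm
    · rintro ⟨h1, h2⟩
      obtain ⟨v1, v2⟩ := v
      simp only at h1 h2
      subst h1
      have := hmax _ (hsubd _ hv)
      obtain rfl : v2 = T := by omega
      exact hdis hv (by simp)
    · rw [hpd, List.append_assoc] at hh
      rw [← hh]
      cases d' <;> simp

/-! ### The upper bound -/

theorem Conn.to_border {M : Set Site} {u v : Site} {a a' b b' : ℤ} (h : Conn M u v)
    (hM : ∀ x ∈ M, a ≤ x.1) (hu : u ∈ rect a a' b b') (hv : v ∉ rect a a' b b') :
    ∃ c : Site, (c.1 = a' ∨ c.2 = b ∨ c.2 = b') ∧ Conn (M ∩ rect a a' b b') u c := by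
  obtain ⟨c, c', h1, h2, h3, h4, -⟩ := h.exit hu hv
  refine ⟨c, ?_, h1⟩
  have h5 := h1.right_mem.2
  have h6 := hM _ h3
  rw [adj_iff] at h2
  simp only [rect, Set.mem_ofPred_eq] at h4 h5
  omega

theorem Conn.arm_rim {ω : Config} {s : Bool} {x₁ y₀ y₁ t r : ℤ} {u v : Site}
    (h : Conn (col s ω ∩ rect 0 x₁ y₀ y₁) u v) (hu : u ∈ halfBall t r) (hv : v ∉ halfBall t r)
    {O : Set Site} (hO : v ∈ O) : ω ∈ arm s (outside x₁ y₀ y₁ t r) (rim t r) O := by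
  obtain ⟨c, c', h1, h2, -, h4, -⟩ := h.symm.exit (Q := (halfBall t r)ᶜ) hv (fun h => h hu)
  exact ⟨c, ⟨c', not_not.mp h4, h2.symm⟩, v, hO, h1.symm.mono fun x hx => ⟨hx.1.1, hx.1.2, hx.2⟩⟩

/-- The event that the lowest crossing starts from `(0, t)` and last visits the left side at
height `t + k`, through its consequences in three disjoint regions, with `4 ^ (J + 1) ≤ k`. -/
def scaleEvent (n t : ℤ) (J : ℕ) (k : ℤ) : Set Config :=
  arm true (rect 0 (2 * 4 ^ J) (t - 2 * 4 ^ J) (t + 2 * 4 ^ J)) {(0, t)} (far t (2 * 4 ^ J)) ∩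
    (threeArm 0 (t + k) (4 ^ J) ∩ farArmsIf n t (32 * 4 ^ J))

theorem scaleEvent_le {μ : Measure Config} (hμ : IsBernoulliHalf μ) {n t k : ℤ} {J : ℕ}
    (ht : -n ≤ 2 * t) (ht' : 2 * t ≤ n) (hk : 4 * 4 ^ J ≤ k) (hk' : k ≤ 16 * 4 ^ J) :
    12 * 4 ^ J * (n * μ.real (scaleEvent n t J k)) ≤
      149299200 / circBd ^ 4 * (1 - circBd) ^ J := by
  have := hμ.prob
  have hc := circBd_pos
  have hc1 := circBd_lt_one
  have hpos : (1 : ℤ) ≤ 4 ^ J := one_le_pow₀ (by norm_num)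
  have hd1 := threeArm_depOn (a := 0) (b := t + k) (R := 4 ^ J) (by omega)
  have hd2 := farArmsIf_depOn n t (32 * 4 ^ J)
  have hd0 := arm_depOn true (rect 0 (2 * 4 ^ J) (t - 2 * 4 ^ J) (t + 2 * 4 ^ J)) {(0, t)}
    (far t (2 * 4 ^ J))
  have e1 : μ.real (threeArm 0 (t + k) (4 ^ J) ∩ farArmsIf n t (32 * 4 ^ J)) =
      μ.real (threeArm 0 (t + k) (4 ^ J)) * μ.real (farArmsIf n t (32 * 4 ^ J)) := by
    refine hμ.indep (finite_rect _ _ _ _) (finite_outside _ _ _ _ _) ?_ hd1 hd2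
    rw [Set.disjoint_left]
    intro v hv hv'
    have := hv'.2
    simp only [mem_halfBall, rect, Set.mem_ofPred_eq] at hv this
    omega
  have e2 : μ.real (scaleEvent n t J k) = μ.real (arm true (rect 0 (2 * 4 ^ J) (t - 2 * 4 ^ J)
      (t + 2 * 4 ^ J)) {(0, t)} (far t (2 * 4 ^ J))) *
      (μ.real (threeArm 0 (t + k) (4 ^ J)) * μ.real (farArmsIf n t (32 * 4 ^ J))) := by
    rw [← e1]
    refine hμ.indep (finite_rect _ _ _ _) ((finite_rect _ _ _ _).union (finite_outside _ _ _ _ _))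
      ?_ hd0 ((hd1.mono Set.subset_union_left).inter (hd2.mono Set.subset_union_right))
    rw [Set.disjoint_left]
    rintro v hv (hv' | hv')
    · simp only [rect, Set.mem_ofPred_eq] at hv hv'
      omega
    · have := hv'.2
      simp only [mem_halfBall, rect, Set.mem_ofPred_eq] at hv this
      omega
  have b0 := hμ.one_arm_le true t (G := rect 0 (2 * 4 ^ J) (t - 2 * 4 ^ J) (t + 2 * 4 ^ J))
    (fun v hv => hv.1) J
  have b1 := hμ.threeArm_le 0 (t + k) (R := 4 ^ J) hpos
  have b2 := hμ.farArmsIf_le (n := n) (t := t) (r := 32 * 4 ^ J) (by omega) ht ht'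
  push_cast at b1 b2
  rw [e2]
  set x := μ.real (arm true (rect 0 (2 * 4 ^ J) (t - 2 * 4 ^ J)
      (t + 2 * 4 ^ J)) {(0, t)} (far t (2 * 4 ^ J)))
  set y := μ.real (threeArm 0 (t + k) (4 ^ J))
  set z := μ.real (farArmsIf n t (32 * 4 ^ J))
  have hx : 0 ≤ x := measureReal_nonneg
  have hy : 0 ≤ y := measureReal_nonneg
  have hz : 0 ≤ z := measureReal_nonneg
  have hn : (0 : ℝ) ≤ n := by exact_mod_cast (by omega : 0 ≤ n)
  have hp : (0 : ℝ) < 4 ^ J := by positivity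
  have b3 : (n : ℝ) * z ≤ 9600 / circBd ^ 3 * 4 ^ J := by
    refine b2.trans (le_of_eq ?_)
    ring
  calc 12 * 4 ^ J * ((n : ℝ) * (x * (y * z))) = 12 * 4 ^ J * (x * y * (n * z)) := by ring
    _ ≤ 12 * 4 ^ J * ((1 - circBd) ^ J * y * (9600 / circBd ^ 3 * 4 ^ J)) := by gcongr
    _ = 115200 / circBd ^ 3 * (1 - circBd) ^ J * ((4 ^ J) ^ 2 * y) := by ring
    _ ≤ 115200 / circBd ^ 3 * (1 - circBd) ^ J * (1296 / circBd) := by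
        have : (0 : ℝ) ≤ 1 - circBd := by linarith
        gcongr
    _ = 149299200 / circBd ^ 4 * (1 - circBd) ^ J := by
        field_simp
        ring

theorem lowest_subset {n : ℕ} (hn : 1 ≤ n) {t : ℤ} (ht : -(n : ℤ) ≤ 2 * t) :
    {ω | ∃ p, IsLowestCrossing 0 (2 * n) (-(n : ℤ)) n ω p ∧ p.head? = some (0, t)} ⊆
      farArmsIf n t 5 ∪ ⋃ J ∈ Finset.range (2 * n),
        ⋃ k ∈ Finset.Ico (4 * 4 ^ J : ℤ) (16 * 4 ^ J), scaleEvent n t J k := by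
  rintro ω ⟨p, hp, hh⟩
  obtain ⟨T, hT, hT', ⟨b, hb, hbc⟩, ⟨u, hu, w, hw, huw⟩, h⟩ := hp.structure (by omega) (by omega) hh
  have hfar : ∀ r : ℤ, T + 1 - t ≤ r → ω ∈ farArmsIf n t r := by
    intro r hr h150
    refine ⟨hbc.arm_rim (mem_halfBall.2 (by simp only; omega)) (fun h => ?_) hb,
      huw.arm_rim (mem_halfBall.2 ?_) (fun h => ?_) hw⟩
    · rw [mem_halfBall] at h; omega
    · have := huw.left_mem.2.1
      rw [adj_iff] at hu
      simp only at hu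
      omega
    · rw [mem_halfBall] at h; omega
  rcases lt_or_ge T (t + 4) with hk | hk
  · exact Or.inl (hfar 5 (by omega))
  right
  obtain ⟨hTo, ⟨b₁, hb₁, h1⟩, ⟨b₂, hb₂, h2⟩, h3⟩ := h (by omega)
  obtain ⟨k, rfl⟩ : ∃ k : ℕ, T = t + k := ⟨(T - t).toNat, by omega⟩
  have hk4 : 4 ≤ k := by omega
  obtain ⟨J, hJ⟩ : ∃ J, Nat.log 4 k = J + 1 := by
    have : 0 < Nat.log 4 k := Nat.log_pos (by norm_num) hk4
    exact ⟨Nat.log 4 k - 1, by omega⟩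
  have hJ1 : 4 * 4 ^ J ≤ k := by
    have := Nat.pow_log_le_self 4 (x := k) (by omega)
    rw [hJ, pow_succ] at this
    omega
  have hJ2 : k < 16 * 4 ^ J := by
    have := Nat.lt_pow_succ_log_self (b := 4) (by norm_num) k
    rw [hJ, pow_succ, pow_succ] at this
    omega
  have hJk : J < 4 ^ J := Nat.lt_pow_self (by norm_num)
  have hJ1' : 4 * 4 ^ J ≤ (k : ℤ) := by exact_mod_cast hJ1
  have hJ2' : (k : ℤ) < 16 * 4 ^ J := by exact_mod_cast hJ2
  have hpos : (1 : ℤ) ≤ 4 ^ J := one_le_pow₀ (by norm_num)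
  refine Set.mem_biUnion (x := J) (Finset.mem_coe.2 (Finset.mem_range.2 (by omega)))
    (Set.mem_biUnion (x := (k : ℤ)) (Finset.mem_coe.2 (Finset.mem_Ico.2 ⟨hJ1', hJ2'⟩)) ?_)
  refine ⟨?_, ⟨⟨?_, ?_⟩, ?_, ?_⟩, hfar _ (by omega)⟩
  · obtain ⟨c, hc, hcc⟩ := hbc.to_border (a := 0) (a' := 2 * 4 ^ J) (b := t - 2 * 4 ^ J)
      (b' := t + 2 * 4 ^ J) (fun x hx => hx.2.1)
      (by simp only [rect, Set.mem_ofPred_eq]; omega)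
      (by simp only [rect, Set.mem_ofPred_eq]; omega)
    refine ⟨_, rfl, c, ?_, hcc.mono fun x hx => ⟨hx.1.1, hx.2⟩⟩
    simp only [far, Set.mem_ofPred_eq]
    omega
  · obtain ⟨c, hc, hcc⟩ := h1.to_border (a := 0 + 1) (a' := 0 + 4 ^ J) (b := t + k - 4 ^ J)
      (b' := t + k + 4 ^ J) (fun x hx => by have := hx.2.1; omega)
      (by simp only [rect, Set.mem_ofPred_eq]; omega)
      (by simp only [rect, Set.mem_ofPred_eq]; omega)
    exact ⟨_, rfl, c, hc, hcc.mono fun x hx => ⟨hx.1.1, hx.2⟩⟩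
  · obtain ⟨c, hc, hcc⟩ := h2.to_border (a := 0) (a' := 0 + 4 ^ J) (b := t + k - 4 ^ J)
      (b' := t + k + 4 ^ J) (fun x hx => hx.1.2.1)
      (by simp only [rect, Set.mem_ofPred_eq]; omega)
      (by simp only [rect, Set.mem_ofPred_eq]; omega)
    refine ⟨_, rfl, c, hc, hcc.mono fun x hx => ⟨hx.1.1.1, ?_⟩⟩
    have h4 := hx.1.2
    have h5 := hx.2
    simp only [rect, Set.mem_ofPred_eq] at h4 h5 ⊢
    omega
  · obtain ⟨c, hc, hcc⟩ := h3.to_border (a := 0) (a' := 0 + 4 ^ J) (b := t + k - 4 ^ J)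
      (b' := t + k + 4 ^ J) (fun x hx => hx.1.2.1)
      (by simp only [rect, Set.mem_ofPred_eq]; omega)
      (by simp only [rect, Set.mem_ofPred_eq]; omega)
    exact ⟨_, rfl, c, hc, hcc.mono fun x hx => ⟨hx.1.1.1, hx.2, hx.1.2⟩⟩
  · exact ⟨_, rfl, _, rfl, Conn.refl ⟨hTo, rfl⟩⟩

theorem lowest_le {μ : Measure Config} (hμ : IsBernoulliHalf μ) {n : ℕ} (hn : 1 ≤ n) {t : ℤ}
    (ht : -(n : ℤ) ≤ 2 * t) (ht' : 2 * t ≤ n) :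
    n * μ.real {ω | ∃ p, IsLowestCrossing 0 (2 * n) (-(n : ℤ)) n ω p ∧ p.head? = some (0, t)} ≤
      1500 / circBd ^ 3 + 149299200 / circBd ^ 5 := by
  have := hμ.prob
  have hc := circBd_pos
  have hc1 := circBd_lt_one
  have b1 := hμ.farArmsIf_le (n := n) (t := t) (r := 5) (by norm_num) ht ht'
  have b2 : ∀ J : ℕ, n * μ.real (⋃ k ∈ Finset.Ico (4 * 4 ^ J : ℤ) (16 * 4 ^ J),
      scaleEvent n t J k) ≤ 149299200 / circBd ^ 4 * (1 - circBd) ^ J := by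
    intro J
    have hp : (0 : ℝ) < 12 * 4 ^ J := by positivity
    have hcard : ((Finset.Ico (4 * 4 ^ J : ℤ) (16 * 4 ^ J)).card : ℝ) = 12 * 4 ^ J := by
      have : (16 * 4 ^ J - 4 * 4 ^ J : ℤ) = ((12 * 4 ^ J : ℕ) : ℤ) := by push_cast; ring
      rw [Int.card_Ico, this, Int.toNat_natCast]
      push_cast
      rfl
    calc (n : ℝ) * μ.real (⋃ k ∈ Finset.Ico (4 * 4 ^ J : ℤ) (16 * 4 ^ J), scaleEvent n t J k)
        ≤ n * ∑ k ∈ Finset.Ico (4 * 4 ^ J : ℤ) (16 * 4 ^ J), μ.real (scaleEvent n t J k) := by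
          gcongr
          exact measureReal_biUnion_finset_le _ _
      _ = ∑ k ∈ Finset.Ico (4 * 4 ^ J : ℤ) (16 * 4 ^ J), n * μ.real (scaleEvent n t J k) :=
          Finset.mul_sum _ _ _
      _ ≤ ∑ k ∈ Finset.Ico (4 * 4 ^ J : ℤ) (16 * 4 ^ J),
          149299200 / circBd ^ 4 * (1 - circBd) ^ J / (12 * 4 ^ J) := by
          refine Finset.sum_le_sum fun k hk => ?_
          rw [Finset.mem_Ico] at hk
          have := scaleEvent_le hμ ht ht' hk.1 hk.2.le
          rw [le_div_iff₀ hp, mul_comm]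
          exact_mod_cast this
      _ = 149299200 / circBd ^ 4 * (1 - circBd) ^ J := by
          rw [Finset.sum_const, nsmul_eq_mul, hcard]
          field_simp
  have hgeom : ∑ J ∈ Finset.range (2 * n), (1 - circBd) ^ J ≤ 1 / circBd := by
    have h := geom_sum_mul_neg (1 - circBd) (2 * n)
    rw [sub_sub_cancel] at h
    rw [le_div_iff₀ hc, h]
    have : 0 ≤ (1 - circBd) ^ (2 * n) := pow_nonneg (by linarith) _
    linarith
  calc _ ≤ n * (μ.real (farArmsIf n t 5) + ∑ J ∈ Finset.range (2 * n),
        μ.real (⋃ k ∈ Finset.Ico (4 * 4 ^ J : ℤ) (16 * 4 ^ J), scaleEvent n t J k)) := by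
        gcongr
        refine (measureReal_mono (lowest_subset hn ht) (measure_ne_top _ _)).trans
          ((measureReal_union_le _ _).trans ?_)
        gcongr
        exact measureReal_biUnion_finset_le _ _
    _ = n * μ.real (farArmsIf n t 5) + ∑ J ∈ Finset.range (2 * n),
        n * μ.real (⋃ k ∈ Finset.Ico (4 * 4 ^ J : ℤ) (16 * 4 ^ J), scaleEvent n t J k) := by
        rw [mul_add, Finset.mul_sum]
    _ ≤ 300 / circBd ^ 3 * 5 + ∑ J ∈ Finset.range (2 * n),
        149299200 / circBd ^ 4 * (1 - circBd) ^ J := by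
        refine add_le_add ?_ (Finset.sum_le_sum fun J _ => b2 J)
        exact_mod_cast b1
    _ = 1500 / circBd ^ 3 + 149299200 / circBd ^ 4 *
        ∑ J ∈ Finset.range (2 * n), (1 - circBd) ^ J := by
        rw [← Finset.mul_sum]
        ring
    _ ≤ 1500 / circBd ^ 3 + 149299200 / circBd ^ 4 * (1 / circBd) := by gcongr
    _ = _ := by
        field_simp

/-- There exist constants `0 < c ≤ C < ∞` such that for all integers `n ≥ 1`
and all `y = (0,t) ∈ Γ_{H(n)}` (i.e. `-n/2 ≤ t ≤ n/2`),
`c/n ≤ P(L(y, H(n))) ≤ C/n`, where `H(n) = [0,2n] × [-n,n]` and `L(y,H(n))` is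
the event that the lowest horizontal open crossing of `H(n)` exists and starts
from `y`. -/
theorem statement13 :
    ∃ c C : ℝ≥0∞, 0 < c ∧ c ≤ C ∧ C < ⊤ ∧
      ∀ μ : Measure Config, IsBernoulliHalf μ →
        ∀ n : ℕ, 1 ≤ n → ∀ t : ℤ, -(n : ℤ) ≤ 2 * t → 2 * t ≤ (n : ℤ) →
          c / (n : ℝ≥0∞) ≤
              μ {ω | ∃ p, IsLowestCrossing 0 (2 * n) (-(n : ℤ)) n ω p ∧
                  p.head? = some (0, t)} ∧
            μ {ω | ∃ p, IsLowestCrossing 0 (2 * n) (-(n : ℤ)) n ω p ∧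
                  p.head? = some (0, t)} ≤ C / (n : ℝ≥0∞) := by
  set c : ℝ := min (doubling 5 ^ 3) ((1 / 2) ^ 961)
  set C : ℝ := 1500 / circBd ^ 3 + 149299200 / circBd ^ 5
  have hc : 0 < c := lt_min (pow_pos (doubling_pos _) 3) (by positivity)
  refine ⟨ENNReal.ofReal c, ENNReal.ofReal (max c C), ENNReal.ofReal_pos.2 hc,
    ENNReal.ofReal_le_ofReal (le_max_left _ _), ENNReal.ofReal_lt_top, ?_⟩
  intro μ hμ n hn t ht ht'
  have := hμ.prob
  have hn0 : (n : ℝ≥0∞) ≠ 0 := by exact_mod_cast (by omega : n ≠ 0)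
  have hmul : ∀ S : Set Config, (n : ℝ≥0∞) * μ S = ENNReal.ofReal (n * μ.real S) := fun S => by
    rw [ENNReal.ofReal_mul (Nat.cast_nonneg n), ENNReal.ofReal_natCast, ofReal_measureReal]
  constructor
  · refine ENNReal.div_le_of_le_mul' ?_
    rw [hmul]
    refine ENNReal.ofReal_le_ofReal ((hμ.lowStart_ge (n := n) (t := t) (by omega) ht ht').trans ?_)
    rw [Int.cast_natCast]
    gcongr
    · exact measure_ne_top _ _
    · exact fun ω hω => lowest_of_lowStart (by omega) (by omega) (by omega) hω
  · rw [ENNReal.le_div_iff_mul_le (Or.inl hn0) (Or.inl (ENNReal.natCast_ne_top n)), mul_comm, hmul]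
    exact ENNReal.ofReal_le_ofReal ((lowest_le hμ hn ht ht').trans (le_max_right _ _))
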